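/- arXiv:2311.00095 — 4 statements merged into one kernel-verified Lean document; each statement's English description precedes it below -/
import Mathlib

section
/- Fix μ > 0. Let P⁰(r) := −2 log(1+r²) and Q⁰(r) := 8/(1+r²)². There exist ε₀ > 0 and α₀ ∈ (0,1) such that for every ε ∈ (0, ε₀), every α ∈ (α₀, 1), every radial stationary profile P for the parameters (μ, ε) with associated cell-density profile Q(r) := 8 e^{P(r) − μ r²/2}, and every r > 0 the following strict inequalities hold: (1) P⁰(r) − μαr²/2 < P(r) − μαr²/2 < P⁰(r) < P(r) < 0; (2) r P'(r) − μαr² < r (P⁰)'(r) < r P'(r) < 0; (3) Q⁰(r) e^{−μ r²/2} < Q(r) < Q⁰(r) e^{−μ(1−α) r²/2}. -/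
open Real Set

noncomputable section

/-- Derivative on `[0,∞)`. -/
def Dr (P : ℝ → ℝ) : ℝ → ℝ := fun r => derivWithin P (Set.Ici 0) r

/-- A radial stationary profile for the parameters `(μ, ε)`: a `C²` function on `[0,∞)`
with `P(0) = P'(0) = 0` solving `P'' + (1/r + μεr) P' = −8 e^{P − μr²/2}` for `r > 0`. -/
def IsRadialProfile (μ ε : ℝ) (P : ℝ → ℝ) : Prop :=
  ContDiffOn ℝ 2 P (Set.Ici 0) ∧ P 0 = 0 ∧ Dr P 0 = 0 ∧
    ∀ r > (0:ℝ),
      Dr (Dr P) r + (1 / r + μ * ε * r) * Dr P r = -8 * Real.exp (P r - μ * r ^ 2 / 2)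

/-- The associated cell-density profile `Q(r) = 8 e^{P(r) − μr²/2}`. -/
def profQ (μ : ℝ) (P : ℝ → ℝ) (r : ℝ) : ℝ := 8 * Real.exp (P r - μ * r ^ 2 / 2)

/-- The explicit `ε = 0` chemical profile `P⁰(r) = −2 log(1+r²)`. -/
def P0fun (r : ℝ) : ℝ := -2 * Real.log (1 + r ^ 2)

/-- The explicit `ε = 0` cell-density profile `Q⁰(r) = 8/(1+r²)²`. -/
def Q0fun (r : ℝ) : ℝ := 8 / (1 + r ^ 2) ^ 2

theorem mono_aux {f f' : ℝ → ℝ} (hc : ContinuousOn f (Set.Ici 0))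
    (hd : ∀ x > (0:ℝ), HasDerivAt f (f' x) x) (hp : ∀ x > (0:ℝ), 0 < f' x) :
    StrictMonoOn f (Set.Ici 0) := by
  apply strictMonoOn_of_deriv_pos (convex_Ici 0) hc
  intro x hx
  rw [interior_Ici] at hx
  rw [(hd x hx).deriv]
  exact hp x hx

theorem pos_aux {f f' : ℝ → ℝ} (hc : ContinuousOn f (Set.Ici 0)) (h0 : f 0 = 0)
    (hd : ∀ x > (0:ℝ), HasDerivAt f (f' x) x) (hp : ∀ x > (0:ℝ), 0 < f' x) :
    ∀ x > (0:ℝ), 0 < f x := by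
  intro x hx
  have := mono_aux hc hd hp (Set.mem_Ici.2 le_rfl) (Set.mem_Ici.2 hx.le) hx
  rwa [h0] at this

theorem P0_deriv (r : ℝ) : HasDerivAt P0fun (-4 * r / (1 + r ^ 2)) r := by
  have h1 : HasDerivAt (fun r : ℝ => 1 + r ^ 2) (2 * r) r := by
    simpa using (hasDerivAt_pow 2 r).const_add 1
  have h2 := (h1.log (by positivity)).const_mul (-2)
  refine HasDerivAt.congr_deriv h2 ?_
  ring

theorem exp_P0 (r : ℝ) : Real.exp (P0fun r) = 1 / (1 + r ^ 2) ^ 2 := by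
  have h : (0:ℝ) < 1 + r ^ 2 := by positivity
  have : P0fun r = -(Real.log ((1 + r ^ 2) ^ 2)) := by
    rw [Real.log_pow]; simp [P0fun]
  rw [this, Real.exp_neg, Real.exp_log (by positivity), one_div]

/-- The comparison `m < 4 r² / (1 + r²)` for the mass function. -/
theorem mass_upper {μ k : ℝ} (hμ : 0 < μ) (hk : 0 < k) {m W : ℝ → ℝ}
    (mc : ContinuousOn m (Set.Ici 0)) (Wc : ContinuousOn W (Set.Ici 0)) (m0 : m 0 = 0)
    (W0 : W 0 = 8) (Wpos : ∀ r, 0 < W r)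
    (md : ∀ r > (0:ℝ), HasDerivAt m (r * (W r - k * m r)) r)
    (Wd : ∀ r > (0:ℝ), HasDerivAt W (W r * (-(m r) / r - μ * r)) r)
    (mpos : ∀ r > (0:ℝ), 0 < m r) (mlt : ∀ r > (0:ℝ), m r < 4 * r ^ 2) :
    ∀ r > (0:ℝ), m r < 4 * r ^ 2 / (1 + r ^ 2) := by
  have gc : ContinuousOn (fun r => W r - k * m r) (Set.Ici 0) :=
    Wc.sub (continuousOn_const.mul mc)
  have gd : ∀ r > (0:ℝ), HasDerivAt (fun r => W r - k * m r)
      (W r * (-(m r) / r - μ * r) - k * (r * (W r - k * m r))) r := fun r hr =>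
    (Wd r hr).sub ((md r hr).const_mul k)
  have ed : ∀ r : ℝ, HasDerivAt (fun r : ℝ => Real.exp (k * r ^ 2 / 2))
      (Real.exp (k * r ^ 2 / 2) * (k * r)) r := by
    intro r
    have h1 : HasDerivAt (fun r : ℝ => k * r ^ 2 / 2) (k * r) r := by
      have := ((hasDerivAt_pow 2 r).const_mul k).div_const 2
      refine HasDerivAt.congr_deriv this ?_
      simp
      ring
    exact h1.exp
  -- the weighted `g` is decreasing
  have ganti : StrictMonoOn (fun r => -(Real.exp (k * r ^ 2 / 2) * (W r - k * m r)))
      (Set.Ici 0) := by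
    refine mono_aux (f' := fun r => Real.exp (k * r ^ 2 / 2) * (W r * (m r / r + μ * r))) ?_ ?_ ?_
    · exact ((Continuous.continuousOn (by fun_prop)).mul gc).neg
    · intro r hr
      have := ((ed r).mul (gd r hr)).neg
      refine HasDerivAt.congr_deriv this ?_
      ring
    · intro r hr
      have := mpos r hr
      have := Wpos r
      positivity
  have gnonneg : ∀ r > (0:ℝ), 0 ≤ W r - k * m r → ∀ t, 0 ≤ t → t ≤ r → 0 ≤ W t - k * m t := by
    intro r hr h t ht htr
    have h1 := ganti.monotoneOn (Set.mem_Ici.2 ht) (Set.mem_Ici.2 hr.le) htr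
    beta_reduce at h1
    have h2 := Real.exp_pos (k * r ^ 2 / 2)
    have h3 := Real.exp_pos (k * t ^ 2 / 2)
    have h4 := mul_nonneg h2.le h
    by_contra hcon
    push Not at hcon
    have := mul_neg_of_pos_of_neg h3 hcon
    linarith
  -- the case of nonnegative `g`
  have main : ∀ r > (0:ℝ), 0 ≤ W r - k * m r → m r < 4 * r ^ 2 / (1 + r ^ 2) := by
    intro r hr hg
    have hgt := gnonneg r hr hg
    have sub : Set.Icc 0 r ⊆ Set.Ici (0:ℝ) := fun x hx => hx.1
    have Emono : StrictAntiOn (fun r => r ^ 2 * (W r - k * m r) - 2 * m r + m r ^ 2 / 2)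
        (Set.Icc 0 r) := by
      apply strictAntiOn_of_deriv_neg (convex_Icc 0 r)
      · have mc' := mc.mono sub
        have gc' := gc.mono sub
        exact (((Continuous.continuousOn (by fun_prop)).mul gc').sub
          (continuousOn_const.mul mc')).add ((mc'.pow 2).div_const 2)
      · intro t ht
        rw [interior_Icc] at ht
        have ht0 : 0 < t := ht.1
        have h := (((hasDerivAt_pow 2 t).mul (gd t ht0)).sub ((md t ht0).const_mul 2)).add
          (((md t ht0).pow 2).div_const 2)
        have h' : HasDerivAt (fun r => r ^ 2 * (W r - k * m r) - 2 * m r + m r ^ 2 / 2)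
            (-(μ * t ^ 3 * W t + k * t ^ 3 * (W t - k * m t) + k * m t ^ 2 * t)) t := by
          refine HasDerivAt.congr_deriv h ?_
          simp
          field_simp
          ring
        rw [h'.deriv]
        have h1 := hgt t ht.1.le ht.2.le
        have h2 := Wpos t
        have h3 := mpos t ht0
        have : 0 < μ * t ^ 3 * W t := by positivity
        have : 0 ≤ k * t ^ 3 * (W t - k * m t) := by positivity
        have : 0 < k * m t ^ 2 * t := by positivity
        linarith
    have Eneg : ∀ t, 0 < t → t ≤ r →
        t ^ 2 * (W t - k * m t) - 2 * m t + m t ^ 2 / 2 < 0 := by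
      intro t ht htr
      have := Emono (⟨le_rfl, hr.le⟩ : (0:ℝ) ∈ Set.Icc 0 r) ⟨ht.le, htr⟩ ht
      simpa [m0] using this
    have vd : ∀ t > (0:ℝ), HasDerivAt (fun t => 4 * t ^ 2 / m t - t ^ 2)
        (((4 * (2 * t)) * m t - 4 * t ^ 2 * (t * (W t - k * m t))) / m t ^ 2 - 2 * t) t := by
      intro t ht
      have h1 : HasDerivAt (fun t : ℝ => t ^ 2) (2 * t) t := by
        simpa using hasDerivAt_pow 2 t
      exact ((h1.const_mul 4).div (md t ht) (mpos t ht).ne').sub h1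
    have vmono : StrictMonoOn (fun t => 4 * t ^ 2 / m t - t ^ 2) (Set.Ioc 0 r) := by
      apply strictMonoOn_of_deriv_pos (convex_Ioc 0 r)
      · intro t ht
        exact (vd t ht.1).continuousAt.continuousWithinAt
      · intro t ht
        rw [interior_Ioc] at ht
        rw [(vd t ht.1).deriv]
        have h3 := mpos t ht.1
        have h4 := Eneg t ht.1 ht.2.le
        have h5 : ((4 * (2 * t)) * m t - 4 * t ^ 2 * (t * (W t - k * m t))) / m t ^ 2 - 2 * t
          = 4 * t * (-(t ^ 2 * (W t - k * m t) - 2 * m t + m t ^ 2 / 2)) / m t ^ 2 := by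
          field_simp
          ring
        rw [h5]
        have ht0 : 0 < t := ht.1
        have h6 : 0 < -(t ^ 2 * (W t - k * m t) - 2 * m t + m t ^ 2 / 2) := by linarith
        positivity
    have hr2 : 0 < r / 2 := by positivity
    have half : 1 ≤ 4 * (r / 2) ^ 2 / m (r / 2) - (r / 2) ^ 2 := by
      apply le_of_forall_pos_le_add
      intro e he
      set t := min (r / 2) (min 1 e) with htdef
      have ht0 : 0 < t := by positivity
      have ht1 : t ≤ r / 2 := min_le_left _ _
      have ht2 : t ≤ 1 := (min_le_right _ _).trans (min_le_left _ _)
      have ht3 : t ≤ e := (min_le_right _ _).trans (min_le_right _ _)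
      have h1 := vmono.monotoneOn (⟨ht0, by linarith⟩ : t ∈ Set.Ioc 0 r)
        (⟨hr2, by linarith⟩ : r / 2 ∈ Set.Ioc 0 r) ht1
      beta_reduce at h1
      have h2 : 1 ≤ 4 * t ^ 2 / m t := by
        rw [le_div_iff₀ (mpos t ht0)]
        linarith [mlt t ht0]
      nlinarith
    have h1 := vmono (⟨hr2, by linarith⟩ : r / 2 ∈ Set.Ioc 0 r)
      (⟨hr, le_rfl⟩ : r ∈ Set.Ioc 0 r) (by linarith)
    beta_reduce at h1
    have h2 : 1 + r ^ 2 < 4 * r ^ 2 / m r := by linarith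
    rw [lt_div_iff₀ (mpos r hr)] at h2
    rw [lt_div_iff₀ (by positivity)]
    linarith
  intro r hr
  by_cases hg : 0 ≤ W r - k * m r
  · exact main r hr hg
  push Not at hg
  have sub : Set.Icc 0 r ⊆ Set.Ici (0:ℝ) := fun x hx => hx.1
  have hmem : (0:ℝ) ∈ Set.Icc (W r - k * m r) (W 0 - k * m 0) := ⟨hg.le, by simp [m0, W0]⟩
  obtain ⟨q, hq, hq0⟩ := intermediate_value_Icc' hr.le (gc.mono sub) hmem
  beta_reduce at hq0
  have hqpos : 0 < q := by
    rcases hq.1.lt_or_eq with h | h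
    · exact h
    · rw [← h, m0, W0] at hq0; norm_num at hq0
  have hqr : q < r := by
    rcases hq.2.lt_or_eq with h | h
    · exact h
    · rw [h] at hq0; linarith
  have hmq := main q hqpos hq0.ge
  have manti : AntitoneOn m (Set.Icc q r) := by
    apply antitoneOn_of_deriv_nonpos (convex_Icc q r)
    · exact mc.mono (fun x hx => hqpos.le.trans hx.1)
    · intro t ht
      rw [interior_Icc] at ht
      exact (md t (hqpos.trans ht.1)).differentiableAt.differentiableWithinAt
    · intro t ht
      rw [interior_Icc] at ht
      have ht0 : 0 < t := hqpos.trans ht.1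
      rw [(md t ht0).deriv]
      have h1 := ganti (Set.mem_Ici.2 hqpos.le) (Set.mem_Ici.2 ht0.le) ht.1
      simp only [hq0] at h1
      have h2 := Real.exp_pos (k * t ^ 2 / 2)
      have h3 : W t - k * m t ≤ 0 := by
        by_contra hcon
        push Not at hcon
        have := mul_pos h2 hcon
        linarith
      exact mul_nonpos_of_nonneg_of_nonpos ht0.le h3
  have h1 := manti (⟨le_rfl, hqr.le⟩ : q ∈ Set.Icc q r) ⟨hqr.le, le_rfl⟩ hqr.le
  have h2 : 4 * q ^ 2 / (1 + q ^ 2) ≤ 4 * r ^ 2 / (1 + r ^ 2) := by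
    rw [div_le_div_iff₀ (by positivity) (by positivity)]
    nlinarith
  linarith

/-- uniform comparison of the stationary profiles `(Q, P)` with the
explicit parabolic-elliptic profiles `(Q⁰, P⁰)`. -/
theorem stmt1 (μ : ℝ) (hμ : 0 < μ) :
    ∃ ε₀ > (0:ℝ), ∃ α₀ ∈ Set.Ioo (0:ℝ) 1,
      ∀ ε ∈ Set.Ioo (0:ℝ) ε₀, ∀ α ∈ Set.Ioo α₀ 1, ∀ P : ℝ → ℝ,
        IsRadialProfile μ ε P → ∀ r > (0:ℝ),
          (P0fun r - μ * α * r ^ 2 / 2 < P r - μ * α * r ^ 2 / 2 ∧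
            P r - μ * α * r ^ 2 / 2 < P0fun r ∧ P0fun r < P r ∧ P r < 0) ∧
          (r * Dr P r - μ * α * r ^ 2 < r * deriv P0fun r ∧
            r * deriv P0fun r < r * Dr P r ∧ r * Dr P r < 0) ∧
          (Q0fun r * Real.exp (-(μ * r ^ 2 / 2)) < profQ μ P r ∧
            profQ μ P r < Q0fun r * Real.exp (-(μ * (1 - α) * r ^ 2 / 2))) := by
  refine ⟨1 / 8, by norm_num, 3 / 4, ⟨by norm_num, by norm_num⟩, ?_⟩
  rintro ε ⟨hε0, hε1⟩ α ⟨hα0, hα1⟩ P ⟨hC, hP0, hp0, hode⟩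
  have hk : 0 < μ * ε := by positivity
  have Pc : ContinuousOn P (Set.Ici 0) := hC.continuousOn
  have hC1 : ContDiffOn ℝ 1 (Dr P) (Set.Ici 0) :=
    hC.derivWithin (uniqueDiffOn_Ici 0) (by norm_num)
  have pc : ContinuousOn (Dr P) (Set.Ici 0) := hC1.continuousOn
  have Pd : ∀ r > (0:ℝ), HasDerivAt P (Dr P r) r := fun r hr =>
    ((hC.differentiableOn (by norm_num) r hr.le).hasDerivWithinAt).hasDerivAt (Ici_mem_nhds hr)
  have pd : ∀ r > (0:ℝ), HasDerivAt (Dr P) (Dr (Dr P) r) r := fun r hr =>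
    ((hC1.differentiableOn (by norm_num) r hr.le).hasDerivWithinAt).hasDerivAt (Ici_mem_nhds hr)
  set p := Dr P with hp
  set m : ℝ → ℝ := fun r => -(r * p r) with hm
  set W : ℝ → ℝ := fun r => 8 * Real.exp (P r - μ * r ^ 2 / 2) with hW
  have mc : ContinuousOn m (Set.Ici 0) := (continuousOn_id.mul pc).neg
  have Wc : ContinuousOn W (Set.Ici 0) :=
    continuousOn_const.mul (Pc.sub (Continuous.continuousOn (by fun_prop))).rexp
  have m0 : m 0 = 0 := by simp [hm]
  have W0 : W 0 = 8 := by simp [hW, hP0]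
  have Wpos : ∀ r, 0 < W r := fun r => by simp only [hW]; positivity
  have hpm : ∀ r > (0:ℝ), p r = -(m r) / r := by
    intro r hr; simp only [hm]; field_simp
  have sqd : ∀ r : ℝ, HasDerivAt (fun t : ℝ => t ^ 2) (2 * r) r := fun r => by
    simpa using hasDerivAt_pow 2 r
  have md : ∀ r > (0:ℝ), HasDerivAt m (r * (W r - μ * ε * m r)) r := by
    intro r hr
    have h := ((hasDerivAt_id r).mul (pd r hr)).neg
    have ho := hode r hr
    refine HasDerivAt.congr_deriv h ?_
    simp only [hm, hW, id, one_mul]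
    have h2 : 8 * Real.exp (P r - μ * r ^ 2 / 2)
      = -(Dr p r + (1 / r + μ * ε * r) * p r) := by linarith
    rw [h2]
    field_simp
    ring
  have Wd : ∀ r > (0:ℝ), HasDerivAt W (W r * (-(m r) / r - μ * r)) r := by
    intro r hr
    have h := (((Pd r hr).sub (((sqd r).const_mul μ).div_const 2)).exp).const_mul 8
    refine HasDerivAt.congr_deriv h ?_
    rw [← hpm r hr]
    simp only [hW, Pi.sub_apply]
    ring
  have mpos : ∀ r > (0:ℝ), 0 < m r := by
    have h := pos_aux (f := fun r => Real.exp (μ * ε * r ^ 2 / 2) * m r)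
      (f' := fun r => Real.exp (μ * ε * r ^ 2 / 2) * (r * W r))
      ((Continuous.continuousOn (by fun_prop)).mul mc) (by simp [m0])
      (by
        intro r hr
        have h := ((((sqd r).const_mul (μ * ε)).div_const 2).exp).mul (md r hr)
        refine HasDerivAt.congr_deriv h ?_
        ring)
      (by
        intro r hr
        have := Wpos r
        positivity)
    intro r hr
    exact (pos_iff_pos_of_mul_pos (h r hr)).1 (Real.exp_pos _)
  have Pneg : ∀ r > (0:ℝ), P r < 0 := by
    have h := pos_aux (f := fun r => -(P r)) (f' := fun r => -(p r)) Pc.neg (by simp [hP0])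
      (fun r hr => (Pd r hr).neg)
      (by
        intro r hr
        have := mpos r hr
        rw [hpm r hr, neg_div, neg_neg]
        positivity)
    intro r hr
    linarith [h r hr]
  have mlt : ∀ r > (0:ℝ), m r < 4 * r ^ 2 := by
    have h := pos_aux (f := fun r => 4 * r ^ 2 - m r)
      (f' := fun r => 4 * (2 * r) - r * (W r - μ * ε * m r))
      ((Continuous.continuousOn (by fun_prop)).sub mc) (by simp [m0])
      (fun r hr => ((sqd r).const_mul 4).sub (md r hr))
      (by
        intro r hr
        have h1 := mpos r hr
        have h2 : W r < 8 := by
          have : Real.exp (P r - μ * r ^ 2 / 2) < 1 := by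
            rw [Real.exp_lt_one_iff]
            have : 0 < μ * r ^ 2 / 2 := by positivity
            linarith [Pneg r hr]
          simp only [hW]; linarith
        have h3 : 0 < μ * ε * m r := by positivity
        have h4 : 0 < r * (8 - (W r - μ * ε * m r)) := mul_pos hr (by linarith)
        linarith)
    intro r hr
    linarith [h r hr]
  have mup := mass_upper hμ hk mc Wc m0 W0 Wpos md Wd mpos mlt
  have P0c : Continuous P0fun :=
    continuous_iff_continuousAt.2 fun r => (P0_deriv r).continuousAt
  have P00 : P0fun 0 = 0 := by simp [P0fun]
  have Plow : ∀ r > (0:ℝ), P0fun r < P r := by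
    have h := pos_aux (f := fun r => P r - P0fun r)
      (f' := fun r => p r - (-4 * r / (1 + r ^ 2)))
      (Pc.sub P0c.continuousOn) (by simp [hP0, P00])
      (fun r hr => (Pd r hr).sub (P0_deriv r))
      (by
        intro r hr
        have h1 := mup r hr
        have h2 : p r - (-4 * r / (1 + r ^ 2)) = (4 * r ^ 2 / (1 + r ^ 2) - m r) / r := by
          rw [hpm r hr]; field_simp; ring
        rw [h2]
        exact div_pos (by linarith) hr)
    intro r hr
    linarith [h r hr]
  have Dpos : ∀ r > (0:ℝ), 0 < μ * α * r ^ 2 - 4 * r ^ 2 / (1 + r ^ 2) + m r := by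
    refine pos_aux (f := fun r => μ * α * r ^ 2 - 4 * r ^ 2 / (1 + r ^ 2) + m r)
      (f' := fun r => μ * α * (2 * r) - ((4 * (2 * r)) * (1 + r ^ 2) - 4 * r ^ 2 * (2 * r))
        / (1 + r ^ 2) ^ 2 + r * (W r - μ * ε * m r)) ?_ (by simp [m0]) ?_ ?_
    · refine ContinuousOn.add (Continuous.continuousOn ?_) mc
      have : ∀ r : ℝ, 1 + r ^ 2 ≠ 0 := fun r => by positivity
      fun_prop (disch := assumption)
    · intro r hr
      exact (((sqd r).const_mul (μ * α)).sub (((sqd r).const_mul 4).div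
        ((sqd r).const_add 1) (by positivity))).add (md r hr)
    · intro r hr
      have hs : (0:ℝ) < 1 + r ^ 2 := by positivity
      have h1 : m r < 4 := by
        refine (mup r hr).trans ?_
        rw [div_lt_iff₀ hs]; linarith
      have h2 : 8 / (1 + r ^ 2) ^ 2 - μ ≤ W r := by
        have e1 : Real.exp (P0fun r) * Real.exp (-(μ * r ^ 2 / 2))
            ≤ Real.exp (P r - μ * r ^ 2 / 2) := by
          rw [← Real.exp_add]
          exact Real.exp_le_exp.2 (by linarith [Plow r hr])
        have e2 := Real.add_one_le_exp (-(μ * r ^ 2 / 2))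
        rw [exp_P0] at e1
        have e3 : 1 / (1 + r ^ 2) ^ 2 * (-(μ * r ^ 2 / 2) + 1)
            ≤ 1 / (1 + r ^ 2) ^ 2 * Real.exp (-(μ * r ^ 2 / 2)) :=
          mul_le_mul_of_nonneg_left e2 (by positivity)
        have e4 : 4 * r ^ 2 / (1 + r ^ 2) ^ 2 ≤ 1 := by
          rw [div_le_one (by positivity)]
          nlinarith [sq_nonneg (r ^ 2 - 1)]
        have e5 : 8 * (1 / (1 + r ^ 2) ^ 2 * (-(μ * r ^ 2 / 2) + 1))
            = 8 / (1 + r ^ 2) ^ 2 - μ * (4 * r ^ 2 / (1 + r ^ 2) ^ 2) := by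
          field_simp; ring
        have e6 := mul_le_mul_of_nonneg_left e4 hμ.le
        simp only [hW]
        linarith
      have h3 : μ * ε * m r < μ * ε * 4 := mul_lt_mul_of_pos_left h1 hk
      have h4 : μ * α * (2 * r) - ((4 * (2 * r)) * (1 + r ^ 2) - 4 * r ^ 2 * (2 * r))
        / (1 + r ^ 2) ^ 2 + r * (W r - μ * ε * m r)
        = r * (2 * (μ * α) - 8 / (1 + r ^ 2) ^ 2 + W r - μ * ε * m r) := by
        field_simp; ring
      rw [h4]
      apply mul_pos hr
      have h5 : μ * (3 / 4) < μ * α := mul_lt_mul_of_pos_left hα0 hμ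
      have h6 : μ * ε < μ * (1 / 8) := mul_lt_mul_of_pos_left hε1 hμ
      linarith
  have Fpos : ∀ r > (0:ℝ), 0 < μ * α * r ^ 2 / 2 + P0fun r - P r := by
    refine pos_aux (f := fun r => μ * α * r ^ 2 / 2 + P0fun r - P r)
      (f' := fun r => μ * α * (2 * r) / 2 + -4 * r / (1 + r ^ 2) - p r) ?_
      (by simp [hP0, P00]) ?_ ?_
    · exact (Continuous.continuousOn (by fun_prop)).sub Pc
    · intro r hr
      exact ((((sqd r).const_mul (μ * α)).div_const 2).add (P0_deriv r)).sub (Pd r hr)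
    · intro r hr
      have h2 : μ * α * (2 * r) / 2 + -4 * r / (1 + r ^ 2) - p r
          = (μ * α * r ^ 2 - 4 * r ^ 2 / (1 + r ^ 2) + m r) / r := by
        rw [hpm r hr]; field_simp; ring
      rw [h2]
      exact div_pos (Dpos r hr) hr
  intro r hr
  have hmr : m r = -(r * p r) := rfl
  have hd0 : r * deriv P0fun r = -(4 * r ^ 2 / (1 + r ^ 2)) := by
    rw [(P0_deriv r).deriv]; ring
  have hQ : Q0fun r = 8 * Real.exp (P0fun r) := by
    rw [exp_P0, Q0fun]; ring
  have a1 := Plow r hr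
  have a2 := Fpos r hr
  have a3 := Dpos r hr
  have a4 := mup r hr
  have a5 := mpos r hr
  refine ⟨⟨by linarith, by linarith, a1, Pneg r hr⟩, ⟨?_, ?_, ?_⟩, ?_, ?_⟩
  · rw [hd0]; linarith
  · rw [hd0]; linarith
  · linarith
  · rw [hQ, profQ, mul_assoc, ← Real.exp_add]
    have := Real.exp_lt_exp.2 (show P0fun r + -(μ * r ^ 2 / 2) < P r - μ * r ^ 2 / 2 by linarith)
    linarith
  · rw [hQ, profQ, mul_assoc, ← Real.exp_add]
    have := Real.exp_lt_exp.2
      (show P r - μ * r ^ 2 / 2 < P0fun r + -(μ * (1 - α) * r ^ 2 / 2) by linarith)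
    linarith

end
end

section
/- There exist constants C₀, C₁, C₂, C₃ > 0, ε₀ > 0 and θ ∈ (0,1) such that for every μ ∈ (0,∞), every ε ∈ (0, ε₀], and every radial stationary profile P for the parameters (μ, ε) with associated cell-density profile Q(r) := 8 e^{P(r) − μ r²/2}, viewing Q and P as radially symmetric functions on ℝ², the following hold for all x ∈ ℝ²: (1) 0 ≤ Q(x) ≤ C₀ e^{−μ θ |x|²/2} ⟨x⟩^{−4}; (2) (1/|x| + ⟨x⟩) |∇P(x)| ≤ C₁ for x ≠ 0; (3) |ΔP(x)| ≤ C₂ μ ε + C₃ ⟨x⟩^{−1}. -/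
open Real Set

noncomputable section

abbrev R2 : Type := EuclideanSpace ℝ (Fin 2)

/-- Japanese bracket `⟨x⟩ = (1+|x|²)^{1/2}`. -/
def jap (x : R2) : ℝ := Real.sqrt (1 + ‖x‖ ^ 2)

open Filter Topology

/-- Functions with nonnegative derivative on `(0,R]` dominate their limit at `0+`. -/
lemma mono_lim (f f' : ℝ → ℝ) (R L : ℝ)
    (hd : ∀ r, 0 < r → r ≤ R → HasDerivAt f (f' r) r)
    (hn : ∀ r, 0 < r → r ≤ R → 0 ≤ f' r)
    (hl : Tendsto f (𝓝[>] 0) (𝓝 L)) : ∀ r, 0 < r → r ≤ R → L ≤ f r := by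
  intro r h0 hR
  have hm : MonotoneOn f (Ioc 0 R) := by
    apply monotoneOn_of_deriv_nonneg (convex_Ioc 0 R)
    · intro x hx
      exact (hd x hx.1 hx.2).continuousAt.continuousWithinAt
    · intro x hx
      rw [interior_Ioc] at hx
      exact (hd x hx.1 hx.2.le).differentiableAt.differentiableWithinAt
    · intro x hx
      rw [interior_Ioc] at hx
      rw [(hd x hx.1 hx.2.le).deriv]
      exact hn x hx.1 hx.2.le
  refine le_of_tendsto hl ?_
  have : Ioo (0:ℝ) r ∈ 𝓝[>] (0:ℝ) := Ioo_mem_nhdsGT h0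
  filter_upwards [this] with s hs
  exact hm ⟨hs.1, hs.2.le.trans hR⟩ ⟨h0, hR⟩ hs.2.le

/-- Calculus facts extracted from the definition of a profile. -/
lemma profile_facts (μ ε : ℝ) (P : ℝ → ℝ) (h : IsRadialProfile μ ε P) :
    (∀ r, 0 < r → HasDerivAt P (Dr P r) r) ∧
    (∀ r, 0 < r → HasDerivAt (Dr P)
      (-8 * Real.exp (P r - μ * r ^ 2 / 2) - (1 / r + μ * ε * r) * Dr P r) r) ∧
    Tendsto P (𝓝[>] 0) (𝓝 0) ∧ Tendsto (Dr P) (𝓝[>] 0) (𝓝 0) ∧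
    Tendsto (fun r => Dr P r / r) (𝓝[>] 0) (𝓝 (-4)) := by
  obtain ⟨hC, hP0, hq0, hode⟩ := h
  have hu : UniqueDiffOn ℝ (Ici (0:ℝ)) := uniqueDiffOn_Ici 0
  have hC1 : ContDiffOn ℝ 1 (Dr P) (Ici 0) := by
    have := ((contDiffOn_succ_iff_derivWithin (n := 1) hu).1 (by
      simpa [one_add_one_eq_two] using hC)).2.2
    exact this
  have hC0 : ContinuousOn (Dr (Dr P)) (Ici 0) :=
    hC1.continuousOn_derivWithin hu le_rfl
  have hsub : 𝓝[>] (0:ℝ) ≤ 𝓝[Ici 0] 0 := nhdsWithin_mono _ Ioi_subset_Ici_self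
  have hPt : Tendsto P (𝓝[>] 0) (𝓝 0) := by
    have := (hC.continuousOn 0 self_mem_Ici).tendsto.mono_left hsub
    rwa [hP0] at this
  have hqt : Tendsto (Dr P) (𝓝[>] 0) (𝓝 0) := by
    have := (hC1.continuousOn 0 self_mem_Ici).tendsto.mono_left hsub
    rwa [hq0] at this
  have hat : Tendsto (Dr (Dr P)) (𝓝[>] 0) (𝓝 (Dr (Dr P) 0)) :=
    (hC0 0 self_mem_Ici).tendsto.mono_left hsub
  have hrt : Tendsto (fun r : ℝ => r) (𝓝[>] 0) (𝓝 0) := tendsto_id.mono_left nhdsWithin_le_nhds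
  have hqr : Tendsto (fun r => Dr P r / r) (𝓝[>] 0) (𝓝 (Dr (Dr P) 0)) := by
    have hd : HasDerivWithinAt (Dr P) (Dr (Dr P) 0) (Ici 0) 0 :=
      ((hC1.differentiableOn one_ne_zero) 0 self_mem_Ici).hasDerivWithinAt
    have h2 := (hasDerivWithinAt_iff_tendsto_slope.1 hd)
    have hset : Ici (0:ℝ) \ {0} = Ioi 0 := Ici_sdiff_left
    rw [hset] at h2
    refine h2.congr ?_
    intro r
    simp [slope_def_field, hq0]
  have hlim : Tendsto (fun r => Dr (Dr P) r + Dr P r / r + μ * ε * r * Dr P r) (𝓝[>] 0)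
      (𝓝 (Dr (Dr P) 0 + Dr (Dr P) 0 + μ * ε * 0 * 0)) :=
    (hat.add hqr).add ((hrt.const_mul _).mul hqt)
  have hlim2 : Tendsto (fun r => -8 * Real.exp (P r - μ * r ^ 2 / 2)) (𝓝[>] 0)
      (𝓝 (-8 * Real.exp (0 - μ * 0 ^ 2 / 2))) :=
    ((hPt.sub (((hrt.pow 2).const_mul μ).div_const 2)).rexp).const_mul _
  have heq : Dr (Dr P) 0 + Dr (Dr P) 0 + μ * ε * 0 * 0 = -8 * Real.exp (0 - μ * 0 ^ 2 / 2) := by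
    refine tendsto_nhds_unique (hlim.congr' ?_) hlim2
    filter_upwards [self_mem_nhdsWithin] with r hr
    rw [← hode r hr]; ring
  have ha : Dr (Dr P) 0 = -4 := by
    norm_num at heq
    linarith
  refine ⟨?_, ?_, hPt, hqt, ha ▸ hqr⟩
  · intro r hr
    have := ((hC.differentiableOn two_ne_zero) r hr.le).hasDerivWithinAt
    exact this.hasDerivAt (Ici_mem_nhds hr)
  · intro r hr
    have := ((hC1.differentiableOn one_ne_zero) r hr.le).hasDerivWithinAt.hasDerivAt
      (Ici_mem_nhds hr)
    refine this.congr_deriv ?_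
    have := hode r hr
    change Dr (Dr P) r = _
    linarith

/-- The decay estimate, in terms of abstract functions. -/
lemma core (μ ε : ℝ) (hμ : 0 < μ) (hε : 0 < ε) (hε1 : ε ≤ 1) (P q : ℝ → ℝ)
    (hP : ∀ r, 0 < r → HasDerivAt P (q r) r)
    (hq : ∀ r, 0 < r → HasDerivAt q
      (-8 * Real.exp (P r - μ * r ^ 2 / 2) - (1 / r + μ * ε * r) * q r) r)
    (hPt : Tendsto P (𝓝[>] 0) (𝓝 0)) (hqt : Tendsto q (𝓝[>] 0) (𝓝 0))
    (hqr : Tendsto (fun r => q r / r) (𝓝[>] 0) (𝓝 (-4))) :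
    ∀ r, 0 < r → q r ≤ 0 ∧
      8 * Real.exp (P r - μ * r ^ 2 / 2) ≤
        (256 * exp 10) * Real.exp (-(μ * (1/2) * r ^ 2 / 2)) / (1 + r ^ 2) ^ 2 ∧
      -(r * q r) ≤ (128 * exp 10) * (1 - 1 / (1 + r ^ 2)) := by
  have hrt : Tendsto (fun r : ℝ => r) (𝓝[>] 0) (𝓝 0) := tendsto_id.mono_left nhdsWithin_le_nhds
  set Q : ℝ → ℝ := fun r => 8 * Real.exp (P r - μ * r ^ 2 / 2) with hQdef
  set m : ℝ → ℝ := fun r => -(r * q r) with hmdef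
  have hQpos : ∀ r, 0 < Q r := fun r => by positivity
  have hqm : ∀ r, 0 < r → q r = -(m r / r) := fun r hr => by
    simp only [hmdef]; field_simp; 
  have hP' : ∀ r, 0 < r → HasDerivAt P (-(m r / r)) r := fun r hr => by
    rw [← hqm r hr]; exact hP r hr
  have hr2 : ∀ r : ℝ, HasDerivAt (fun r : ℝ => r ^ 2) (2 * r) r := fun r => by
    simpa using hasDerivAt_pow 2 r
  have hr4 : ∀ r : ℝ, HasDerivAt (fun r : ℝ => r ^ 4) (4 * r ^ 3) r := fun r => by
    simpa using hasDerivAt_pow 4 r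
  have hm' : ∀ r, 0 < r → HasDerivAt m (r * Q r - μ * ε * r * m r) r := fun r hr => by
    have := ((hasDerivAt_id' r).mul (hq r hr)).neg
    refine this.congr_deriv ?_
    simp only [hQdef, hmdef]
    field_simp
    ring
  have hQ' : ∀ r, 0 < r → HasDerivAt Q (Q r * (-(m r / r) - μ * r)) r := fun r hr => by
    have := (((hP' r hr).sub (((hr2 r).const_mul μ).div_const 2)).exp).const_mul 8
    refine this.congr_deriv ?_
    simp only [hQdef, Pi.sub_apply]
    ring
  have hmt : Tendsto m (𝓝[>] 0) (𝓝 0) := by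
    simpa using (hrt.mul hqt).neg
  have hQt : Tendsto Q (𝓝[>] 0) (𝓝 8) := by
    simpa using ((hPt.sub (((hrt.pow 2).const_mul μ).div_const 2)).rexp).const_mul 8
  have hr2t : Tendsto (fun r : ℝ => r ^ 2) (𝓝[>] 0) (𝓝 0) := by simpa using hrt.pow 2
  have hr4t : Tendsto (fun r : ℝ => r ^ 4) (𝓝[>] 0) (𝓝 0) := by simpa using hrt.pow 4
  -- step 1
  have m0 : ∀ r, 0 < r → 0 ≤ m r := by
    intro R hR
    have := mono_lim (fun r => m r * exp (μ * ε * r ^ 2 / 2))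
      (fun r => r * Q r * exp (μ * ε * r ^ 2 / 2)) R 0 ?_ ?_ ?_ R hR le_rfl
    · exact nonneg_of_mul_nonneg_left this (exp_pos _)
    · intro r h0 _
      refine ((hm' r h0).mul ((((hr2 r).const_mul (μ * ε)).div_const 2).exp)).congr_deriv ?_
      ring
    · intro r h0 _
      have := hQpos r
      positivity
    · simpa using hmt.mul (((hr2t.const_mul (μ * ε)).div_const 2).rexp)
  -- step 2
  have P0 : ∀ r, 0 < r → P r ≤ 0 := by
    intro R hR
    have := mono_lim (fun r => - P r) (fun r => m r / r) R 0 ?_ ?_ ?_ R hR le_rfl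
    · linarith
    · intro r h0 _
      exact (hP' r h0).neg.congr_deriv (by ring)
    · intro r h0 _
      exact div_nonneg (m0 r h0) h0.le
    · simpa using hPt.neg
  have Q8 : ∀ r, 0 < r → Q r ≤ 8 := by
    intro r hr
    have : exp (P r - μ * r ^ 2 / 2) ≤ 1 := by
      rw [exp_le_one_iff]
      have := P0 r hr
      have : 0 ≤ μ * r ^ 2 / 2 := by positivity
      linarith
    simp only [hQdef]; linarith
  -- step 3
  have m4 : ∀ r, 0 < r → m r ≤ 4 * r ^ 2 := by
    intro R hR
    have := mono_lim (fun r => 4 * r ^ 2 - m r)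
      (fun r => r * (8 - Q r) + μ * ε * r * m r) R 0 ?_ ?_ ?_ R hR le_rfl
    · simpa using this
    · intro r h0 _
      exact (((hr2 r).const_mul 4).sub (hm' r h0)).congr_deriv (by ring)
    · intro r h0 _
      have h1 := m0 r h0
      have h2 : 0 ≤ 8 - Q r := by linarith [Q8 r h0]
      positivity
    · simpa using (hr2t.const_mul 4).sub hmt
  -- step 4
  set F : ℝ → ℝ := fun r => m r - m r ^ 2 / 4 - r ^ 2 * Q r / 2 with hFdef
  have hF' : ∀ r, 0 < r → HasDerivAt F
      (2 * r * (μ * (r ^ 2 * Q r / 2) / 2 - μ * ε * (m r / 2) * (1 - m r / 2))) r := by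
    intro r hr
    refine (((hm' r hr).sub (((hm' r hr).pow 2).div_const 4)).sub
      (((hr2 r).mul (hQ' r hr)).div_const 2)).congr_deriv ?_
    simp
    field_simp
    ring
  have hFt : Tendsto F (𝓝[>] 0) (𝓝 0) := by
    simpa using (hmt.sub ((hmt.pow 2).div_const 4)).sub ((hr2t.mul hQt).div_const 2)
  have Flow : ∀ r, 0 < r → 0 ≤ F r + μ * ε * r ^ 2 / 4 := by
    intro R hR
    refine mono_lim (fun r => F r + μ * ε * r ^ 2 / 4) _ R 0
      (fun r h0 _ => (hF' r h0).add (((hr2 r).const_mul (μ * ε)).div_const 4)) ?_ ?_ R hR le_rfl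
    · intro r h0 _
      have h1 : 0 ≤ r * μ * (r ^ 2 * Q r / 2) := by
        have := hQpos r
        positivity
      have h2 : 0 ≤ μ * ε * r * (m r - 1) ^ 2 := by positivity
      nlinarith
    · simpa using hFt.add ((hr2t.const_mul (μ * ε)).div_const 4)
  -- step 5
  have hK : ∀ r, 0 < r → μ * r ^ 2 ≤ 1 → r ^ 2 * Q r / 2 ≤ 5 / 4 ∧ m r ≤ 5 := by
    intro r hr h1
    have h2 := Flow r hr
    have h3 : μ * ε * r ^ 2 ≤ 1 := by nlinarith [mul_pos hμ (pow_pos hr 2)]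
    have h4 : 0 < r ^ 2 * Q r := mul_pos (pow_pos hr 2) (hQpos r)
    simp only [hFdef] at h2
    constructor
    · nlinarith [sq_nonneg (m r - 2)]
    · by_contra hc
      push Not at hc
      nlinarith
  -- step 6
  have Fup : ∀ r, 0 < r → μ * r ^ 2 ≤ 1 → F r ≤ 15 * μ * r ^ 4 / (1 + r ^ 2) := by
    intro R hR hR1
    have := mono_lim (fun r => 15 * μ * r ^ 4 / (1 + r ^ 2) - F r) _ R 0
      (fun r h0 _ => (((hr4 r).const_mul (15 * μ)).div ((hr2 r).const_add 1)
        (by positivity)).sub (hF' r h0)) ?_ ?_ R hR le_rfl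
    · linarith
    · intro r h0 hrR
      have hr1 : μ * r ^ 2 ≤ 1 := by
        have : r ^ 2 ≤ R ^ 2 := by gcongr
        nlinarith
      obtain ⟨hk, h5⟩ := hK r h0 hr1
      have hm0 := m0 r h0
      have hm4 := m4 r h0
      have hq8 := Q8 r h0
      have hqp := hQpos r
      have hk1 : (r ^ 2 * Q r / 2) * (1 + r ^ 2) ≤ 6 * r ^ 2 := by nlinarith [pow_pos h0 2]
      have hm1 : m r ^ 2 * (1 + r ^ 2) ≤ 45 * r ^ 2 := by
        have a1 : m r ^ 2 ≤ 5 * (4 * r ^ 2) := by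
          rw [sq (m r)]
          exact mul_le_mul h5 hm4 hm0 (by norm_num)
        have a2 : m r ^ 2 ≤ 25 := by nlinarith
        have a3 := mul_le_mul_of_nonneg_right a2 (sq_nonneg r)
        linarith
      have hb : μ * (r ^ 2 * Q r / 2) / 2 - μ * ε * (m r / 2) * (1 - m r / 2)
          ≤ 15 * μ * r ^ 2 / (1 + r ^ 2) := by
        rw [le_div_iff₀ (by positivity)]
        have e1 : 0 ≤ μ * ε * m r := by positivity
        have e2 : 0 ≤ μ * (1 - ε) * m r ^ 2 := by
          have : 0 ≤ 1 - ε := by linarith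
          positivity
        have e3 : μ * (r ^ 2 * Q r / 2) / 2 - μ * ε * (m r / 2) * (1 - m r / 2)
          ≤ μ * ((r ^ 2 * Q r / 2) / 2 + m r ^ 2 / 4) := by nlinarith
        calc _ ≤ μ * ((r ^ 2 * Q r / 2) / 2 + m r ^ 2 / 4) * (1 + r ^ 2) := by gcongr
          _ = μ * (((r ^ 2 * Q r / 2) * (1 + r ^ 2)) / 2 + m r ^ 2 * (1 + r ^ 2) / 4) := by ring
          _ ≤ μ * ((6 * r ^ 2) / 2 + 45 * r ^ 2 / 4) := by gcongr
          _ ≤ _ := by nlinarith [mul_pos hμ (pow_pos h0 2)]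
      have hb2 : 2 * r * (15 * μ * r ^ 2 / (1 + r ^ 2)) ≤
          (15 * μ * (4 * r ^ 3) * (1 + r ^ 2) - 15 * μ * r ^ 4 * (2 * r)) / (1 + r ^ 2) ^ 2 := by
        have : (15 * μ * (4 * r ^ 3) * (1 + r ^ 2) - 15 * μ * r ^ 4 * (2 * r)) / (1 + r ^ 2) ^ 2
          - 2 * r * (15 * μ * r ^ 2 / (1 + r ^ 2)) = 30 * μ * r ^ 3 / (1 + r ^ 2) ^ 2 := by
          field_simp
          ring
        have : 0 ≤ 30 * μ * r ^ 3 / (1 + r ^ 2) ^ 2 := by positivity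
        linarith
      have := mul_le_mul_of_nonneg_left hb (by positivity : 0 ≤ 2 * r)
      linarith
    · have h1 : Tendsto (fun r : ℝ => 1 + r ^ 2) (𝓝[>] 0) (𝓝 1) := by
        simpa using hr2t.const_add 1
      simpa using ((hr4t.const_mul (15 * μ)).div h1 one_ne_zero).sub hFt
  -- step 7
  have hH : ∀ r, 0 < r → μ * r ^ 2 ≤ 1 → 0 ≤ (1 + r ^ 2) * (m r / r ^ 2) / 4 - 1 + 5 * μ * r ^ 2 := by
    intro R hR hR1
    have hd : ∀ r, 0 < r → HasDerivAt
        (fun r => ((1 + r ^ 2) * (m r / r ^ 2) / 4 - 1 + 5 * μ * r ^ 2) * exp (-(P r / 2)))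
        (exp (-(P r / 2)) * (-((1 + r ^ 2) / (2 * r ^ 3)) * (F r + μ * ε * r ^ 2 * m r / 2)
          + 10 * μ * r + 5 * μ * r * m r / 2)) r := by
      intro r h0
      refine (((((((hr2 r).const_add 1).mul ((hm' r h0).div (hr2 r) (by positivity))).div_const
        4).sub_const 1).add ((hr2 r).const_mul (5 * μ))).mul
        (((hP' r h0).div_const 2).neg.exp)).congr_deriv ?_
      simp only [hFdef, Pi.div_apply, Pi.mul_apply, Pi.add_apply, Pi.neg_apply]
      field_simp
      ring
    have := mono_lim _ _ R 0 (fun r h0 _ => hd r h0) ?_ ?_ R hR le_rfl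
    · exact nonneg_of_mul_nonneg_left this (exp_pos _)
    · intro r h0 hrR
      have hr1 : μ * r ^ 2 ≤ 1 := by
        have : r ^ 2 ≤ R ^ 2 := by gcongr
        nlinarith
      obtain ⟨hk, h5⟩ := hK r h0 hr1
      have hm0 := m0 r h0
      have hm4 := m4 r h0
      have hF := Fup r h0 hr1
      have hm1 : m r ≤ 10 * r ^ 2 / (1 + r ^ 2) := by
        rw [le_div_iff₀ (by positivity)]
        nlinarith [pow_pos h0 2]
      have h6 : μ * ε * r ^ 2 * m r / 2 ≤ μ * 1 * r ^ 2 * (10 * r ^ 2 / (1 + r ^ 2)) / 2 := by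
        gcongr
      have h7 : F r + μ * ε * r ^ 2 * m r / 2 ≤ 20 * μ * r ^ 4 / (1 + r ^ 2) := by
        have : 15 * μ * r ^ 4 / (1 + r ^ 2) + μ * 1 * r ^ 2 * (10 * r ^ 2 / (1 + r ^ 2)) / 2
          = 20 * μ * r ^ 4 / (1 + r ^ 2) := by ring
        linarith
      have h8 : ((1 + r ^ 2) / (2 * r ^ 3)) * (F r + μ * ε * r ^ 2 * m r / 2) ≤
          ((1 + r ^ 2) / (2 * r ^ 3)) * (20 * μ * r ^ 4 / (1 + r ^ 2)) := by
        gcongr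
      have h9 : ((1 + r ^ 2) / (2 * r ^ 3)) * (20 * μ * r ^ 4 / (1 + r ^ 2)) = 10 * μ * r := by
        field_simp
        ring
      have h10 : 0 ≤ 5 * μ * r * m r / 2 := by positivity
      refine mul_nonneg (exp_pos _).le ?_
      linarith
    · have hn : Tendsto (fun r => m r / r ^ 2) (𝓝[>] 0) (𝓝 4) := by
        have := hqr.neg
        rw [neg_neg] at this
        refine this.congr' ?_
        filter_upwards [self_mem_nhdsWithin] with r hr
        have hr : 0 < r := hr
        simp only [hmdef]
        field_simp
      have := (((((hr2t.const_add 1).mul hn).div_const 4).sub_const 1).add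
        (hr2t.const_mul (5 * μ))).mul ((hPt.div_const 2).neg.rexp)
      simpa using this
  -- step 8
  have hPd : ∀ r, 0 < r → μ * r ^ 2 ≤ 1 → exp (P r) ≤ exp 10 / (1 + r ^ 2) ^ 2 := by
    intro R hR hR1
    have := mono_lim (fun r => -(P r / 2) - log (1 + r ^ 2) + 5 * μ * r ^ 2) _ R 0
      (fun r h0 _ => (((hP' r h0).div_const 2).neg.sub
        (((hr2 r).const_add 1).log (by positivity))).add ((hr2 r).const_mul (5 * μ)))
      ?_ ?_ R hR le_rfl
    · have h1 : P R ≤ 10 - 2 * log (1 + R ^ 2) := by linarith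
      calc exp (P R) ≤ exp (10 - 2 * log (1 + R ^ 2)) := exp_le_exp.2 h1
        _ = _ := by
          rw [exp_sub, two_mul, exp_add, exp_log (by positivity), sq (1 + R ^ 2)]
    · intro r h0 hrR
      have hr1 : μ * r ^ 2 ≤ 1 := by
        have : r ^ 2 ≤ R ^ 2 := by gcongr
        nlinarith
      have h1 := hH r h0 hr1
      have h2 : -(-(m r / r) / 2) - 2 * r / (1 + r ^ 2) + 5 * μ * (2 * r) =
        (2 * r / (1 + r ^ 2)) * (((1 + r ^ 2) * (m r / r ^ 2) / 4 - 1 + 5 * μ * r ^ 2) + 5 * μ) := by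
        field_simp
        ring
      rw [h2]
      have : 0 ≤ 5 * μ := by positivity
      have : 0 ≤ ((1 + r ^ 2) * (m r / r ^ 2) / 4 - 1 + 5 * μ * r ^ 2) + 5 * μ := by linarith
      positivity
    · have h1 : Tendsto (fun r : ℝ => log (1 + r ^ 2)) (𝓝[>] 0) (𝓝 0) := by
        have := (hr2t.const_add 1).log (by norm_num)
        simpa using this
      simpa using ((hPt.div_const 2).neg.sub h1).add (hr2t.const_mul (5 * μ))
  have hanti : ∀ a b, 0 < a → a ≤ b → P b ≤ P a := by
    intro a b ha hab
    have : AntitoneOn P (Ioi 0) := by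
      apply antitoneOn_of_deriv_nonpos (convex_Ioi 0)
      · intro x hx
        exact (hP x hx).continuousAt.continuousWithinAt
      · intro x hx
        rw [interior_Ioi] at hx
        exact (hP x hx).differentiableAt.differentiableWithinAt
      · intro x hx
        rw [interior_Ioi] at hx
        rw [(hP' x hx).deriv]
        have := div_nonneg (m0 x hx) (le_of_lt hx)
        linarith
    exact this ha (lt_of_lt_of_le ha hab) hab
  -- step 9
  have hPall : ∀ r, 0 < r → exp (P r) ≤ 32 * exp 10 * exp (μ * r ^ 2 / 4) / (1 + r ^ 2) ^ 2 := by
    intro r hr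
    have hx : 0 < μ * r ^ 2 := by positivity
    rcases le_total (μ * r ^ 2) 1 with h | h
    · refine (hPd r hr h).trans ?_
      gcongr
      have : 1 ≤ exp (μ * r ^ 2 / 4) := one_le_exp (by positivity)
      nlinarith [exp_pos 10]
    · set a := (√μ)⁻¹ with ha
      have hsμ : 0 < √μ := sqrt_pos.2 hμ
      have ha0 : 0 < a := inv_pos.2 hsμ
      have ha2 : a ^ 2 = 1 / μ := by
        rw [ha, inv_pow, sq_sqrt hμ.le, one_div]
      have hμa : μ * a ^ 2 = 1 := by rw [ha2]; field_simp
      have har : a ≤ r := by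
        refine le_of_sq_le_sq ?_ hr.le
        nlinarith
      have h1 : exp (P r) ≤ exp 10 / (1 + a ^ 2) ^ 2 :=
        (exp_le_exp.2 (hanti a r ha0 har)).trans (hPd a ha0 hμa.le)
      refine h1.trans ?_
      rw [div_le_div_iff₀ (by positivity) (by positivity)]
      have h2 : 1 + r ^ 2 ≤ (μ * r ^ 2) * (1 + a ^ 2) := by
        have : (μ * r ^ 2) * (1 + a ^ 2) = μ * r ^ 2 + r ^ 2 * (μ * a ^ 2) := by ring
        rw [this, hμa]; linarith
      have h3 : (μ * r ^ 2) ^ 2 ≤ 32 * exp (μ * r ^ 2 / 4) := by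
        have := quadratic_le_exp_of_nonneg (x := μ * r ^ 2 / 4) (by positivity)
        nlinarith
      calc exp 10 * (1 + r ^ 2) ^ 2 ≤ exp 10 * ((μ * r ^ 2) * (1 + a ^ 2)) ^ 2 := by gcongr
        _ = exp 10 * (μ * r ^ 2) ^ 2 * (1 + a ^ 2) ^ 2 := by ring
        _ ≤ exp 10 * (32 * exp (μ * r ^ 2 / 4)) * (1 + a ^ 2) ^ 2 := by gcongr
        _ = _ := by ring
  have hQall : ∀ r, 0 < r → Q r ≤
      (256 * exp 10) * Real.exp (-(μ * (1/2) * r ^ 2 / 2)) / (1 + r ^ 2) ^ 2 := by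
    intro r hr
    have h1 := hPall r hr
    calc Q r = 8 * (exp (P r) * exp (-(μ * r ^ 2 / 2))) := by
          rw [← exp_add]; simp only [hQdef]; ring_nf
      _ ≤ 8 * (32 * exp 10 * exp (μ * r ^ 2 / 4) / (1 + r ^ 2) ^ 2 * exp (-(μ * r ^ 2 / 2))) := by
          gcongr
      _ = 256 * exp 10 * (exp (μ * r ^ 2 / 4) * exp (-(μ * r ^ 2 / 2))) / (1 + r ^ 2) ^ 2 := by
          ring
      _ = _ := by
          rw [← exp_add]; congr 3; ring
  -- step 10
  have hmall : ∀ r, 0 < r → m r ≤ (128 * exp 10) * (1 - 1 / (1 + r ^ 2)) := by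
    intro R hR
    have := mono_lim (fun r => (128 * exp 10) * (1 - 1 / (1 + r ^ 2)) - m r)
      (fun r => r * ((256 * exp 10) / (1 + r ^ 2) ^ 2 - Q r) + μ * ε * r * m r) R 0 ?_ ?_ ?_
      R hR le_rfl
    · linarith
    · intro r h0 _
      have h1 : HasDerivAt (fun r : ℝ => 1 / (1 + r ^ 2)) (-(2 * r) / (1 + r ^ 2) ^ 2) r := by
        have := ((hr2 r).const_add 1).inv (by positivity)
        refine (this.congr_of_eventuallyEq (Eventually.of_forall fun y => ?_))
        simp
      refine ((((h1.const_sub 1).const_mul (128 * exp 10))).sub (hm' r h0)).congr_deriv ?_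
      ring
    · intro r h0 _
      have h1 := m0 r h0
      have h2 : Q r ≤ (256 * exp 10) / (1 + r ^ 2) ^ 2 := by
        refine (hQall r h0).trans ?_
        refine div_le_div_of_nonneg_right ?_ (by positivity)
        have : exp (-(μ * (1/2) * r ^ 2 / 2)) ≤ 1 := by
          rw [exp_le_one_iff]
          have : 0 ≤ μ * (1/2) * r ^ 2 / 2 := by positivity
          linarith
        nlinarith [exp_pos 10]
      have h3 : 0 ≤ (256 * exp 10) / (1 + r ^ 2) ^ 2 - Q r := by linarith
      positivity
    · have h1 : Tendsto (fun r : ℝ => 1 / (1 + r ^ 2)) (𝓝[>] 0) (𝓝 1) := by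
        simpa using (hr2t.const_add 1).inv₀ (by norm_num)
      simpa using ((h1.const_sub 1).const_mul (128 * exp 10)).sub hmt
  intro r hr
  refine ⟨?_, hQall r hr, hmall r hr⟩
  rw [hqm r hr]
  have := div_nonneg (m0 r hr) hr.le
  linarith

/-- uniform bounds on `Q`, `∇P` and `ΔP`, viewing `(Q, P)` as radially
symmetric functions on `ℝ²` (so that `|∇P(x)| = |P'(|x|)|` and
`ΔP(x) = P''(|x|) + P'(|x|)/|x|` for `x ≠ 0`). -/
theorem stmt2 :
    ∃ C₀ > (0:ℝ), ∃ C₁ > (0:ℝ), ∃ C₂ > (0:ℝ), ∃ C₃ > (0:ℝ), ∃ ε₀ > (0:ℝ),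
      ∃ θ ∈ Set.Ioo (0:ℝ) 1,
        ∀ μ > (0:ℝ), ∀ ε ∈ Set.Ioc (0:ℝ) ε₀, ∀ P : ℝ → ℝ, IsRadialProfile μ ε P →
          ∀ x : R2,
            (0 ≤ profQ μ P ‖x‖ ∧
              profQ μ P ‖x‖ ≤ C₀ * Real.exp (-(μ * θ * ‖x‖ ^ 2 / 2)) * (jap x) ^ (-(4:ℝ))) ∧
            (x ≠ 0 → (1 / ‖x‖ + jap x) * |Dr P ‖x‖| ≤ C₁) ∧
            (x ≠ 0 →
              |Dr (Dr P) ‖x‖ + Dr P ‖x‖ / ‖x‖| ≤ C₂ * μ * ε + C₃ * (jap x)⁻¹) := by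
  refine ⟨256 * exp 10, by positivity, 256 * exp 10, by positivity, 128 * exp 10, by positivity,
    256 * exp 10, by positivity, 1, one_pos, 1/2, by norm_num, ?_⟩
  intro μ hμ ε hε P hprof x
  obtain ⟨f1, f2, f3, f4, f5⟩ := profile_facts μ ε P hprof
  have hcore := core μ ε hμ hε.1 hε.2 P (Dr P) f1 f2 f3 f4 f5
  obtain ⟨-, hP0, -, hode⟩ := hprof
  have hj1 : 1 ≤ jap x := by
    unfold jap
    rw [one_le_sqrt]
    nlinarith [sq_nonneg ‖x‖]
  have hj0 : 0 < jap x := by linarith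
  have hj2 : jap x ^ 2 = 1 + ‖x‖ ^ 2 := by
    unfold jap
    rw [sq_sqrt (by positivity)]
  have hj4 : jap x ^ (-(4:ℝ)) = 1 / (1 + ‖x‖ ^ 2) ^ 2 := by
    rw [rpow_neg hj0.le, ← hj2, ← pow_mul, one_div]
    norm_cast
  have hxn : ∀ h : x ≠ 0, 0 < ‖x‖ := fun h => norm_pos_iff.2 h
  have hrj : ‖x‖ ≤ jap x := by
    refine le_of_sq_le_sq ?_ hj0.le
    rw [hj2]; linarith
  refine ⟨⟨by unfold profQ; positivity, ?_⟩, ?_, ?_⟩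
  · rw [hj4]
    by_cases h : x = 0
    · subst h
      simp [profQ, hP0]
      have : 1 ≤ exp 10 := one_le_exp (by norm_num)
      linarith
    · have := (hcore _ (hxn h)).2.1
      unfold profQ
      refine this.trans (le_of_eq ?_)
      ring
  · intro h
    have hr := hxn h
    obtain ⟨hq0, -, hm⟩ := hcore _ hr
    set r := ‖x‖
    set j := jap x
    rw [abs_of_nonpos hq0]
    have h1 : -Dr P r ≤ 128 * exp 10 * (r / j ^ 2) := by
      have : 128 * exp 10 * (1 - 1 / (1 + r ^ 2)) = r * (128 * exp 10 * (r / j ^ 2)) := by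
        rw [hj2]; field_simp; ring
      rw [this] at hm
      have : r * (-Dr P r) ≤ r * (128 * exp 10 * (r / j ^ 2)) := by linarith
      exact le_of_mul_le_mul_left this hr
    calc (1 / r + j) * -Dr P r ≤ (1 / r + j) * (128 * exp 10 * (r / j ^ 2)) := by gcongr
      _ = 128 * exp 10 * (1 / j ^ 2 + r / j) := by field_simp
      _ ≤ 128 * exp 10 * (1 + 1) := by
        gcongr
        · rw [div_le_one (by positivity)]; nlinarith
        · rw [div_le_one hj0]; exact hrj
      _ = _ := by ring
  · intro h
    have hr := hxn h
    obtain ⟨hq0, hQ, hm⟩ := hcore _ hr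
    have ho := hode _ hr
    set r := ‖x‖
    set j := jap x
    have h1 : Dr (Dr P) r + Dr P r / r =
        -(8 * exp (P r - μ * r ^ 2 / 2)) + μ * ε * (-(r * Dr P r)) := by
      have : Dr P r / r = 1 / r * Dr P r := by ring
      rw [this]; linarith
    have hm0 : 0 ≤ -(r * Dr P r) := by nlinarith
    have hmb : -(r * Dr P r) ≤ 128 * exp 10 := by
      refine hm.trans ?_
      have : 0 ≤ 1 / (1 + r ^ 2) := by positivity
      nlinarith [exp_pos 10]
    have hQb : 8 * exp (P r - μ * r ^ 2 / 2) ≤ 256 * exp 10 * j⁻¹ := by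
      refine hQ.trans ?_
      rw [← hj2, div_eq_mul_inv]
      have e1 : exp (-(μ * (1/2) * r ^ 2 / 2)) ≤ 1 := by
        rw [exp_le_one_iff]
        have : 0 ≤ μ * (1/2) * r ^ 2 / 2 := by positivity
        linarith
      have e2 : ((j ^ 2) ^ 2)⁻¹ ≤ j⁻¹ := by
        rw [← pow_mul]
        apply inv_anti₀ hj0
        exact le_self_pow₀ hj1 (by norm_num)
      calc _ ≤ 256 * exp 10 * 1 * j⁻¹ := by gcongr
        _ = _ := by ring
    have hμε : 0 < μ * ε := mul_pos hμ hε.1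
    have h2 : μ * ε * (-(r * Dr P r)) ≤ 128 * exp 10 * μ * ε := by
      calc _ ≤ μ * ε * (128 * exp 10) := by gcongr
        _ = _ := by ring
    have h3 : 0 ≤ μ * ε * (-(r * Dr P r)) := by positivity
    have h4 : 0 < exp (P r - μ * r ^ 2 / 2) := exp_pos _
    have h5 : 0 ≤ 256 * exp 10 * j⁻¹ := by positivity
    have h6 : 0 ≤ 128 * exp 10 * μ * ε := by
      have := hε.1
      positivity
    rw [h1, abs_le]
    constructor <;> linarith

end
end

section
/- There exist constants θ ∈ (0,1), C₁, C₂, C₃, C₄ > 0 and ε₀ > 0 such that for every μ ∈ (0,∞) and every ε ∈ (0, ε₀], if P_ε is a radial stationary profile for the parameters (μ, ε) and P₀ is a radial stationary profile for the parameters (μ, 0), with associated cell-density profiles Q_ε(r) = 8 e^{P_ε(r) − μ r²/2} and Q₀(r) = 8 e^{P₀(r) − μ r²/2}, then, viewing all of these as radially symmetric functions on ℝ², for every x ∈ ℝ²: (1) |∇P_ε(x) − ∇P₀(x)| ≤ C₁ √(με); (2) |ΔP_ε(x) − ΔP₀(x)| ≤ C₂ με; (3) |Q_ε(x) − Q₀(x)|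 ≤ C₃ με e^{−θμ|x|²/2}; (4) |∇Q_ε(x) − ∇Q₀(x)| ≤ C₄ με e^{−θμ|x|²/2}. -/
open Real Set

noncomputable section

/-- A function with nonnegative derivative on `(0,R)` satisfies `f 0 ≤ f R`. -/
lemma mono_aux_s3 {f f' : ℝ → ℝ} (hc : ContinuousOn f (Set.Ici 0))
    (hd : ∀ r > (0:ℝ), HasDerivAt f (f' r) r) {R : ℝ} (hR : 0 ≤ R)
    (hn : ∀ r > (0:ℝ), r < R → 0 ≤ f' r) : f 0 ≤ f R := by
  have hm : MonotoneOn f (Set.Icc 0 R) := by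
    apply monotoneOn_of_deriv_nonneg (convex_Icc 0 R)
    · exact hc.mono Set.Icc_subset_Ici_self
    · intro r hr
      rw [interior_Icc] at hr
      exact (hd r hr.1).differentiableAt.differentiableWithinAt
    · intro r hr
      rw [interior_Icc] at hr
      rw [(hd r hr.1).deriv]
      exact hn r hr.1 hr.2
  exact hm ⟨le_refl _, hR⟩ ⟨hR, le_refl _⟩ hR

lemma prof_reg {μ ε : ℝ} {P : ℝ → ℝ} (h : IsRadialProfile μ ε P) :
    ContinuousOn P (Set.Ici 0) ∧ ContinuousOn (Dr P) (Set.Ici 0) ∧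
    (∀ r ≥ (0:ℝ), HasDerivWithinAt P (Dr P r) (Set.Ici 0) r) ∧
    (∀ r > (0:ℝ), HasDerivAt P (Dr P r) r) ∧
    (∀ r > (0:ℝ), HasDerivAt (Dr P) (Dr (Dr P) r) r) := by
  obtain ⟨hC, -, -, -⟩ := h
  have hD : ContDiffOn ℝ 1 (Dr P) (Set.Ici 0) :=
    hC.derivWithin (uniqueDiffOn_Ici 0) (by norm_num)
  have h1 : ∀ r ≥ (0:ℝ), HasDerivWithinAt P (Dr P r) (Set.Ici 0) r := fun r hr =>
    ((hC.differentiableOn (by norm_num)) r hr).hasDerivWithinAt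
  have h2 : ∀ r ≥ (0:ℝ), HasDerivWithinAt (Dr P) (Dr (Dr P) r) (Set.Ici 0) r := fun r hr =>
    ((hD.differentiableOn (by norm_num)) r hr).hasDerivWithinAt
  exact ⟨hC.continuousOn, hD.continuousOn, h1,
    fun r hr => (h1 r hr.le).hasDerivAt (Ici_mem_nhds hr),
    fun r hr => (h2 r hr.le).hasDerivAt (Ici_mem_nhds hr)⟩

lemma profQ_deriv {μ ε : ℝ} {P : ℝ → ℝ} (h : IsRadialProfile μ ε P) {r : ℝ} (hr : 0 ≤ r) :
    HasDerivWithinAt (profQ μ P) (profQ μ P r * (Dr P r - μ * r)) (Set.Ici 0) r := by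
  have h1 := (prof_reg h).2.2.1 r hr
  have h2 : HasDerivWithinAt (fun s : ℝ => μ * s ^ 2 / 2) (μ * r) (Set.Ici 0) r := by
    have := (((hasDerivAt_id r).pow 2).const_mul μ).div_const 2
    refine (this.congr_deriv ?_).hasDerivWithinAt
    simp; ring
  have h3 := ((h1.sub h2).exp).const_mul 8
  refine h3.congr_deriv ?_
  simp only [profQ, Pi.sub_apply]; ring

lemma Dr_profQ {μ ε : ℝ} {P : ℝ → ℝ} (h : IsRadialProfile μ ε P) {r : ℝ} (hr : 0 ≤ r) :
    Dr (profQ μ P) r = profQ μ P r * (Dr P r - μ * r) :=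
  (profQ_deriv h hr).derivWithin (uniqueDiffOn_Ici 0 r hr)

lemma prof_bounds {μ ε : ℝ} {P : ℝ → ℝ} (hμ : 0 < μ) (hε : 0 ≤ ε) (hε1 : ε ≤ 2 / 5)
    (h : IsRadialProfile μ ε P) :
    ∃ m : ℝ → ℝ, (∀ r > (0:ℝ), HasDerivAt m (r * profQ μ P r) r) ∧
      ∀ r > (0:ℝ), 0 ≤ m r ∧ m r ≤ 4 ∧ 0 ≤ -(r * Dr P r) ∧ -(r * Dr P r) ≤ m r ∧
        m r ≤ 4 * r ^ 2 ∧ r ^ 2 * Real.exp (P r) ≤ (1 + μ * r ^ 2) / 2 ∧ P r ≤ 0 ∧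
        -2 * r ^ 2 ≤ P r := by
  obtain ⟨hPc, hDc, -, hP1, hP2⟩ := prof_reg h
  have hQd := fun r (hr : (0:ℝ) < r) => (profQ_deriv h hr.le).hasDerivAt (Ici_mem_nhds hr)
  have hQc : ContinuousOn (profQ μ P) (Set.Ici 0) := fun r hr =>
    (profQ_deriv h hr).continuousWithinAt
  obtain ⟨-, hP0, hDP0, hode⟩ := h
  have hQpos : ∀ r, 0 < profQ μ P r := fun r => by unfold profQ; positivity
  -- the mass
  set g : ℝ → ℝ := fun s => s * profQ μ P |s| with hg
  have hgc : Continuous g := by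
    refine continuous_id.mul ?_
    exact hQc.comp_continuous continuous_abs (fun x => abs_nonneg x)
  set m : ℝ → ℝ := fun r => ∫ s in (0:ℝ)..r, g s with hm
  have hmd' : ∀ r, HasDerivAt m (g r) r := fun r => hgc.integral_hasStrictDerivAt 0 r |>.hasDerivAt
  have hmd : ∀ r > (0:ℝ), HasDerivAt m (r * profQ μ P r) r := by
    intro r hr
    have := hmd' r
    simpa [hg, abs_of_pos hr] using this
  have hmc : Continuous m := continuous_iff_continuousAt.2 fun r => (hmd' r).continuousAt
  have hm0 : m 0 = 0 := by simp [hm]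
  -- n
  set n : ℝ → ℝ := fun r => -(r * Dr P r) with hn
  have hnc : ContinuousOn n (Set.Ici 0) := (continuousOn_id.mul hDc).neg
  have hn0 : n 0 = 0 := by simp [hn]
  have hnd : ∀ r > (0:ℝ), HasDerivAt n (r * profQ μ P r - μ * ε * r * n r) r := by
    intro r hr
    refine ((hasDerivAt_id r).mul (hP2 r hr)).neg.congr_deriv ?_
    have e := hode r hr
    have e2 : Dr (Dr P) r = -profQ μ P r - (1 / r + μ * ε * r) * Dr P r := by
      unfold profQ; linarith
    rw [e2]
    simp only [hn, id]
    field_simp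
    ring
  have hnnn : ∀ r ≥ (0:ℝ), 0 ≤ n r := by
    intro r hr
    have hE : ∀ s : ℝ, HasDerivAt (fun s : ℝ => Real.exp (μ * ε * s ^ 2 / 2))
        (Real.exp (μ * ε * s ^ 2 / 2) * (μ * ε * s)) s := by
      intro s
      have := ((((hasDerivAt_id s).pow 2).const_mul (μ * ε)).div_const 2).exp
      refine this.congr_deriv ?_
      simp; ring
    have := mono_aux_s3 (f := fun s => n s * Real.exp (μ * ε * s ^ 2 / 2))
      (f' := fun s => s * profQ μ P s * Real.exp (μ * ε * s ^ 2 / 2))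
      (hnc.mul (by fun_prop)) (fun s hs => by
        refine ((hnd s hs).mul (hE s)).congr_deriv ?_
        ring) hr (fun s hs _ => by have := hQpos s; positivity)
    simp only [hn0, zero_mul] at this
    by_contra hneg
    push Not at hneg
    have := mul_neg_of_neg_of_pos hneg (Real.exp_pos (μ * ε * r ^ 2 / 2))
    linarith
  have hnm : ∀ r ≥ (0:ℝ), n r ≤ m r := by
    intro r hr
    have := mono_aux_s3 (f := fun s => m s - n s) (f' := fun s => μ * ε * s * n s)
      (hmc.continuousOn.sub hnc) (fun s hs => by
        refine ((hmd s hs).sub (hnd s hs)).congr_deriv ?_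
        ring) hr (fun s hs _ => by have := hnnn s hs.le; positivity)
    simp only [hn0, hm0] at this
    linarith
  have hmn : ∀ r ≥ (0:ℝ), m r - n r ≤ μ * ε * r ^ 2 * m r / 2 := by
    intro r hr
    have hsq : ∀ s : ℝ, HasDerivAt (fun s : ℝ => μ * ε * s ^ 2) (μ * ε * (2 * s)) s := by
      intro s
      refine (((hasDerivAt_id s).pow 2).const_mul (μ * ε)).congr_deriv ?_
      simp
    have := mono_aux_s3 (f := fun s => μ * ε * s ^ 2 * m s / 2 - (m s - n s))
      (f' := fun s => μ * ε * s * (m s - n s) + μ * ε * s ^ 2 * (s * profQ μ P s) / 2)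
      (by
        refine ContinuousOn.sub ?_ (hmc.continuousOn.sub hnc)
        exact Continuous.continuousOn (by fun_prop)) (fun s hs => by
        refine ((((hsq s).mul (hmd s hs)).div_const 2).sub
          ((hmd s hs).sub (hnd s hs))).congr_deriv ?_
        ring) hr (fun s hs _ => by
          have := hQpos s
          have h2 := sub_nonneg.2 (hnm s hs.le)
          positivity)
    simp only [hn0, hm0] at this
    norm_num at this
    linarith
  have hmmono : ∀ a b, 0 ≤ a → a ≤ b → m a ≤ m b := by
    intro a b ha hab
    have : MonotoneOn m (Set.Ici 0) := by
      apply monotoneOn_of_deriv_nonneg (convex_Ici 0) hmc.continuousOn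
      · exact fun r _ => (hmd' r).differentiableAt.differentiableWithinAt
      · intro r hr
        rw [interior_Ici] at hr
        rw [(hmd r hr).deriv]
        have := hQpos r
        have := hr.out.le
        positivity
    exact this ha (ha.trans hab) hab
  have hPanti : ∀ a b, 0 ≤ a → a ≤ b → P b ≤ P a := by
    intro a b ha hab
    have : AntitoneOn P (Set.Ici 0) := by
      apply antitoneOn_of_deriv_nonpos (convex_Ici 0) hPc
      · intro r hr
        rw [interior_Ici] at hr
        exact (hP1 r hr).differentiableAt.differentiableWithinAt
      · intro r hr
        rw [interior_Ici] at hr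
        rw [(hP1 r hr).deriv]
        have h1 := hnnn r hr.out.le
        simp only [hn] at h1
        by_contra hneg
        push Not at hneg
        have := mul_pos hr.out hneg
        linarith
    exact this ha (ha.trans hab) hab
  have hPle : ∀ r ≥ (0:ℝ), P r ≤ 0 := fun r hr => by
    have := hPanti 0 r le_rfl hr
    rwa [hP0] at this
  have hQ8 : ∀ r ≥ (0:ℝ), profQ μ P r ≤ 8 := by
    intro r hr
    have : Real.exp (P r - μ * r ^ 2 / 2) ≤ 1 := by
      rw [Real.exp_le_one_iff]
      have := hPle r hr
      have : 0 ≤ μ * r ^ 2 / 2 := by positivity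
      linarith
    unfold profQ; linarith
  have hsq2 : ∀ (c s : ℝ), HasDerivAt (fun s : ℝ => c * s ^ 2) (c * (2 * s)) s := by
    intro c s
    refine (((hasDerivAt_id s).pow 2).const_mul c).congr_deriv ?_
    simp
  have hm4r : ∀ r ≥ (0:ℝ), m r ≤ 4 * r ^ 2 := by
    intro r hr
    have := mono_aux_s3 (f := fun s => 4 * s ^ 2 - m s)
      (f' := fun s => s * (8 - profQ μ P s))
      (Continuous.continuousOn (by fun_prop)) (fun s hs => by
        refine ((hsq2 4 s).sub (hmd s hs)).congr_deriv ?_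
        ring) hr (fun s hs _ => by
          have := sub_nonneg.2 (hQ8 s hs.le)
          positivity)
    simp only [hm0] at this
    norm_num at this
    linarith
  have hPlow : ∀ r ≥ (0:ℝ), -2 * r ^ 2 ≤ P r := by
    intro r hr
    have := mono_aux_s3 (f := fun s => P s + 2 * s ^ 2)
      (f' := fun s => Dr P s + 2 * (2 * s))
      (hPc.add (Continuous.continuousOn (by fun_prop))) (fun s hs =>
        (hP1 s hs).add (hsq2 2 s)) hr (fun s hs _ => by
          have h1 := (hnm s hs.le).trans (hm4r s hs.le)
          simp only [hn] at h1
          by_contra hneg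
          push Not at hneg
          nlinarith [mul_neg_of_pos_of_neg hs hneg])
    simp only [hP0] at this
    norm_num at this
    linarith
  have hkey5 : ∀ r ≥ (0:ℝ), m r ≤ 5 → r ^ 2 * profQ μ P r ≤ 2 * m r - m r ^ 2 / 2 := by
    intro r hr h5
    have := mono_aux_s3 (f := fun s => 2 * m s - m s ^ 2 / 2 - s ^ 2 * profQ μ P s)
      (f' := fun s => s * profQ μ P s * (n s - m s + μ * s ^ 2))
      (ContinuousOn.sub (Continuous.continuousOn (by fun_prop))
        (ContinuousOn.mul (by fun_prop) hQc)) (fun s hs => by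
        have hs2 : HasDerivAt (fun s : ℝ => s ^ 2) (2 * s) s := by
          simpa using hsq2 1 s
        refine ((((hmd s hs).const_mul 2).sub (((hmd s hs).pow 2).div_const 2)).sub
          (hs2.mul (hQd s hs))).congr_deriv ?_
        simp only [hn]
        norm_num
        ring) hr (fun s hs hsr => by
          have hq := hQpos s
          refine mul_nonneg (by positivity) ?_
          have h1 := hmn s hs.le
          have h2 := (hmmono s r hs.le hsr.le).trans h5
          have h3 : ε * m s ≤ 2 := by
            have : 0 ≤ m s := (hnnn s hs.le).trans (hnm s hs.le)
            nlinarith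
          have h4 : 0 ≤ μ * s ^ 2 := by positivity
          nlinarith)
    simp only [hm0] at this
    norm_num at this
    linarith
  have hm5 : ∀ r ≥ (0:ℝ), m r ≤ 5 := by
    intro r hr
    by_contra hcon
    push Not at hcon
    obtain ⟨t, ht, ht5⟩ := intermediate_value_Icc hr hmc.continuousOn
      (show (5:ℝ) ∈ Set.Icc (m 0) (m r) from ⟨by rw [hm0]; norm_num, hcon.le⟩)
    have := hkey5 t ht.1 ht5.le
    rw [ht5] at this
    have h2 : 0 ≤ t ^ 2 * profQ μ P t := by have := hQpos t; positivity
    linarith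
  have hm4 : ∀ r ≥ (0:ℝ), m r ≤ 4 := by
    intro r hr
    have := hkey5 r hr (hm5 r hr)
    have h2 : 0 ≤ r ^ 2 * profQ μ P r := by have := hQpos r; positivity
    by_contra hcon
    push Not at hcon
    nlinarith
  have hQ2 : ∀ r ≥ (0:ℝ), r ^ 2 * profQ μ P r ≤ 2 := by
    intro r hr
    have := hkey5 r hr (hm5 r hr)
    nlinarith [sq_nonneg (m r - 2)]
  have hexp : Real.exp (1 / 2) ≤ 2 := by
    have h1 : Real.exp (1 / 2) * Real.exp (1 / 2) = Real.exp 1 := by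
      rw [← Real.exp_add]; norm_num
    have h2 := Real.exp_one_lt_d9
    have h3 := Real.exp_pos (1 / 2)
    nlinarith
  have hsmall : ∀ r ≥ (0:ℝ), μ * r ^ 2 ≤ 1 → r ^ 2 * Real.exp (P r) ≤ 1 / 2 := by
    intro r hr hy
    have h1 := hQ2 r hr
    have h2 : Real.exp (P r) = Real.exp (P r - μ * r ^ 2 / 2) * Real.exp (μ * r ^ 2 / 2) := by
      rw [← Real.exp_add]; ring_nf
    have h3 : Real.exp (μ * r ^ 2 / 2) ≤ 2 :=
      (Real.exp_le_exp.2 (by linarith)).trans hexp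
    unfold profQ at h1
    rw [h2]
    have h4 : 0 ≤ r ^ 2 * Real.exp (P r - μ * r ^ 2 / 2) := by positivity
    calc r ^ 2 * (Real.exp (P r - μ * r ^ 2 / 2) * Real.exp (μ * r ^ 2 / 2))
        = (r ^ 2 * Real.exp (P r - μ * r ^ 2 / 2)) * Real.exp (μ * r ^ 2 / 2) := by ring
      _ ≤ (r ^ 2 * Real.exp (P r - μ * r ^ 2 / 2)) * 2 := by gcongr
      _ ≤ 1 / 2 := by linarith
  have hall : ∀ r ≥ (0:ℝ), r ^ 2 * Real.exp (P r) ≤ (1 + μ * r ^ 2) / 2 := by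
    intro r hr
    have hy0 : 0 ≤ μ * r ^ 2 := by positivity
    rcases le_total (μ * r ^ 2) 1 with hy | hy
    · have := hsmall r hr hy
      linarith
    · set R := 1 / Real.sqrt μ with hR
      have hR0 : 0 ≤ R := by positivity
      have hR2 : R ^ 2 = 1 / μ := by
        rw [hR, div_pow, Real.sq_sqrt hμ.le]; norm_num
      have hRr : R ≤ r := by
        apply abs_le_of_sq_le_sq' _ hr |>.2
        rw [hR2, div_le_iff₀ hμ]; linarith
      have h1 := hsmall R hR0 (by rw [hR2]; field_simp; norm_num)
      rw [hR2] at h1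
      have h2 : Real.exp (P R) ≤ μ / 2 := by
        rw [one_div, inv_mul_le_iff₀ hμ] at h1
        linarith
      have h3 : Real.exp (P r) ≤ μ / 2 := (Real.exp_le_exp.2 (hPanti R r hR0 hRr)).trans h2
      have h4 : r ^ 2 * Real.exp (P r) ≤ r ^ 2 * (μ / 2) := by gcongr
      linarith
  refine ⟨m, hmd, fun r hr => ⟨(hnnn r hr.le).trans (hnm r hr.le), hm4 r hr.le, hnnn r hr.le,
    hnm r hr.le, hm4r r hr.le, hall r hr.le, hPle r hr.le, hPlow r hr.le⟩⟩

lemma exp_diff (a b : ℝ) : |Real.exp a - Real.exp b| ≤ (Real.exp a + Real.exp b) * |a - b| := by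
  have ha := Real.exp_pos a
  have hb := Real.exp_pos b
  have key : ∀ x y : ℝ, x ≤ y → Real.exp y - Real.exp x ≤ Real.exp y * (y - x) := by
    intro x y _
    have h1 := Real.add_one_le_exp (x - y)
    have h2 : Real.exp x = Real.exp y * Real.exp (x - y) := by rw [← Real.exp_add]; ring_nf
    have h3 := Real.exp_pos y
    rw [h2]
    nlinarith
  rcases le_total a b with h | h
  · have h1 := key a b h
    have h2 := Real.exp_le_exp.2 h
    rw [abs_of_nonpos (by linarith), abs_of_nonpos (by linarith)]
    nlinarith [mul_nonneg ha.le (sub_nonneg.2 h)]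
  · have h1 := key b a h
    have h2 := Real.exp_le_exp.2 h
    rw [abs_of_nonneg (by linarith), abs_of_nonneg (by linarith)]
    nlinarith [mul_nonneg hb.le (sub_nonneg.2 h)]

lemma profQ_diff (μ : ℝ) (P P' : ℝ → ℝ) (r : ℝ) : |profQ μ P r - profQ μ P' r| ≤
    (profQ μ P r + profQ μ P' r) * |P r - P' r| := by
  have h := exp_diff (P r - μ * r ^ 2 / 2) (P' r - μ * r ^ 2 / 2)
  unfold profQ
  rw [← mul_sub, abs_mul, ← mul_add, mul_assoc]
  rw [sub_sub_sub_cancel_right] at h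
  rw [abs_of_pos (by norm_num : (0:ℝ) < 8)]
  linarith

/-- The algebraic heart of the energy inequality. -/
lemma energy_alg {d u g q κ n : ℝ} (hg : |g| ≤ q * |d|) (hq : 0 ≤ q) (hκ : 0 ≤ κ)
    (hn0 : 0 ≤ n) (hn : n ≤ 4) :
    2 * d * (u - 2 * d) + 2 * u * (-2 * u - g + κ * n) ≤ q * (d ^ 2 + u ^ 2)
      + 8 * κ ^ 2 - (d ^ 2 + u ^ 2) := by
  have h1 : -(2 * u * g) ≤ q * (d ^ 2 + u ^ 2) := by
    have : -(u * g) ≤ |u| * |g| := by rw [← abs_mul]; exact neg_le_abs _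
    have h2 : |u| * |g| ≤ |u| * (q * |d|) := by gcongr
    have h3 : 0 ≤ q * (|u| - |d|) ^ 2 := by positivity
    have h4 := sq_abs u
    have h5 := sq_abs d
    nlinarith
  have h2 : 2 * u * (κ * n) ≤ 2 * u ^ 2 + 8 * κ ^ 2 := by
    have : (κ * n) ^ 2 ≤ (4 * κ) ^ 2 := by
      apply pow_le_pow_left₀ (by positivity)
      nlinarith
    nlinarith [sq_nonneg (2 * u - κ * n)]
  nlinarith [sq_nonneg (d - u)]

lemma diff_bound {μ ε : ℝ} {Pe P0 : ℝ → ℝ} (hμ : 0 < μ) (hε : 0 < ε) (hε1 : ε ≤ 2 / 5)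
    (he : IsRadialProfile μ ε Pe) (h0 : IsRadialProfile μ 0 P0) {r : ℝ} (hr : 0 < r) :
    (Pe r - P0 r) ^ 2 + (r * (Dr Pe r - Dr P0 r)) ^ 2 ≤
      8 * Real.exp 8 * (μ * ε) ^ 2 * r ^ 4 := by
  obtain ⟨me, hmed, hbe⟩ := prof_bounds hμ hε.le hε1 he
  obtain ⟨m0, hm0d, hb0⟩ := prof_bounds hμ le_rfl (by norm_num) h0
  obtain ⟨-, -, -, he1, he2⟩ := prof_reg he
  obtain ⟨-, -, -, h01, h02⟩ := prof_reg h0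
  have hodee := he.2.2.2
  have hode0 := h0.2.2.2
  set κ := μ * ε with hκ
  have hκ0 : 0 < κ := by positivity
  set d : ℝ → ℝ := fun s => (Pe s - P0 s) / s ^ 2 with hd
  set u : ℝ → ℝ := fun s => (Dr Pe s - Dr P0 s) / s with hu
  set E : ℝ → ℝ := fun s => d s ^ 2 + u s ^ 2 with hE
  set W : ℝ → ℝ := fun s => Real.exp (-(me s + m0 s)) with hW
  set H : ℝ → ℝ := fun s => s * (E s * W s - 8 * κ ^ 2) with hH
  have hdd : ∀ s > (0:ℝ), HasDerivAt d ((u s - 2 * d s) / s) s := by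
    intro s hs
    have hs2 : HasDerivAt (fun s : ℝ => s ^ 2) (2 * s) s := by
      refine ((hasDerivAt_id s).pow 2).congr_deriv ?_
      simp
    refine (((he1 s hs).sub (h01 s hs)).div hs2 (by positivity)).congr_deriv ?_
    simp only [hd, hu, Pi.sub_apply]
    field_simp
  have hud : ∀ s > (0:ℝ), HasDerivAt u ((-2 * u s - (profQ μ Pe s - profQ μ P0 s)
      + κ * (-(s * Dr Pe s))) / s) s := by
    intro s hs
    refine (((he2 s hs).sub (h02 s hs)).div (hasDerivAt_id s) hs.ne').congr_deriv ?_
    have e1 : Dr (Dr Pe) s = -profQ μ Pe s - (1 / s + κ * s) * Dr Pe s := by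
      have := hodee s hs
      unfold profQ; linarith
    have e2 : Dr (Dr P0) s = -profQ μ P0 s - (1 / s) * Dr P0 s := by
      have := hode0 s hs
      simp only [mul_zero, zero_mul, add_zero] at this
      unfold profQ; linarith
    rw [e1, e2]
    simp only [hu, Pi.sub_apply, id]
    field_simp
    ring
  have hWd : ∀ s > (0:ℝ), HasDerivAt W
      (W s * (-(s * profQ μ Pe s + s * profQ μ P0 s))) s := fun s hs =>
    ((hmed s hs).add (hm0d s hs)).neg.exp
  have hHd : ∀ s > (0:ℝ), HasDerivAt H ((E s * W s - 8 * κ ^ 2) + W s *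
      ((2 * d s * (u s - 2 * d s) + 2 * u s * (-2 * u s - (profQ μ Pe s - profQ μ P0 s)
        + κ * (-(s * Dr Pe s)))) - s ^ 2 * (profQ μ Pe s + profQ μ P0 s) * E s)) s := by
    intro s hs
    refine ((hasDerivAt_id s).mul ((((((hdd s hs).pow 2).add ((hud s hs).pow 2)).mul
      (hWd s hs))).sub_const (8 * κ ^ 2))).congr_deriv ?_
    simp only [hE, id, Pi.add_apply, Pi.pow_apply, Pi.mul_apply]
    norm_num
    field_simp
    ring
  have hHn : ∀ s > (0:ℝ), ((E s * W s - 8 * κ ^ 2) + W s *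
      ((2 * d s * (u s - 2 * d s) + 2 * u s * (-2 * u s - (profQ μ Pe s - profQ μ P0 s)
        + κ * (-(s * Dr Pe s)))) - s ^ 2 * (profQ μ Pe s + profQ μ P0 s) * E s)) ≤ 0 := by
    intro s hs
    obtain ⟨a1, a2, a3, a4, -⟩ := hbe s hs
    obtain ⟨b1, -⟩ := hb0 s hs
    have hq : 0 ≤ s ^ 2 * (profQ μ Pe s + profQ μ P0 s) := by unfold profQ; positivity
    have hg : |profQ μ Pe s - profQ μ P0 s| ≤
        s ^ 2 * (profQ μ Pe s + profQ μ P0 s) * |d s| := by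
      refine (profQ_diff μ Pe P0 s).trans (le_of_eq ?_)
      have : Pe s - P0 s = s ^ 2 * d s := by
        simp only [hd]; field_simp
      rw [this, abs_mul, abs_of_nonneg (sq_nonneg s)]
      ring
    have h1 := energy_alg (u := u s) hg hq hκ0.le a3 (a4.trans a2)
    have hW0 : 0 < W s := Real.exp_pos _
    have hW1 : W s ≤ 1 := by
      simp only [hW]; rw [Real.exp_le_one_iff]; linarith
    have h2 := mul_le_mul_of_nonneg_left h1 hW0.le
    have h3 : 0 ≤ 8 * κ ^ 2 := by positivity
    have h4 := mul_le_mul_of_nonneg_left hW1 h3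
    have hEs : E s = d s ^ 2 + u s ^ 2 := rfl
    rw [hEs]
    linarith
  have hanti : AntitoneOn H (Set.Ioi 0) := by
    apply antitoneOn_of_deriv_nonpos (convex_Ioi 0)
    · exact fun s hs => (hHd s hs).continuousAt.continuousWithinAt
    · rw [interior_Ioi]
      exact fun s hs => (hHd s hs).differentiableAt.differentiableWithinAt
    · rw [interior_Ioi]
      intro s hs
      rw [(hHd s hs).deriv]
      exact hHn s hs
  have hsm : ∀ s > (0:ℝ), H s ≤ 20 * s := by
    intro s hs
    obtain ⟨a1, a2, a3, a4, a5, a6, a7, a8⟩ := hbe s hs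
    obtain ⟨b1, b2, b3, b4, b5, b6, b7, b8⟩ := hb0 s hs
    have hs2 : 0 < s ^ 2 := by positivity
    have hd2 : |d s| ≤ 2 := by
      simp only [hd]
      rw [abs_div, abs_of_pos hs2, div_le_iff₀ hs2, abs_le]
      constructor <;> linarith
    have hu4 : |u s| ≤ 4 := by
      have : u s = (s * Dr Pe s - s * Dr P0 s) / s ^ 2 := by
        simp only [hu]; field_simp
      rw [this, abs_div, abs_of_pos hs2, div_le_iff₀ hs2, abs_le]
      constructor <;> linarith
    have hd2' := abs_le.1 hd2
    have hu4' := abs_le.1 hu4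
    have hEs : E s ≤ 20 := by
      have : E s = d s ^ 2 + u s ^ 2 := rfl
      nlinarith
    have hE0 : 0 ≤ E s := by
      have : E s = d s ^ 2 + u s ^ 2 := rfl
      positivity
    have hW0 : 0 < W s := Real.exp_pos _
    have hW1 : W s ≤ 1 := by
      simp only [hW]; rw [Real.exp_le_one_iff]; linarith
    have h3 : E s * W s - 8 * κ ^ 2 ≤ 20 := by
      have : 0 ≤ 8 * κ ^ 2 := by positivity
      nlinarith
    have := mul_le_mul_of_nonneg_left h3 hs.le
    simp only [hH]
    linarith
  have hH0 : H r ≤ 0 := by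
    by_contra hcon
    push Not at hcon
    have hs : 0 < min r (H r / 40) := by positivity
    have h1 := hanti (Set.mem_Ioi.2 hs) (Set.mem_Ioi.2 hr) (min_le_left _ _)
    have h2 := hsm _ hs
    have h3 := min_le_right r (H r / 40)
    linarith
  have h5 : E r * W r - 8 * κ ^ 2 ≤ 0 := by
    by_contra hcon
    push Not at hcon
    have := mul_pos hr hcon
    simp only [hH] at hH0
    linarith
  have h6 : E r ≤ 8 * κ ^ 2 * Real.exp 8 := by
    have e1 : E r = E r * W r * Real.exp (me r + m0 r) := by
      simp only [hW]
      rw [mul_assoc, ← Real.exp_add]; simp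
    rw [e1]
    obtain ⟨-, a2, -⟩ := hbe r hr
    obtain ⟨-, b2, -⟩ := hb0 r hr
    have : Real.exp (me r + m0 r) ≤ Real.exp 8 := Real.exp_le_exp.2 (by linarith)
    have h7 : E r * W r ≤ 8 * κ ^ 2 := by linarith
    calc E r * W r * Real.exp (me r + m0 r) ≤ 8 * κ ^ 2 * Real.exp (me r + m0 r) := by gcongr
      _ ≤ _ := by gcongr
  have e2 : (Pe r - P0 r) ^ 2 + (r * (Dr Pe r - Dr P0 r)) ^ 2 = E r * r ^ 4 := by
    simp only [hE, hd, hu]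
    field_simp
  rw [e2]
  calc E r * r ^ 4 ≤ (8 * κ ^ 2 * Real.exp 8) * r ^ 4 := by gcongr
    _ = _ := by ring

lemma diff_bound2 {μ ε : ℝ} {Pe P0 : ℝ → ℝ} (hμ : 0 < μ) (hε : 0 < ε) (hε1 : ε ≤ 2 / 5)
    (he : IsRadialProfile μ ε Pe) (h0 : IsRadialProfile μ 0 P0) {r : ℝ} (hr : 0 < r) :
    |Pe r - P0 r| ≤ 3 * Real.exp 4 * (μ * ε) * r ^ 2 ∧
      |Dr Pe r - Dr P0 r| ≤ 3 * Real.exp 4 * (μ * ε) * r := by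
  have h := diff_bound hμ hε hε1 he h0 hr
  have e8 : Real.exp 8 = Real.exp 4 ^ 2 := by
    rw [← Real.exp_nat_mul]; norm_num
  have hb : 8 * Real.exp 8 * (μ * ε) ^ 2 * r ^ 4 ≤ (3 * Real.exp 4 * (μ * ε) * r ^ 2) ^ 2 := by
    rw [e8]
    have : 0 ≤ Real.exp 4 ^ 2 * (μ * ε) ^ 2 * r ^ 4 := by positivity
    nlinarith
  constructor
  · apply abs_le_of_sq_le_sq _ (by positivity)
    nlinarith [sq_nonneg (r * (Dr Pe r - Dr P0 r))]
  · have : |r * (Dr Pe r - Dr P0 r)| ≤ 3 * Real.exp 4 * (μ * ε) * r ^ 2 := by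
      apply abs_le_of_sq_le_sq _ (by positivity)
      nlinarith [sq_nonneg (Pe r - P0 r)]
    rw [abs_mul, abs_of_pos hr] at this
    by_contra hcon
    push Not at hcon
    have := mul_lt_mul_of_pos_left hcon hr
    linarith

lemma poly_exp {y : ℝ} (hy : 0 ≤ y) :
    Real.exp (-(y / 2)) * (1 + y) ^ 2 ≤ 32 * Real.exp (-(y / 4)) := by
  have h1 := Real.quadratic_le_exp_of_nonneg (show 0 ≤ y / 4 by positivity)
  have h2 : (1 + y) ^ 2 ≤ 32 * Real.exp (y / 4) := by nlinarith
  calc Real.exp (-(y / 2)) * (1 + y) ^ 2 ≤ Real.exp (-(y / 2)) * (32 * Real.exp (y / 4)) := by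
        gcongr
    _ = 32 * (Real.exp (-(y / 2)) * Real.exp (y / 4)) := by ring
    _ = _ := by rw [← Real.exp_add]; ring_nf

/-- Pointwise consequences of the `r² e^P` bound. -/
lemma weight_bounds {μ r p : ℝ} (hμ : 0 < μ) (hr : 0 < r) (hp : p ≤ 0)
    (h : r ^ 2 * Real.exp p ≤ (1 + μ * r ^ 2) / 2) :
    r ^ 2 * Real.exp p ≤ (1 + μ * r ^ 2) ^ 2 / 2 ∧
    r * Real.exp p ≤ 2 * (1 + μ * r ^ 2) ^ 2 ∧
    μ * r ^ 3 * Real.exp p ≤ (1 + μ * r ^ 2) ^ 2 := by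
  have hy : 0 < μ * r ^ 2 := by positivity
  set y := μ * r ^ 2 with hyd
  have hE : Real.exp p ≤ 1 := Real.exp_le_one_iff.2 hp
  have hE0 := Real.exp_pos p
  refine ⟨by nlinarith, ?_, ?_⟩
  · have : r * Real.exp p ≤ (1 + r ^ 2) * Real.exp p := by
      apply mul_le_mul_of_nonneg_right _ hE0.le
      nlinarith [sq_nonneg (r - 1)]
    nlinarith
  · rcases le_total μ 1 with h1 | h1
    · have h2 : μ * r ≤ 1 + y := by
        refine le_of_abs_le (abs_le_of_sq_le_sq ?_ (by positivity))
        have : (μ * r) ^ 2 = μ * y := by rw [hyd]; ring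
        rw [this]; nlinarith
      calc μ * r ^ 3 * Real.exp p = (μ * r) * (r ^ 2 * Real.exp p) := by ring
        _ ≤ (1 + y) * ((1 + y) / 2) := by gcongr
        _ ≤ _ := by nlinarith
    · have h2 : μ * r ^ 3 ≤ (1 + y) ^ 2 := by
        refine le_of_abs_le (abs_le_of_sq_le_sq ?_ (by positivity))
        have h3 : (μ * r ^ 3) ^ 2 ≤ μ * (μ * r ^ 3) ^ 2 := by
          nlinarith [sq_nonneg (μ * r ^ 3)]
        have h4 : μ * (μ * r ^ 3) ^ 2 = y ^ 3 := by rw [hyd]; ring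
        rw [h4] at h3
        refine h3.trans ?_
        have : 0 ≤ y ^ 4 := by positivity
        nlinarith [sq_nonneg y, pow_pos hy 3]
      calc μ * r ^ 3 * Real.exp p ≤ (1 + y) ^ 2 * 1 := by gcongr
        _ = _ := by ring

set_option maxHeartbeats 1000000 in
/-- comparison between the stationary profiles for parameters `(μ, ε)` and
`(μ, 0)`, viewing them as radially symmetric functions on `ℝ²` (so that
`|∇P_ε(x) − ∇P₀(x)| = |P_ε'(|x|) − P₀'(|x|)|`,
`ΔP(x) = P''(|x|) + P'(|x|)/|x|` for `x ≠ 0`, and `|∇Q_ε(x) − ∇Q₀(x)| = |Q_ε'(|x|) − Q₀'(|x|)|`). -/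
theorem stmt3 :
    ∃ θ ∈ Set.Ioo (0:ℝ) 1, ∃ C₁ > (0:ℝ), ∃ C₂ > (0:ℝ), ∃ C₃ > (0:ℝ), ∃ C₄ > (0:ℝ),
      ∃ ε₀ > (0:ℝ),
        ∀ μ > (0:ℝ), ∀ ε ∈ Set.Ioc (0:ℝ) ε₀, ∀ Pe P0 : ℝ → ℝ,
          IsRadialProfile μ ε Pe → IsRadialProfile μ 0 P0 →
          ∀ x : R2,
            (|Dr Pe ‖x‖ - Dr P0 ‖x‖| ≤ C₁ * Real.sqrt (μ * ε)) ∧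
            (x ≠ 0 →
              |(Dr (Dr Pe) ‖x‖ + Dr Pe ‖x‖ / ‖x‖) -
                  (Dr (Dr P0) ‖x‖ + Dr P0 ‖x‖ / ‖x‖)| ≤ C₂ * μ * ε) ∧
            (|profQ μ Pe ‖x‖ - profQ μ P0 ‖x‖| ≤
              C₃ * μ * ε * Real.exp (-(θ * μ * ‖x‖ ^ 2 / 2))) ∧
            (|Dr (profQ μ Pe) ‖x‖ - Dr (profQ μ P0) ‖x‖| ≤
              C₄ * μ * ε * Real.exp (-(θ * μ * ‖x‖ ^ 2 / 2))) := by
  set K : ℝ := 3 * Real.exp 4 with hK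
  have hK0 : 0 < K := by positivity
  have hK1 : 1 ≤ K := by
    have := Real.add_one_le_exp (4:ℝ)
    linarith
  refine ⟨1 / 2, ⟨by norm_num, by norm_num⟩, 2 * K, by positivity, 256 * K + 4, by positivity,
    256 * K, by positivity, 2048 * K, by positivity, 2 / 5, by norm_num, ?_⟩
  intro μ hμ ε ⟨hε, hε1⟩ Pe P0 he h0 x
  have hκ : 0 < μ * ε := by positivity
  rcases eq_or_ne x 0 with rfl | hx
  · simp only [norm_zero]
    have e1 : Dr (profQ μ Pe) 0 = 0 := by rw [Dr_profQ he le_rfl, he.2.2.1]; simp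
    have e2 : Dr (profQ μ P0) 0 = 0 := by rw [Dr_profQ h0 le_rfl, h0.2.2.1]; simp
    have e3 : profQ μ Pe 0 = profQ μ P0 0 := by unfold profQ; rw [he.2.1, h0.2.1]
    refine ⟨?_, fun h => absurd rfl h, ?_, ?_⟩
    · rw [he.2.2.1, h0.2.2.1]; simp; positivity
    · rw [e3]; simp; positivity
    · rw [e1, e2]; simp; positivity
  have hr : 0 < ‖x‖ := norm_pos_iff.2 hx
  generalize ‖x‖ = r at hr
  obtain ⟨hd, hd'⟩ := diff_bound2 hμ hε hε1 he h0 hr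
  rw [← hK] at hd hd'
  obtain ⟨me, -, hbe⟩ := prof_bounds hμ hε.le hε1 he
  obtain ⟨m0, -, hb0⟩ := prof_bounds hμ le_rfl (by norm_num) h0
  obtain ⟨a1, a2, a3, a4, a5, a6, a7, a8⟩ := hbe r hr
  obtain ⟨b1, b2, b3, b4, b5, b6, b7, b8⟩ := hb0 r hr
  obtain ⟨we1, we2, we3⟩ := weight_bounds hμ hr a7 a6
  obtain ⟨w01, w02, w03⟩ := weight_bounds hμ hr b7 b6
  have hpe := poly_exp (show 0 ≤ μ * r ^ 2 by positivity)
  have eθ : -(1 / 2 * μ * r ^ 2 / 2) = -(μ * r ^ 2 / 4) := by ring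
  rw [eθ]
  set X := Real.exp (-(μ * r ^ 2 / 4)) with hX
  have hX0 : 0 < X := Real.exp_pos _
  have hX1 : X ≤ 1 := by
    rw [hX, Real.exp_le_one_iff]
    have : 0 < μ * r ^ 2 / 4 := by positivity
    linarith
  set Y := Real.exp (-(μ * r ^ 2 / 2)) with hY
  have hY0 : 0 < Y := Real.exp_pos _
  have eQ : ∀ P : ℝ → ℝ, profQ μ P r = 8 * Y * Real.exp (P r) := by
    intro P
    unfold profQ
    rw [hY, mul_assoc, ← Real.exp_add]
    ring_nf
  set Z := (1 + μ * r ^ 2) ^ 2 with hZ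
  have hQd := profQ_diff μ Pe P0 r
  have hQd2 : |profQ μ Pe r - profQ μ P0 r| ≤
      8 * Y * K * (μ * ε) * (r ^ 2 * (Real.exp (Pe r) + Real.exp (P0 r))) := by
    refine hQd.trans ?_
    rw [eQ, eQ]
    calc (8 * Y * Real.exp (Pe r) + 8 * Y * Real.exp (P0 r)) * |Pe r - P0 r|
        ≤ (8 * Y * Real.exp (Pe r) + 8 * Y * Real.exp (P0 r)) * (K * (μ * ε) * r ^ 2) := by
          gcongr
      _ = _ := by ring
  have hc0 : 0 < 8 * Y * K * (μ * ε) := by positivity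
  have hcZ : 8 * Y * K * (μ * ε) * Z ≤ 256 * K * (μ * ε) * X := by
    calc 8 * Y * K * (μ * ε) * Z = 8 * K * (μ * ε) * (Y * Z) := by ring
      _ ≤ 8 * K * (μ * ε) * (32 * X) := by gcongr
      _ = _ := by ring
  have h3 : |profQ μ Pe r - profQ μ P0 r| ≤ 256 * K * (μ * ε) * X := by
    refine (hQd2.trans ?_).trans hcZ
    apply mul_le_mul_of_nonneg_left _ hc0.le
    linarith
  have h3μ : μ * r * |profQ μ Pe r - profQ μ P0 r| ≤ 512 * K * (μ * ε) * X := by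
    calc μ * r * |profQ μ Pe r - profQ μ P0 r| ≤ μ * r *
          (8 * Y * K * (μ * ε) * (r ^ 2 * (Real.exp (Pe r) + Real.exp (P0 r)))) := by gcongr
      _ = 8 * Y * K * (μ * ε) * (μ * r ^ 3 * Real.exp (Pe r) + μ * r ^ 3 * Real.exp (P0 r)) := by
          ring
      _ ≤ 8 * Y * K * (μ * ε) * (Z + Z) := by gcongr
      _ ≤ _ := by linarith
  have h4 : profQ μ P0 r * |Dr Pe r - Dr P0 r| ≤ 512 * K * (μ * ε) * X := by
    rw [eQ]
    calc 8 * Y * Real.exp (P0 r) * |Dr Pe r - Dr P0 r|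
        ≤ 8 * Y * Real.exp (P0 r) * (K * (μ * ε) * r) := by gcongr
      _ = 8 * Y * K * (μ * ε) * (r * Real.exp (P0 r)) := by ring
      _ ≤ 8 * Y * K * (μ * ε) * (2 * Z) := by gcongr
      _ ≤ _ := by linarith
  have hDe : |Dr Pe r| ≤ 4 := by
    have k1 : |r * Dr Pe r| ≤ 4 := by rw [abs_le]; constructor <;> linarith
    have k2 : |r * Dr Pe r| ≤ 4 * r ^ 2 := by
      have : 0 ≤ r ^ 2 := by positivity
      rw [abs_le]; constructor <;> linarith
    rw [abs_mul, abs_of_pos hr] at k1 k2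
    by_contra hcon
    push Not at hcon
    have k3 := mul_lt_mul_of_pos_left hcon hr
    have k4 : r < 1 := by linarith
    have k5 : r ^ 2 < r := by
      rw [sq]; exact mul_lt_of_lt_one_left hr k4
    linarith
  refine ⟨?_, ?_, ?_, ?_⟩
  · have k1 : r * |Dr Pe r - Dr P0 r| ≤ 4 := by
      rw [← abs_of_pos hr, ← abs_mul, abs_of_pos hr, mul_sub, abs_le]
      constructor <;> linarith
    apply abs_le_of_sq_le_sq _ (by positivity)
    rw [mul_pow, Real.sq_sqrt hκ.le, ← sq_abs]
    have k2 : |Dr Pe r - Dr P0 r| ^ 2 ≤ K * (μ * ε) * (r * |Dr Pe r - Dr P0 r|) := by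
      have := mul_le_mul_of_nonneg_right hd' (abs_nonneg (Dr Pe r - Dr P0 r))
      rw [sq]
      linarith
    have k3 : K * (μ * ε) * (r * |Dr Pe r - Dr P0 r|) ≤ K * (μ * ε) * 4 := by gcongr
    have k4 : K * (μ * ε) * 4 ≤ (2 * K) ^ 2 * (μ * ε) := by
      have : 0 ≤ K * (μ * ε) * (K - 1) := by
        have := sub_nonneg.2 hK1
        positivity
      have : (2 * K) ^ 2 * (μ * ε) = K * (μ * ε) * 4 + 4 * (K * (μ * ε) * (K - 1)) := by ring
      linarith
    linarith
  · intro _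
    have e1 : Dr (Dr Pe) r + Dr Pe r / r = -profQ μ Pe r + μ * ε * -(r * Dr Pe r) := by
      have := he.2.2.2 r hr
      unfold profQ
      have e : Dr Pe r / r = 1 / r * Dr Pe r := by ring
      linarith
    have e2 : Dr (Dr P0) r + Dr P0 r / r = -profQ μ P0 r := by
      have := h0.2.2.2 r hr
      unfold profQ
      have e : Dr P0 r / r = 1 / r * Dr P0 r := by ring
      linarith
    rw [e1, e2]
    have k1 : 256 * K * (μ * ε) * X ≤ 256 * K * (μ * ε) * 1 := by gcongr
    have k2 := abs_le.1 (h3.trans k1)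
    have k3 : 0 ≤ μ * ε * -(r * Dr Pe r) := by positivity
    have k4 : μ * ε * -(r * Dr Pe r) ≤ μ * ε * 4 := by gcongr; linarith
    have e3 : (256 * K + 4) * μ * ε = 256 * K * (μ * ε) + 4 * (μ * ε) := by ring
    rw [e3, abs_le]
    constructor <;> linarith [k2.1, k2.2]
  · calc _ ≤ _ := h3
      _ = _ := by ring
  · rw [Dr_profQ he hr.le, Dr_profQ h0 hr.le]
    have e1 : profQ μ Pe r * (Dr Pe r - μ * r) - profQ μ P0 r * (Dr P0 r - μ * r) =
        (profQ μ Pe r - profQ μ P0 r) * Dr Pe r - μ * r * (profQ μ Pe r - profQ μ P0 r)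
          + profQ μ P0 r * (Dr Pe r - Dr P0 r) := by ring
    have hQ0 : 0 < profQ μ P0 r := by unfold profQ; positivity
    have hμr : 0 < μ * r := by positivity
    have k1 : |(profQ μ Pe r - profQ μ P0 r) * Dr Pe r| ≤ 256 * K * (μ * ε) * X * 4 := by
      rw [abs_mul]; gcongr
    have k2 : |μ * r * (profQ μ Pe r - profQ μ P0 r)| ≤ 512 * K * (μ * ε) * X := by
      rw [abs_mul, abs_of_pos hμr]; exact h3μ
    have k3 : |profQ μ P0 r * (Dr Pe r - Dr P0 r)| ≤ 512 * K * (μ * ε) * X := by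
      rw [abs_mul, abs_of_pos hQ0]; exact h4
    rw [e1]
    have k4 := abs_add_le ((profQ μ Pe r - profQ μ P0 r) * Dr Pe r
      - μ * r * (profQ μ Pe r - profQ μ P0 r)) (profQ μ P0 r * (Dr Pe r - Dr P0 r))
    have k5 := abs_sub ((profQ μ Pe r - profQ μ P0 r) * Dr Pe r)
      (μ * r * (profQ μ Pe r - profQ μ P0 r))
    have e2 : 2048 * K * μ * ε * X = 2048 * K * (μ * ε) * X := by ring
    rw [e2]
    linarith


end
end

section
/- Let ε > 0, μ > 0, and let Q : ℝ² → [0,∞) be continuous with 0 ≤ Q(x) ≤ C e^{−a|x|²} for some constants C, a > 0. Then for every Schwartz function w on ℝ², ∫_{ℝ²} ∇[ (1/ε) Δw + μ x·∇w + ∇κ*[Q ∇w] ] · ∇w dx = −(1/ε) ∫_{ℝ²} |∇²w|² dx − ∫_{ℝ²} Q |∇w|² dx, where |∇²w|² = Σ_{i,j} (∂_i∂_j w)². (Equivalently: the operator L w := (1/ε)Δw + μ x·∇w + ∇κ*[Q∇w] satisfies ⟨L w, w⟩_{Ḣ¹} = −(1/ε)‖w‖²_{Ḣ²} − (2π)²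 ‖Q^{1/2} ∇w‖²_{L²} in the homogeneous Ḣ¹ pairing.) -/
open MeasureTheory Real Set
open scoped InnerProductSpace

noncomputable section

/-- `∇κ(z) = −(1/(2π)) z/|z|²`, the gradient of the Laplace kernel in the plane. -/
def gradKappa (z : R2) : R2 := (-(1 / (2 * π)) * (‖z‖ ^ 2)⁻¹) • z

/-- The (vector valued) convolution `(∇κ⋆g)(x)`. -/
def gradKappaConv (g : R2 → ℝ) (x : R2) : R2 := ∫ y, g y • gradKappa (x - y)

/-- The scalar function `∇κ⋆F = Σ_j ∂_jκ ⋆ F_j` for a vector field `F`. -/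
def gradKappaConvVec (F : R2 → R2) (x : R2) : ℝ := ∫ y, ⟪gradKappa (x - y), F y⟫_ℝ

/-- Fourier transform with the convention `𝓕f(ξ) = ∫ f(x) e^{−i x·ξ} dx`. -/
def FT (f : R2 → ℂ) (ξ : R2) : ℂ := ∫ x, f x * Complex.exp (-Complex.I * ((⟪x, ξ⟫_ℝ : ℝ) : ℂ))

def FTr (f : R2 → ℝ) : R2 → ℂ := FT fun x => (f x : ℂ)

/-- Homogeneous Sobolev seminorm `‖f‖_{Ḣ^σ} = ‖ |ξ|^σ 𝓕f ‖_{L²}`. -/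
def sobNorm (σ : ℝ) (f : R2 → ℝ) : ℝ :=
  (∫ ξ : R2, ‖ξ‖ ^ (2 * σ) * ‖FTr f ξ‖ ^ 2) ^ (1/2 : ℝ)

def L2Norm (f : R2 → ℝ) : ℝ := (∫ x : R2, f x ^ 2) ^ (1/2 : ℝ)

def L1Norm (f : R2 → ℝ) : ℝ := ∫ x : R2, |f x|

/-- Weighted norm `‖f‖_{L²_k} = ‖⟨x⟩^k f‖_{L²}`. -/
def L2kNorm (k : ℝ) (f : R2 → ℝ) : ℝ := (∫ x : R2, jap x ^ (2 * k) * f x ^ 2) ^ (1/2 : ℝ)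

def gradL2kNorm (k : ℝ) (f : R2 → ℝ) : ℝ :=
  (∫ x : R2, jap x ^ (2 * k) * ‖gradient f x‖ ^ 2) ^ (1/2 : ℝ)

def H1kNorm (k : ℝ) (f : R2 → ℝ) : ℝ := (L2kNorm k f ^ 2 + gradL2kNorm k f ^ 2) ^ (1/2 : ℝ)

def gradL2Norm (f : R2 → ℝ) : ℝ := (∫ x : R2, ‖gradient f x‖ ^ 2) ^ (1/2 : ℝ)

/-- Weighted pairing `⟨f,g⟩_{L²_k} = ∫ f g ⟨x⟩^{2k}`. -/
def L2kInner (k : ℝ) (f g : R2 → ℝ) : ℝ := ∫ x : R2, f x * g x * jap x ^ (2 * k)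

/-- Dual norm `‖φ‖_{H^{-1}_k} = sup { ⟨φ,f⟩_{L²_k} : ‖f‖_{H¹_k} ≤ 1 }`. -/
def Hm1kNorm (k : ℝ) (φ : R2 → ℝ) : ℝ :=
  sSup {r | ∃ f : R2 → ℝ, H1kNorm k f ≤ 1 ∧ r = L2kInner k φ f}

def basis2 (i : Fin 2) : R2 := EuclideanSpace.single i 1

/-- Partial derivative in the `i`-th coordinate direction. -/
def pd (i : Fin 2) (f : R2 → ℝ) (x : R2) : ℝ := fderiv ℝ f x (basis2 i)

/-- Laplacian. -/
def lap (f : R2 → ℝ) (x : R2) : ℝ := ∑ i, pd i (pd i f) x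

/-- Divergence of a vector field. -/
def divg (F : R2 → R2) (x : R2) : ℝ := ∑ i, pd i (fun y => F y i) x

/-- `|∇²f|² = Σ_{i,j} (∂_i∂_j f)²`. -/
def hessSq (f : R2 → ℝ) (x : R2) : ℝ := ∑ i, ∑ j, pd i (pd j f) x ^ 2

/-- The operator `L w = (1/ε)Δw + μ x·∇w + ∇κ⋆[Q∇w]`. -/
def L22Op (μ ε : ℝ) (Q : R2 → ℝ) (w : R2 → ℝ) (x : R2) : ℝ :=
  (1 / ε) * lap w x + μ * ⟪x, gradient w x⟫_ℝ
    + gradKappaConvVec (fun y => Q y • gradient w y) x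

def gH (s : ℝ) : ℝ := if s ≤ 1 then 2 * s - s ^ 2 / 2 - 3 / 2 else Real.log s
def g0 (s : ℝ) : ℝ := if s ≤ 1 then 2 - s else s⁻¹
def g1 (s : ℝ) : ℝ := if s ≤ 1 then -1 else -(s ^ 2)⁻¹

lemma hasDerivAt_ite_one {f₁ f₂ : ℝ → ℝ} {d₁ d₂ : ℝ → ℝ}
    (h1 : ∀ s ≤ 1, HasDerivAt f₁ (d₁ s) s) (h2 : ∀ s, 1 ≤ s → HasDerivAt f₂ (d₂ s) s)
    (hf : f₁ 1 = f₂ 1) (hd : d₁ 1 = d₂ 1) (s : ℝ) :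
    HasDerivAt (fun s => if s ≤ 1 then f₁ s else f₂ s) (if s ≤ 1 then d₁ s else d₂ s) s := by
  rcases lt_trichotomy s 1 with h | h | h
  · rw [if_pos h.le]
    refine (h1 s h.le).congr_of_eventuallyEq ?_
    filter_upwards [Iio_mem_nhds h] with t ht
    rw [if_pos (le_of_lt ht)]
  · subst h
    simp only [le_refl, if_true]
    rw [← hasDerivWithinAt_univ, ← Iic_union_Ici (a := (1 : ℝ))]
    refine HasDerivWithinAt.union ?_ ?_
    · refine (h1 1 le_rfl).hasDerivWithinAt.congr ?_ ?_
      · intro t ht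
        rw [if_pos (mem_Iic.1 ht)]
      · simp
    · rw [hd]
      refine (h2 1 le_rfl).hasDerivWithinAt.congr ?_ ?_
      · intro t ht
        by_cases h : t ≤ 1
        · have : t = 1 := le_antisymm h ht
          subst this
          simp [hf]
        · rw [if_neg h]
      · simp [hf]
  · rw [if_neg (not_le.2 h)]
    refine (h2 s h.le).congr_of_eventuallyEq ?_
    filter_upwards [Ioi_mem_nhds h] with t ht
    rw [if_neg (not_le.2 ht)]

lemma hasDerivAt_gH (s : ℝ) : HasDerivAt gH (g0 s) s := by
  refine hasDerivAt_ite_one (f₁ := fun s => 2 * s - s ^ 2 / 2 - 3 / 2) (f₂ := Real.log)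
    (d₁ := fun s => 2 - s) (d₂ := fun s => s⁻¹) ?_ ?_ ?_ ?_ s
  · intro s _
    have := (((hasDerivAt_id s).const_mul 2).sub (((hasDerivAt_id s).pow 2).div_const 2)).sub_const
      (3 / 2 : ℝ)
    refine this.congr_deriv ?_
    simp
  · intro s hs
    exact Real.hasDerivAt_log (by positivity)
  · norm_num
  · norm_num

lemma hasDerivAt_g0 (s : ℝ) : HasDerivAt g0 (g1 s) s := by
  refine hasDerivAt_ite_one (f₁ := fun s => 2 - s) (f₂ := fun s => s⁻¹)
    (d₁ := fun s => -1) (d₂ := fun s => -(s ^ 2)⁻¹) ?_ ?_ ?_ ?_ s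
  · intro s _
    exact (hasDerivAt_id s).const_sub 2
  · intro s hs
    exact hasDerivAt_inv (by positivity)
  · norm_num
  · norm_num

lemma g0_bound (r : ℝ) (hr : 0 ≤ r) : |g0 (r ^ 2)| ≤ 8 * ((1 + r)⁻¹) ^ 2 := by
  unfold g0
  rw [inv_pow, ← div_eq_mul_inv, le_div_iff₀ (by positivity)]
  split_ifs with h
  · have : r ≤ 1 := by nlinarith
    rw [abs_of_nonneg (by linarith)]
    nlinarith [mul_nonneg hr hr, mul_nonneg (mul_nonneg hr hr) hr]
  · have : 1 < r := by
      by_contra h'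
      push Not at h' h
      nlinarith
    rw [abs_of_nonneg (by positivity), inv_mul_le_iff₀ (by positivity)]
    nlinarith

lemma g1_bound (r : ℝ) (hr : 0 ≤ r) : |g1 (r ^ 2)| * r ^ 2 ≤ 4 * ((1 + r)⁻¹) ^ 2 := by
  unfold g1
  rw [inv_pow, ← div_eq_mul_inv, le_div_iff₀ (by positivity)]
  split_ifs with h
  · have : r ≤ 1 := by nlinarith
    rw [abs_neg, abs_one]
    nlinarith [mul_nonneg hr hr, mul_nonneg (mul_nonneg hr hr) hr]
  · have : 1 < r := by
      by_contra h'
      push Not at h' h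
      nlinarith
    rw [abs_neg, abs_of_nonneg (by positivity)]
    have e : ((r ^ 2) ^ 2)⁻¹ * r ^ 2 * (1 + r) ^ 2 = ((r ^ 2))⁻¹ * (1 + r) ^ 2 := by
      field_simp
    rw [e, inv_mul_le_iff₀ (by positivity)]
    nlinarith

def cK : ℝ := -(1 / (4 * π))
/-- Regularised potential. -/
def k1 (z : R2) : ℝ := cK * gH (‖z‖ ^ 2)
def K1 (z : R2) : R2 := (2 * cK * g0 (‖z‖ ^ 2)) • z
def phi1 (z : R2) : ℝ := (1 / π) * (g0 (‖z‖ ^ 2) + ‖z‖ ^ 2 * g1 (‖z‖ ^ 2))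

lemma hasGradientAt_k1 (z : R2) : HasGradientAt k1 (K1 z) z := by
  rw [hasGradientAt_iff_hasFDerivAt]
  have h := ((hasDerivAt_gH (‖z‖ ^ 2)).comp_hasFDerivAt z
    (hasStrictFDerivAt_norm_sq z).hasFDerivAt).const_mul cK
  refine HasFDerivAt.congr_fderiv h ?_
  ext v
  simp [K1, inner_smul_left]
  ring

lemma hasFDerivAt_K1 (z : R2) : HasFDerivAt K1
    ((2 * cK * g0 (‖z‖ ^ 2)) • ContinuousLinearMap.id ℝ R2 +
      ((4 * cK * g1 (‖z‖ ^ 2)) • innerSL ℝ z).smulRight z) z := by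
  have h := (((hasDerivAt_g0 (‖z‖ ^ 2)).comp_hasFDerivAt z
    (hasStrictFDerivAt_norm_sq z).hasFDerivAt).const_mul (2 * cK)).smul (hasFDerivAt_id z)
  refine HasFDerivAt.congr_fderiv h ?_
  ext v
  simp
  left
  ring

lemma K1_bound (z : R2) : ‖K1 z‖ ≤ 16 * |cK| * (1 + ‖z‖)⁻¹ := by
  unfold K1
  rw [norm_smul, norm_mul, norm_mul, Real.norm_eq_abs, Real.norm_eq_abs, Real.norm_eq_abs]
  have h := g0_bound ‖z‖ (norm_nonneg z)
  have h2 : ‖z‖ * (1 + ‖z‖)⁻¹ ≤ 1 := by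
    rw [← div_eq_mul_inv, div_le_one (by positivity)]
    linarith
  have h3 : 0 < (1 + ‖z‖)⁻¹ := by positivity
  rw [abs_of_pos (by norm_num : (0:ℝ) < 2)]
  calc 2 * |cK| * |g0 (‖z‖ ^ 2)| * ‖z‖ ≤ 2 * |cK| * (8 * ((1 + ‖z‖)⁻¹) ^ 2) * ‖z‖ := by gcongr
    _ = 16 * |cK| * (1 + ‖z‖)⁻¹ * (‖z‖ * (1 + ‖z‖)⁻¹) := by ring
    _ ≤ 16 * |cK| * (1 + ‖z‖)⁻¹ * 1 := by gcongr
    _ = _ := by ring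

lemma fderiv_K1_bound (z : R2) : ‖fderiv ℝ K1 z‖ ≤ 32 * |cK| * ((1 + ‖z‖)⁻¹) ^ 2 := by
  rw [(hasFDerivAt_K1 z).fderiv]
  refine (norm_add_le _ _).trans ?_
  rw [norm_smul, ContinuousLinearMap.norm_smulRight_apply, norm_smul, innerSL_apply_norm]
  simp only [norm_mul, Real.norm_eq_abs]
  have h := g0_bound ‖z‖ (norm_nonneg z)
  have h1 := g1_bound ‖z‖ (norm_nonneg z)
  have h2 : ‖ContinuousLinearMap.id ℝ R2‖ ≤ 1 := ContinuousLinearMap.norm_id_le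
  rw [abs_of_pos (by norm_num : (0:ℝ) < 2), abs_of_pos (by norm_num : (0:ℝ) < 4)]
  calc 2 * |cK| * |g0 (‖z‖ ^ 2)| * ‖ContinuousLinearMap.id ℝ R2‖ + 4 * |cK| * |g1 (‖z‖ ^ 2)| * ‖z‖ * ‖z‖
      ≤ 2 * |cK| * (8 * ((1 + ‖z‖)⁻¹) ^ 2) * 1 + 4 * |cK| * (|g1 (‖z‖ ^ 2)| * ‖z‖ ^ 2) := by
        gcongr ?_ + ?_
        · gcongr
        · exact le_of_eq (by ring)
    _ ≤ 2 * |cK| * (8 * ((1 + ‖z‖)⁻¹) ^ 2) * 1 + 4 * |cK| * (4 * ((1 + ‖z‖)⁻¹) ^ 2) := by gcongr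
    _ = _ := by ring

lemma div_K1 (z : R2) : ∑ i, (fderiv ℝ K1 z (basis2 i)) i = - phi1 z := by
  rw [(hasFDerivAt_K1 z).fderiv]
  simp [basis2, phi1, cK, EuclideanSpace.norm_sq_eq, Fin.sum_univ_two,
    EuclideanSpace.inner_single_right]
  field_simp
  ring

lemma phi1_eq_zero (z : R2) (hz : 1 ≤ ‖z‖) : phi1 z = 0 := by
  unfold phi1 g0 g1
  have : 1 ≤ ‖z‖ ^ 2 := by nlinarith
  split_ifs with h
  · have : ‖z‖ ^ 2 = 1 := le_antisymm h this
    rw [this]; norm_num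
  · field_simp
    ring

lemma phi1_bound (z : R2) : |phi1 z| ≤ 1 := by
  by_cases hz : 1 ≤ ‖z‖
  · simp [phi1_eq_zero z hz]
  · push Not at hz
    unfold phi1 g0 g1
    have h0 := norm_nonneg z
    have : ‖z‖ ^ 2 ≤ 1 := by nlinarith
    rw [if_pos this, if_pos this, abs_of_nonneg, one_div, inv_mul_le_iff₀ pi_pos]
    · nlinarith [pi_gt_three]
    · have : 0 ≤ 2 - ‖z‖ ^ 2 + ‖z‖ ^ 2 * -1 := by linarith
      positivity

lemma continuous_phi1 : Continuous phi1 := by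
  have h : phi1 = fun z => (1 / π) * (2 * max 0 (1 - ‖z‖ ^ 2)) := by
    funext z
    by_cases hz : 1 ≤ ‖z‖
    · rw [phi1_eq_zero z hz, max_eq_left (by nlinarith)]; simp
    · push Not at hz
      unfold phi1 g0 g1
      have h0 := norm_nonneg z
      have : ‖z‖ ^ 2 ≤ 1 := by nlinarith
      rw [if_pos this, if_pos this, max_eq_right (by linarith)]
      ring
  rw [h]
  fun_prop

lemma integrable_phi1 : Integrable phi1 := by
  apply continuous_phi1.integrable_of_hasCompactSupport
  refine HasCompactSupport.intro (isCompact_closedBall (0 : R2) 1) ?_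
  intro z hz
  simp at hz
  exact phi1_eq_zero z hz.le

lemma integral_phi1 : ∫ z, phi1 z = 1 := by
  have h := integral_fun_norm_addHaar (volume : Measure R2)
    (fun r : ℝ => (1 / π) * (g0 (r ^ 2) + r ^ 2 * g1 (r ^ 2)))
  have e : (fun z : R2 => phi1 z) = fun z : R2 =>
    (fun r : ℝ => (1 / π) * (g0 (r ^ 2) + r ^ 2 * g1 (r ^ 2))) ‖z‖ := rfl
  rw [e, h]
  have hv : (volume : Measure R2).real (Metric.ball 0 1) = π := by
    rw [measureReal_def, EuclideanSpace.volume_ball_fin_two]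
    simp [pi_pos.le]
  rw [hv]
  simp only [finrank_euclideanSpace, Fintype.card_fin, smul_eq_mul]
  have hI : ∫ y in Ioi (0:ℝ), y ^ (2 - 1) * (1 / π * (g0 (y ^ 2) + y ^ 2 * g1 (y ^ 2))) =
      ∫ y in (0:ℝ)..1, (1 / π) * (2 * y - 2 * y ^ 3) := by
    rw [intervalIntegral.integral_of_le zero_le_one]
    rw [← Ioc_union_Ioi_eq_Ioi (zero_le_one (α := ℝ))]
    refine (setIntegral_eq_of_subset_of_forall_sdiff_eq_zero (s := Ioc 0 1) ?_ ?_ ?_).trans ?_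
    · measurability
    · exact subset_union_left
    · rintro y ⟨hy, hy2⟩
      have : 1 < y := by
        rcases hy with hy | hy
        · exact absurd hy hy2
        · exact hy
      have h1 : ¬ (y ^ 2 ≤ 1) := by nlinarith
      simp only [g0, g1, if_neg h1]
      field_simp
      simp
    · refine setIntegral_congr_fun measurableSet_Ioc ?_
      intro y hy
      have h1 : (y ^ 2 ≤ 1) := by nlinarith [hy.1, hy.2]
      simp only [g0, g1, if_pos h1]
      ring
  rw [hI, intervalIntegral.integral_const_mul, intervalIntegral.integral_sub
    (by apply Continuous.intervalIntegrable; fun_prop)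
    (by apply Continuous.intervalIntegrable; fun_prop),
    intervalIntegral.integral_const_mul, intervalIntegral.integral_const_mul]
  simp
  field_simp
  norm_num

lemma K1_eq (z : R2) (hz : 1 ≤ ‖z‖) : K1 z = gradKappa z := by
  have : 1 ≤ ‖z‖ ^ 2 := by nlinarith
  have e : g0 (‖z‖ ^ 2) = (‖z‖ ^ 2)⁻¹ := by
    unfold g0
    split_ifs with h
    · have : ‖z‖ ^ 2 = 1 := le_antisymm h this
      rw [this]; norm_num
    · rfl
  unfold K1 gradKappa cK
  rw [e]
  congr 1
  field_simp
  norm_num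

lemma differentiable_K1 : Differentiable ℝ K1 := fun z => (hasFDerivAt_K1 z).differentiableAt
lemma continuous_K1 : Continuous K1 := differentiable_K1.continuous

lemma measurable_gradKappa : Measurable gradKappa := by
  unfold gradKappa
  fun_prop

def N1 (z : R2) : R2 := gradKappa z - K1 z

lemma N1_eq_zero (z : R2) (hz : 1 ≤ ‖z‖) : N1 z = 0 := by
  rw [N1, K1_eq z hz, sub_self]

lemma gradKappa_norm_le (z : R2) : ‖gradKappa z‖ ≤ ‖z‖⁻¹ := by
  unfold gradKappa
  rw [norm_smul, norm_mul, norm_neg]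
  rcases eq_or_ne z 0 with h | h
  · simp [h]
  have hz : 0 < ‖z‖ := norm_pos_iff.2 h
  have : ‖(1 / (2 * π))‖ ≤ 1 := by
    rw [Real.norm_of_nonneg (by positivity), div_le_one (by positivity)]
    nlinarith [pi_gt_three]
  rw [Real.norm_of_nonneg (by positivity : 0 ≤ (‖z‖ ^ 2)⁻¹)]
  calc _ ≤ 1 * (‖z‖ ^ 2)⁻¹ * ‖z‖ := by gcongr
    _ = ‖z‖⁻¹ := by field_simp

lemma integrableOn_inv_norm : IntegrableOn (fun z : R2 => ‖z‖⁻¹) (Metric.ball 0 1) := by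
  have h := integrableOn_fun_norm_addHaar (E := R2) (volume : Measure R2)
    (f := fun r : ℝ => r⁻¹) (r := 1)
  rw [h]
  have : IntegrableOn (fun _ : ℝ => (1:ℝ)) (Ioo 0 1) := by
    refine integrableOn_const ?_
    simp
  refine this.congr_fun ?_ measurableSet_Ioo
  intro y hy
  have := hy.1.ne'
  simp [this]

lemma integrable_N1 : Integrable N1 := by
  have hm : Measurable N1 := measurable_gradKappa.sub continuous_K1.measurable
  have h1 : IntegrableOn N1 (Metric.ball 0 1) := by
    have h2 : IntegrableOn (fun z : R2 => ‖z‖⁻¹ + 16 * |cK|) (Metric.ball 0 1) := by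
      refine integrableOn_inv_norm.add (integrableOn_const ?_)
      exact measure_ball_lt_top.ne
    refine Integrable.mono' h2 hm.aestronglyMeasurable ?_
    refine Filter.Eventually.of_forall fun z => ?_
    refine (norm_sub_le _ _).trans (add_le_add (gradKappa_norm_le z) ((K1_bound z).trans ?_))
    have : (1 + ‖z‖)⁻¹ ≤ 1 := inv_le_one_of_one_le₀ (by linarith [norm_nonneg z])
    have h3 : 0 ≤ 16 * |cK| := by positivity
    nlinarith
  rwa [integrableOn_iff_integrable_of_support_subset] at h1
  intro z hz
  by_contra h
  simp at h
  exact hz (N1_eq_zero z h)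

lemma N1_neg (z : R2) : N1 (-z) = - N1 z := by
  simp [N1, gradKappa, K1]
  abel

def Kd (δ : ℝ) (z : R2) : R2 := δ⁻¹ • K1 (δ⁻¹ • z)
def Nd (δ : ℝ) (z : R2) : R2 := δ⁻¹ • N1 (δ⁻¹ • z)

lemma gradKappa_eq (δ : ℝ) (hδ : 0 < δ) (z : R2) : gradKappa z = Kd δ z + Nd δ z := by
  have : Kd δ z + Nd δ z = δ⁻¹ • gradKappa (δ⁻¹ • z) := by
    rw [Kd, Nd, ← smul_add, N1]
    simp
  rw [this]
  unfold gradKappa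
  rw [smul_smul, smul_smul, norm_smul, norm_inv, Real.norm_of_nonneg hδ.le]
  congr 1
  rcases eq_or_ne z 0 with h | h
  · simp [h]
  have hz : 0 < ‖z‖ := norm_pos_iff.2 h
  field_simp

lemma Nd_eq_zero (δ : ℝ) (hδ : 0 < δ) (z : R2) (hz : δ ≤ ‖z‖) : Nd δ z = 0 := by
  rw [Nd, N1_eq_zero, smul_zero]
  rw [norm_smul, norm_inv, Real.norm_of_nonneg hδ.le, inv_mul_eq_div, one_le_div hδ]
  exact hz

lemma integrable_Nd (δ : ℝ) (hδ : 0 < δ) : Integrable (Nd δ) :=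
  ((integrable_comp_smul_iff volume N1 (inv_ne_zero hδ.ne')).2 integrable_N1).smul δ⁻¹

lemma integral_norm_Nd (δ : ℝ) (hδ : 0 < δ) : ∫ z, ‖Nd δ z‖ = δ * ∫ z, ‖N1 z‖ := by
  simp only [Nd, norm_smul]
  rw [integral_const_mul, Measure.integral_comp_smul volume (fun z => ‖N1 z‖)]
  simp only [finrank_euclideanSpace, Fintype.card_fin, smul_eq_mul]
  rw [norm_inv, Real.norm_of_nonneg hδ.le, abs_of_pos (by positivity)]
  field_simp

lemma integral_Nd (δ : ℝ) : ∫ z, Nd δ z = 0 := by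
  have h : ∫ z, Nd δ z = ∫ z, Nd δ (-z) := (integral_neg_eq_self (Nd δ) volume).symm
  have h2 : ∀ z, Nd δ (-z) = - Nd δ z := by
    intro z
    simp [Nd, N1_neg]
  simp only [h2, integral_neg] at h
  have h3 : (2 : ℝ) • ∫ z, Nd δ z = 0 := by
    rw [two_smul]
    nth_rewrite 1 [h]
    simp
  exact (smul_eq_zero.1 h3).resolve_left two_ne_zero

lemma integrable_inner_Kd (δ : ℝ) {F : R2 → R2} (hFi : Integrable F) (x : R2) :
    Integrable (fun y => ⟪Kd δ (x - y), F y⟫_ℝ) := by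
  have hK : Continuous (Kd δ) := by
    unfold Kd
    have := continuous_K1
    fun_prop
  refine Integrable.mono' (hFi.norm.const_mul (‖δ⁻¹‖ * (16 * |cK|))) ?_ ?_
  · exact ((hK.comp (continuous_const.sub continuous_id)).aestronglyMeasurable).inner
      hFi.aestronglyMeasurable
  · refine Filter.Eventually.of_forall fun y => (norm_inner_le_norm _ _).trans ?_
    gcongr
    rw [Kd, norm_smul]
    gcongr
    refine (K1_bound _).trans ?_
    set z := (δ⁻¹ • (x - y))
    have : (1 + ‖z‖)⁻¹ ≤ 1 := inv_le_one_of_one_le₀ (by linarith [norm_nonneg z])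
    have h3 : 0 ≤ 16 * |cK| := by positivity
    nlinarith

lemma near_est {F : R2 → R2} (hFi : Integrable F) {M : ℝ}
    (hFb : ∀ y, ‖F y‖ ≤ M) (x' : R2) (δ : ℝ) (hδ : 0 < δ) (F0 : R2) (η : ℝ)
    (h : ∀ y, ‖y - x'‖ ≤ δ → ‖F y - F0‖ ≤ η) :
    |gradKappaConvVec F x' - ∫ y, ⟪Kd δ (x' - y), F y⟫_ℝ| ≤ δ * (∫ z, ‖N1 z‖) * η := by
  have hN : Integrable (fun y => Nd δ (x' - y)) := (integrable_Nd δ hδ).comp_sub_left x'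
  have hNF : Integrable (fun y => ⟪Nd δ (x' - y), F y⟫_ℝ) := by
    refine Integrable.mono' (hN.norm.mul_const M) ?_ ?_
    · exact hN.aestronglyMeasurable.inner hFi.aestronglyMeasurable
    · refine Filter.Eventually.of_forall fun y => (norm_inner_le_norm _ _).trans ?_
      gcongr
      exact hFb y
  have hNc : Integrable (fun y => ⟪Nd δ (x' - y), F0⟫_ℝ) := hN.inner_const F0
  have hz : ∫ y, ⟪Nd δ (x' - y), F0⟫_ℝ = 0 := by
    have e : ∀ y, ⟪Nd δ (x' - y), F0⟫_ℝ = ⟪F0, Nd δ (x' - y)⟫_ℝ := fun y => real_inner_comm _ _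
    simp only [e]
    rw [integral_inner hN, integral_sub_left_eq_self (Nd δ) volume x', integral_Nd, inner_zero_right]
  have e1 : gradKappaConvVec F x' - ∫ y, ⟪Kd δ (x' - y), F y⟫_ℝ =
      ∫ y, ⟪Nd δ (x' - y), F y - F0⟫_ℝ := by
    simp only [inner_sub_right]
    rw [integral_sub hNF hNc, hz, sub_zero, gradKappaConvVec]
    simp only [gradKappa_eq δ hδ, inner_add_left]
    rw [integral_add (integrable_inner_Kd δ hFi x') hNF]
    ring
  rw [e1, ← Real.norm_eq_abs]
  have e2 : ∫ y, ‖Nd δ (x' - y)‖ * η = δ * (∫ z, ‖N1 z‖) * η := by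
    rw [integral_mul_const, integral_sub_left_eq_self (fun z => ‖Nd δ z‖) volume x',
      integral_norm_Nd δ hδ]
  rw [← e2]
  refine norm_integral_le_of_norm_le (hN.norm.mul_const η) ?_
  refine Filter.Eventually.of_forall fun y => (norm_inner_le_norm _ _).trans ?_
  by_cases hy : δ ≤ ‖x' - y‖
  · simp [Nd_eq_zero δ hδ _ hy]
  · gcongr
    apply h
    rw [norm_sub_rev]
    linarith

/-- Projection lemma. -/
lemma exists_projection {ι : Type*} (A : ι → R2 → R2) (hA : ∀ i, MemLp (A i) 2)
    (F : R2 → R2) (hF : MemLp F 2) :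
    ∃ P : R2 → R2, MemLp P 2 ∧ (∀ i, ∫ y, ⟪A i y, P y⟫_ℝ = 0) ∧
      ∀ f : R2 → R2, MemLp f 2 → (∀ i, ∫ y, ⟪A i y, f y⟫_ℝ = 0) →
        ∫ y, ⟪f y, F y⟫_ℝ = ∫ y, ⟪f y, P y⟫_ℝ := by
  have key : ∀ (f g : R2 → R2) (hf : MemLp f 2) (hg : MemLp g 2),
      ⟪hf.toLp f, hg.toLp g⟫_ℝ = ∫ y, ⟪f y, g y⟫_ℝ := by
    intro f g hf hg
    rw [L2.inner_def]
    refine integral_congr_ae ?_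
    filter_upwards [hf.coeFn_toLp, hg.coeFn_toLp] with y h1 h2
    rw [h1, h2]
  let W : Submodule ℝ (Lp R2 2 (volume : Measure R2)) :=
    (Submodule.span ℝ (range fun i => (hA i).toLp (A i)))ᗮ
  have hW : ∀ g, g ∈ W ↔ ∀ i, ⟪(hA i).toLp (A i), g⟫_ℝ = 0 := by
    intro g
    constructor
    · intro hg i
      exact (Submodule.mem_orthogonal _ _).1 hg _ (Submodule.subset_span ⟨i, rfl⟩)
    · intro hg
      refine (Submodule.mem_orthogonal _ _).2 fun u hu => ?_
      induction hu using Submodule.span_induction with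
      | mem u hu => obtain ⟨i, rfl⟩ := hu; exact hg i
      | zero => simp
      | add u v _ _ h1 h2 => rw [inner_add_left, h1, h2, add_zero]
      | smul c u _ h => rw [inner_smul_left, h, mul_zero]
  let p : Lp R2 2 (volume : Measure R2) := W.starProjection (hF.toLp F)
  have hp : p ∈ W := Submodule.starProjection_apply_mem _ _
  have hpm : MemLp (p : R2 → R2) 2 volume := Lp.memLp p
  have hpe : hpm.toLp (p : R2 → R2) = p := Lp.toLp_coeFn p hpm
  refine ⟨p, hpm, ?_, ?_⟩
  · intro i
    rw [← key _ _ (hA i) hpm, hpe]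
    exact (hW p).1 hp i
  · intro f hf h
    rw [← key _ _ hf hF, ← key _ _ hf hpm, hpe]
    have hfW : hf.toLp f ∈ W := (hW _).2 fun i => by rw [key]; exact h i
    have := Submodule.starProjection_inner_eq_zero (K := W) (hF.toLp F) _ hfW
    rw [inner_sub_left, sub_eq_zero] at this
    rw [real_inner_comm, this, real_inner_comm]

def J (y : R2) : ℝ := (1 + ‖y‖)⁻¹

lemma J_pos (y : R2) : 0 < J y := by unfold J; positivity
lemma J_le_one (y : R2) : J y ≤ 1 := inv_le_one_of_one_le₀ (by linarith [norm_nonneg y])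
lemma continuous_J : Continuous J := by
  unfold J
  refine Continuous.inv₀ (by fun_prop) fun y => by positivity

lemma integrable_J (n : ℕ) (hn : 2 < n) : Integrable (fun y => J y ^ n) := by
  have h := integrable_one_add_norm (E := R2) (μ := volume) (r := n) (by simpa using hn)
  refine h.congr (Filter.Eventually.of_forall fun y => ?_)
  simp only [J]
  rw [Real.rpow_neg (by positivity), Real.rpow_natCast, inv_pow]

lemma integrable_of_J {f : R2 → ℝ} (hf : AEStronglyMeasurable f) (n : ℕ) (hn : 2 < n) (C : ℝ)
    (h : ∀ y, |f y| ≤ C * J y ^ n) : Integrable f :=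
  ((integrable_J n hn).const_mul C).mono' hf (Filter.Eventually.of_forall h)

lemma memLp_of_J {f : R2 → R2} (hf : AEStronglyMeasurable f) (C : ℝ)
    (h : ∀ y, ‖f y‖ ≤ C * J y ^ 2) : MemLp f 2 := by
  rw [memLp_two_iff_integrable_sq_norm hf]
  refine integrable_of_J (hf.norm.pow 2) 4 (by norm_num) (C ^ 2) fun y => ?_
  rw [abs_of_nonneg (by positivity)]
  calc ‖f y‖ ^ 2 ≤ (C * J y ^ 2) ^ 2 := by gcongr; exact h y
    _ = _ := by ring

lemma J_le {δ : ℝ} (hδ : 0 < δ) (p y : R2) {R : ℝ} (hp : ‖p‖ ≤ R) :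
    J (δ⁻¹ • (p - y)) ≤ (1 + R + δ) * J y := by
  unfold J
  rw [← div_eq_mul_inv, le_div_iff₀ (by positivity), inv_mul_le_iff₀ (by positivity)]
  have h1 : ‖y‖ ≤ ‖p‖ + δ * ‖δ⁻¹ • (p - y)‖ := by
    rw [norm_smul, norm_inv, Real.norm_of_nonneg hδ.le, mul_inv_cancel_left₀ hδ.ne']
    calc ‖y‖ = ‖p - (p - y)‖ := by simp
      _ ≤ _ := norm_sub_le _ _
  have := norm_nonneg (δ⁻¹ • (p - y))
  have := norm_nonneg p
  nlinarith

structure Good (ψ : R2 → ℝ) : Prop where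
  diff : Differentiable ℝ ψ
  cont : Continuous (gradient ψ)
  bound : ∃ C, ∀ y, |ψ y| ≤ C * J y ∧ ‖gradient ψ y‖ ≤ C * J y ^ 2

def Dd (x h : R2) (δ : ℝ) (y : R2) : R2 := Kd δ (x + h - y) - Kd δ (x - y)
def Psi (x h : R2) (δ : ℝ) (y : R2) : ℝ := k1 (δ⁻¹ • (x - y)) - k1 (δ⁻¹ • (x + h - y))
def phid (δ : ℝ) (z : R2) : ℝ := (δ ^ 2)⁻¹ * phi1 (δ⁻¹ • z)
def ed (x h : R2) (δ : ℝ) (y : R2) : ℝ := ∫ t in (0:ℝ)..1, phid δ (x + t • h - y)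

lemma hasFDerivAt_aff (δ : ℝ) (p y : R2) : HasFDerivAt (fun y : R2 => δ⁻¹ • (p - y))
    (-(δ⁻¹ • ContinuousLinearMap.id ℝ R2)) y := by
  have := ((hasFDerivAt_id (𝕜 := ℝ) y).const_sub p).const_smul δ⁻¹
  refine HasFDerivAt.congr_fderiv this ?_
  simp

lemma hasGradientAt_k1_aff (δ : ℝ) (p y : R2) :
    HasGradientAt (fun y : R2 => k1 (δ⁻¹ • (p - y))) (- Kd δ (p - y)) y := by
  rw [hasGradientAt_iff_hasFDerivAt]
  have h := (hasGradientAt_iff_hasFDerivAt.1 (hasGradientAt_k1 (δ⁻¹ • (p - y)))).comp y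
    (hasFDerivAt_aff δ p y)
  refine HasFDerivAt.congr_fderiv h ?_
  ext v
  simp [Kd, inner_smul_left, inner_smul_right]

lemma hasGradientAt_Psi (x h : R2) (δ : ℝ) (y : R2) :
    HasGradientAt (Psi x h δ) (Dd x h δ y) y := by
  rw [hasGradientAt_iff_hasFDerivAt]
  have := (hasGradientAt_iff_hasFDerivAt.1 (hasGradientAt_k1_aff δ x y)).sub
    (hasGradientAt_iff_hasFDerivAt.1 (hasGradientAt_k1_aff δ (x + h) y))
  refine HasFDerivAt.congr_fderiv this ?_
  rw [← map_sub]
  congr 1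
  simp [Dd]
  abel

lemma hasFDerivAt_Kd_aff (δ : ℝ) (p y : R2) : HasFDerivAt (fun y : R2 => Kd δ (p - y))
    (-((δ ^ 2)⁻¹ • fderiv ℝ K1 (δ⁻¹ • (p - y)))) y := by
  have h := ((differentiable_K1 (δ⁻¹ • (p - y))).hasFDerivAt.comp y
    (hasFDerivAt_aff δ p y)).const_smul δ⁻¹
  refine HasFDerivAt.congr_fderiv h ?_
  ext v
  simp [pow_two, mul_assoc]

lemma hasFDerivAt_Dd (x h : R2) (δ : ℝ) (y : R2) : HasFDerivAt (Dd x h δ)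
    ((δ ^ 2)⁻¹ • fderiv ℝ K1 (δ⁻¹ • (x - y)) - (δ ^ 2)⁻¹ • fderiv ℝ K1 (δ⁻¹ • (x + h - y))) y := by
  have h := (hasFDerivAt_Kd_aff δ (x + h) y).sub (hasFDerivAt_Kd_aff δ x y)
  refine HasFDerivAt.congr_fderiv h ?_
  abel

lemma continuous_Dd (x h : R2) (δ : ℝ) : Continuous (Dd x h δ) :=
  continuous_iff_continuousAt.2 fun y => (hasFDerivAt_Dd x h δ y).continuousAt

lemma norm_seg (x h : R2) {t : ℝ} (ht : t ∈ Icc (0:ℝ) 1) : ‖x + t • h‖ ≤ ‖x‖ + ‖h‖ := by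
  refine (norm_add_le _ _).trans ?_
  rw [norm_smul, Real.norm_of_nonneg ht.1]
  nlinarith [ht.2, norm_nonneg h]

lemma hasDerivAt_aff (δ : ℝ) (x h y : R2) (t : ℝ) :
    HasDerivAt (fun t : ℝ => δ⁻¹ • (x + t • h - y)) (δ⁻¹ • h) t := by
  have := ((((hasDerivAt_id t).smul_const h).const_add x).sub_const y).const_smul δ⁻¹
  refine HasDerivAt.congr_deriv this ?_
  simp

lemma Psi_bound (x h : R2) (δ : ℝ) (hδ : 0 < δ) (y : R2) :
    |Psi x h δ y| ≤ (16 * |cK| * (1 + (‖x‖ + ‖h‖) + δ) * (δ⁻¹ * ‖h‖)) * J y := by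
  have key := norm_image_sub_le_of_norm_deriv_le_segment_01'
    (f := fun t : ℝ => k1 (δ⁻¹ • (x + t • h - y)))
    (f' := fun t : ℝ => ⟪K1 (δ⁻¹ • (x + t • h - y)), δ⁻¹ • h⟫_ℝ)
    (C := (16 * |cK| * (1 + (‖x‖ + ‖h‖) + δ) * (δ⁻¹ * ‖h‖)) * J y) ?_ ?_
  · simp only [one_smul, zero_smul, add_zero] at key
    rw [Psi, abs_sub_comm]
    exact key
  · intro t _
    have h1 := (hasGradientAt_iff_hasFDerivAt.1 (hasGradientAt_k1 (δ⁻¹ • (x + t • h - y))))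
    have h2 := h1.comp_hasDerivAt t (hasDerivAt_aff δ x h y t)
    refine HasDerivAt.hasDerivWithinAt ?_
    exact h2
  · intro t ht
    refine (norm_inner_le_norm _ _).trans ?_
    have h1 := K1_bound (δ⁻¹ • (x + t • h - y))
    have h2 := J_le hδ (x + t • h) y (norm_seg x h ⟨ht.1, ht.2.le⟩)
    change _ ≤ 16 * |cK| * J _ at h1
    rw [norm_smul, norm_inv, Real.norm_of_nonneg hδ.le]
    calc _ ≤ (16 * |cK| * ((1 + (‖x‖ + ‖h‖) + δ) * J y)) * (δ⁻¹ * ‖h‖) := by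
          gcongr
          exact h1.trans (by gcongr)
      _ = _ := by ring

lemma Dd_bound (x h : R2) (δ : ℝ) (hδ : 0 < δ) (y : R2) :
    ‖Dd x h δ y‖ ≤ (δ⁻¹ * (32 * |cK| * (1 + (‖x‖ + ‖h‖) + δ) ^ 2 * (δ⁻¹ * ‖h‖))) * J y ^ 2 := by
  have key := norm_image_sub_le_of_norm_deriv_le_segment_01'
    (f := fun t : ℝ => K1 (δ⁻¹ • (x + t • h - y)))
    (f' := fun t : ℝ => fderiv ℝ K1 (δ⁻¹ • (x + t • h - y)) (δ⁻¹ • h))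
    (C := (32 * |cK| * (1 + (‖x‖ + ‖h‖) + δ) ^ 2 * (δ⁻¹ * ‖h‖)) * J y ^ 2) ?_ ?_
  · simp only [one_smul, zero_smul, add_zero] at key
    rw [Dd, Kd, Kd, ← smul_sub, norm_smul, norm_inv, Real.norm_of_nonneg hδ.le, mul_assoc]
    gcongr
  · intro t _
    have h1 := (differentiable_K1 (δ⁻¹ • (x + t • h - y))).hasFDerivAt
    have h2 := h1.comp_hasDerivAt t (hasDerivAt_aff δ x h y t)
    exact HasDerivAt.hasDerivWithinAt h2
  · intro t ht
    refine (ContinuousLinearMap.le_opNorm _ _).trans ?_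
    have h1 := fderiv_K1_bound (δ⁻¹ • (x + t • h - y))
    have h2 := J_le hδ (x + t • h) y (norm_seg x h ⟨ht.1, ht.2.le⟩)
    change _ ≤ 32 * |cK| * J _ ^ 2 at h1
    have h3 := (J_pos (δ⁻¹ • (x + t • h - y))).le
    rw [norm_smul, norm_inv, Real.norm_of_nonneg hδ.le]
    calc _ ≤ (32 * |cK| * ((1 + (‖x‖ + ‖h‖) + δ) * J y) ^ 2) * (δ⁻¹ * ‖h‖) := by
          gcongr
          exact h1.trans (by gcongr)
      _ = _ := by ring

lemma fderiv_Dd_bound (x h : R2) (δ : ℝ) (hδ : 0 < δ) (y : R2) :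
    ‖fderiv ℝ (Dd x h δ) y‖ ≤ (2 * ((δ ^ 2)⁻¹ * (32 * |cK| * (1 + (‖x‖ + ‖h‖) + δ) ^ 2))) * J y ^ 2 := by
  have key : ∀ p : R2, ‖p‖ ≤ ‖x‖ + ‖h‖ → ‖(δ ^ 2)⁻¹ • fderiv ℝ K1 (δ⁻¹ • (p - y))‖ ≤
      ((δ ^ 2)⁻¹ * (32 * |cK| * (1 + (‖x‖ + ‖h‖) + δ) ^ 2)) * J y ^ 2 := by
    intro p hp
    have h1 := fderiv_K1_bound (δ⁻¹ • (p - y))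
    have h2 := J_le hδ p y hp
    have h3 := (J_pos (δ⁻¹ • (p - y))).le
    change _ ≤ 32 * |cK| * J _ ^ 2 at h1
    rw [norm_smul, Real.norm_of_nonneg (by positivity)]
    calc _ ≤ (δ ^ 2)⁻¹ * (32 * |cK| * ((1 + (‖x‖ + ‖h‖) + δ) * J y) ^ 2) := by
          gcongr
          exact h1.trans (by gcongr)
      _ = _ := by ring
  rw [(hasFDerivAt_Dd x h δ y).fderiv]
  refine (norm_sub_le _ _).trans ?_
  have h1 := key x (by linarith [norm_nonneg h])
  have h2 := key (x + h) (norm_add_le _ _)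
  linarith

lemma good_Psi (x h : R2) (δ : ℝ) (hδ : 0 < δ) : Good (Psi x h δ) := by
  have hg : gradient (Psi x h δ) = Dd x h δ := gradient_eq (hasGradientAt_Psi x h δ)
  refine ⟨fun y => (hasGradientAt_Psi x h δ y).differentiableAt, ?_, ?_⟩
  · rw [hg]; exact continuous_Dd x h δ
  · rw [hg]
    refine ⟨max (16 * |cK| * (1 + (‖x‖ + ‖h‖) + δ) * (δ⁻¹ * ‖h‖))
      (δ⁻¹ * (32 * |cK| * (1 + (‖x‖ + ‖h‖) + δ) ^ 2 * (δ⁻¹ * ‖h‖))), fun y => ⟨?_, ?_⟩⟩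
    · refine (Psi_bound x h δ hδ y).trans ?_
      have := (J_pos y).le
      gcongr
      exact le_max_left _ _
    · refine (Dd_bound x h δ hδ y).trans ?_
      gcongr
      exact le_max_right _ _

lemma div_Dd (x h : R2) (δ : ℝ) (y : R2) :
    ∑ i, fderiv ℝ (fun y => Dd x h δ y i) y (basis2 i) = phid δ (x + h - y) - phid δ (x - y) := by
  have e : ∀ i : Fin 2, fderiv ℝ (fun y => Dd x h δ y i) y (basis2 i) =
      (δ ^ 2)⁻¹ * (fderiv ℝ K1 (δ⁻¹ • (x - y)) (basis2 i)) i
        - (δ ^ 2)⁻¹ * (fderiv ℝ K1 (δ⁻¹ • (x + h - y)) (basis2 i)) i := by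
    intro i
    have h1 := (EuclideanSpace.proj (𝕜 := ℝ) i).hasFDerivAt.comp y (hasFDerivAt_Dd x h δ y)
    have h2 : HasFDerivAt (fun y => Dd x h δ y i) _ y := h1
    rw [h2.fderiv]
    simp
  simp only [e]
  rw [Finset.sum_sub_distrib, ← Finset.mul_sum, ← Finset.mul_sum, div_K1, div_K1, phid, phid]
  ring

lemma gradient_coord (ψ : R2 → ℝ) (y : R2) (i : Fin 2) :
    gradient ψ y i = fderiv ℝ ψ y (basis2 i) := by
  rw [← inner_gradient_left, basis2, EuclideanSpace.inner_single_right]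
  simp

lemma inner_eq_sum (a b : R2) : ⟪a, b⟫_ℝ = ∑ i, a i * b i := by
  simp [PiLp.inner_apply, mul_comm]

lemma abs_coord_le (a : R2) (i : Fin 2) : |a i| ≤ ‖a‖ := PiLp.norm_apply_le a i

lemma norm_basis2 (i : Fin 2) : ‖basis2 i‖ = 1 := by simp [basis2]

lemma continuous_phid (δ : ℝ) : Continuous (phid δ) := by
  unfold phid
  have := continuous_phi1
  fun_prop

lemma ibp_Dd (x h : R2) (δ : ℝ) (hδ : 0 < δ) {ψ : R2 → ℝ} (hψ : Good ψ) :
    ∫ y, ⟪Dd x h δ y, gradient ψ y⟫_ℝ =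
      - ∫ y, (phid δ (x + h - y) - phid δ (x - y)) * ψ y := by
  obtain ⟨C, hC⟩ := hψ.bound
  have hDc := continuous_Dd x h δ
  obtain ⟨B, hB⟩ : ∃ B, ∀ y, ‖Dd x h δ y‖ ≤ B * J y ^ 2 := ⟨_, Dd_bound x h δ hδ⟩
  obtain ⟨B', hB'⟩ : ∃ B, ∀ y, ‖fderiv ℝ (Dd x h δ) y‖ ≤ B * J y ^ 2 :=
    ⟨_, fderiv_Dd_bound x h δ hδ⟩
  have hdi : ∀ i : Fin 2, Differentiable ℝ (fun y => Dd x h δ y i) := fun i y =>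
    ((EuclideanSpace.proj (𝕜 := ℝ) i).hasFDerivAt.comp y (hasFDerivAt_Dd x h δ y)).differentiableAt
  have hfd : ∀ (i : Fin 2) y, |fderiv ℝ (fun y => Dd x h δ y i) y (basis2 i)| ≤ B' * J y ^ 2 := by
    intro i y
    have h1 := (EuclideanSpace.proj (𝕜 := ℝ) i).hasFDerivAt.comp y
      (hasFDerivAt_Dd x h δ y).differentiableAt.hasFDerivAt
    have h2 : HasFDerivAt (fun y => Dd x h δ y i) _ y := h1
    rw [h2.fderiv]
    refine (abs_coord_le (fderiv ℝ (Dd x h δ) y (basis2 i)) i).trans ?_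
    refine (ContinuousLinearMap.le_opNorm _ _).trans ?_
    rw [norm_basis2, mul_one]
    exact hB' y
  have hgc : ∀ i : Fin 2, Continuous (fun y => fderiv ℝ ψ y (basis2 i)) := by
    intro i
    have := hψ.cont
    simp only [← gradient_coord]
    fun_prop
  have i1 : ∀ i : Fin 2, Integrable (fun y => fderiv ℝ (fun y => Dd x h δ y i) y (basis2 i) * ψ y) := by
    intro i
    refine integrable_of_J (Measurable.aestronglyMeasurable ?_) 3 (by norm_num) (B' * C) fun y => ?_
    · exact (measurable_fderiv_apply_const ℝ _ _).mul hψ.diff.continuous.measurable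
    · rw [abs_mul]
      calc _ ≤ (B' * J y ^ 2) * (C * J y) :=
            mul_le_mul (hfd i y) (hC y).1 (abs_nonneg _) ((abs_nonneg _).trans (hfd i y))
        _ = _ := by ring
  have i2 : ∀ i : Fin 2, Integrable (fun y => Dd x h δ y i * fderiv ℝ ψ y (basis2 i)) := by
    intro i
    refine integrable_of_J (Continuous.aestronglyMeasurable ?_) 4 (by norm_num) (B * C) fun y => ?_
    · exact (hdi i).continuous.mul (hgc i)
    · rw [abs_mul, ← gradient_coord]
      have a1 := (abs_coord_le _ i).trans (hB y)
      have a2 := (abs_coord_le _ i).trans (hC y).2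
      calc _ ≤ (B * J y ^ 2) * (C * J y ^ 2) :=
            mul_le_mul a1 a2 (abs_nonneg _) ((abs_nonneg _).trans a1)
        _ = _ := by ring
  have i3 : ∀ i : Fin 2, Integrable (fun y => Dd x h δ y i * ψ y) := by
    intro i
    refine integrable_of_J (Continuous.aestronglyMeasurable ?_) 3 (by norm_num) (B * C) fun y => ?_
    · exact (hdi i).continuous.mul hψ.diff.continuous
    · rw [abs_mul]
      have a1 := (abs_coord_le _ i).trans (hB y)
      calc _ ≤ (B * J y ^ 2) * (C * J y) :=
            mul_le_mul a1 (hC y).1 (abs_nonneg _) ((abs_nonneg _).trans a1)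
        _ = _ := by ring
  simp only [inner_eq_sum, gradient_coord]
  rw [integral_finset_sum _ fun i _ => i2 i]
  simp only [← div_Dd, Finset.sum_mul]
  rw [integral_finset_sum _ fun i _ => i1 i, ← Finset.sum_neg_distrib]
  refine Finset.sum_congr rfl fun i _ => ?_
  exact integral_mul_fderiv_eq_neg_fderiv_mul_of_integrable (i1 i) (i2 i) (i3 i)
    (fun y _ => hdi i y) (fun y _ => hψ.diff y)

lemma phid_bound (x h : R2) {δ : ℝ} (hδ : 0 < δ) {t : ℝ} (ht : t ∈ Icc (0:ℝ) 1) (y : R2) :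
    |phid δ (x + t • h - y)| ≤
      (Metric.closedBall x (‖h‖ + δ)).indicator (fun _ => (δ ^ 2)⁻¹) y := by
  by_cases hy : y ∈ Metric.closedBall x (‖h‖ + δ)
  · rw [indicator_of_mem hy, phid, abs_mul, abs_of_pos (by positivity)]
    have := phi1_bound (δ⁻¹ • (x + t • h - y))
    have h2 : 0 < (δ ^ 2)⁻¹ := by positivity
    nlinarith
  · rw [indicator_of_notMem hy, phid, phi1_eq_zero, mul_zero, abs_zero]
    rw [norm_smul, norm_inv, Real.norm_of_nonneg hδ.le, inv_mul_eq_div, one_le_div hδ]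
    rw [Metric.mem_closedBall, not_le, dist_comm, dist_eq_norm] at hy
    have : ‖x - y‖ ≤ ‖x + t • h - y‖ + ‖t • h‖ := by
      calc ‖x - y‖ = ‖(x + t • h - y) - t • h‖ := by congr 1; abel
        _ ≤ _ := norm_sub_le _ _
    rw [norm_smul, Real.norm_of_nonneg ht.1] at this
    nlinarith [ht.2, norm_nonneg h]

lemma continuous_ed (x h : R2) (δ : ℝ) : Continuous (ed x h δ) := by
  unfold ed
  have := continuous_phid δ
  refine intervalIntegral.continuous_parametric_intervalIntegral_of_continuous' (f := fun y t => phid δ (x + t • h - y)) ?_ _ _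
  unfold Function.uncurry
  fun_prop

lemma ed_bound (x h : R2) {δ : ℝ} (hδ : 0 < δ) (y : R2) :
    |ed x h δ y| ≤ (Metric.closedBall x (‖h‖ + δ)).indicator (fun _ => (δ ^ 2)⁻¹) y := by
  unfold ed
  have := intervalIntegral.norm_integral_le_of_norm_le_const (a := (0:ℝ)) (b := 1)
    (f := fun t : ℝ => phid δ (x + t • h - y))
    (C := (Metric.closedBall x (‖h‖ + δ)).indicator (fun _ => (δ ^ 2)⁻¹) y) ?_
  · simpa using this
  · intro t ht
    rw [uIoc_of_le zero_le_one] at ht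
    exact phid_bound x h hδ ⟨ht.1.le, ht.2⟩ y

lemma integrable_ball_ind (x : R2) (r c : ℝ) :
    Integrable ((Metric.closedBall x r).indicator (fun _ => c)) := by
  rw [integrable_indicator_iff measurableSet_closedBall]
  exact integrableOn_const measure_closedBall_lt_top.ne

lemma integrable_phid {δ : ℝ} (hδ : 0 < δ) : Integrable (phid δ) :=
  ((integrable_comp_smul_iff volume phi1 (inv_ne_zero hδ.ne')).2 integrable_phi1).const_mul _

lemma integral_phid {δ : ℝ} (hδ : 0 < δ) : ∫ z, phid δ z = 1 := by
  unfold phid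
  rw [integral_const_mul, Measure.integral_comp_smul volume phi1, integral_phi1]
  simp only [finrank_euclideanSpace, Fintype.card_fin, smul_eq_mul]
  rw [abs_of_pos (by positivity)]
  field_simp

/-- Fubini for `ed`. -/
lemma fubini_ed (x h : R2) {δ : ℝ} (hδ : 0 < δ) {g : R2 → ℝ} (hg : Continuous g) {B : ℝ}
    (hB : ∀ y, |g y| ≤ B) :
    ∫ y, ed x h δ y * g y = ∫ t in (0:ℝ)..1, ∫ y, phid δ (x + t • h - y) * g y := by
  have hc := continuous_phid δ
  have hI : Integrable (Function.uncurry fun (t : ℝ) (y : R2) => phid δ (x + t • h - y) * g y)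
      ((volume.restrict (Ioc (0:ℝ) 1)).prod volume) := by
    have hb : Integrable (fun p : ℝ × R2 =>
        (Metric.closedBall x (‖h‖ + δ)).indicator (fun _ => (δ ^ 2)⁻¹) p.2 * B)
        ((volume.restrict (Ioc (0:ℝ) 1)).prod volume) :=
      ((integrable_ball_ind x (‖h‖ + δ) (δ ^ 2)⁻¹).mul_const B).comp_snd _
    refine hb.mono' ?_ ?_
    · refine Continuous.aestronglyMeasurable ?_
      unfold Function.uncurry
      fun_prop
    · have : ∀ᵐ p : ℝ × R2 ∂((volume.restrict (Ioc (0:ℝ) 1)).prod volume), p.1 ∈ Ioc (0:ℝ) 1 :=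
        Measure.quasiMeasurePreserving_fst.ae (ae_restrict_mem measurableSet_Ioc)
      filter_upwards [this] with p hp
      simp only [Function.uncurry, norm_mul, Real.norm_eq_abs]
      have h1 := phid_bound x h hδ ⟨hp.1.le, hp.2⟩ p.2
      exact mul_le_mul h1 (hB _) (abs_nonneg _) ((abs_nonneg _).trans h1)
  rw [intervalIntegral.integral_of_le zero_le_one, integral_integral_swap hI]
  refine integral_congr_ae (Filter.Eventually.of_forall fun y => ?_)
  simp only [ed]
  rw [intervalIntegral.integral_of_le zero_le_one, integral_mul_const]

lemma integral_ed (x h : R2) {δ : ℝ} (hδ : 0 < δ) : ∫ y, ed x h δ y = 1 := by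
  have := fubini_ed x h hδ (g := fun _ => 1) continuous_const (B := 1) (by simp)
  simp only [mul_one] at this
  rw [this]
  have e : ∀ t : ℝ, ∫ y, phid δ (x + t • h - y) = 1 := fun t => by
    rw [integral_sub_left_eq_self (phid δ) volume, integral_phid hδ]
  simp [e]

lemma ftc_ed (x h : R2) {δ : ℝ} (hδ : 0 < δ) {ψ : R2 → ℝ} (hψ : Good ψ) :
    ∫ y, (phid δ (x + h - y) - phid δ (x - y)) * ψ y = ∫ y, ed x h δ y * ⟪h, gradient ψ y⟫_ℝ := by
  obtain ⟨C, hC⟩ := hψ.bound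
  have hgc := hψ.cont
  have hψc := hψ.diff.continuous
  have hc := continuous_phid δ
  have hC0 : 0 ≤ C := by
    have h1 := (abs_nonneg _).trans (hC 0).1
    have := J_pos 0
    by_contra h2
    nlinarith
  have hψb : ∀ y, |ψ y| ≤ C := fun y => (hC y).1.trans (by nlinarith [J_le_one y, J_pos y])
  have hgb : ∀ y, |⟪h, gradient ψ y⟫_ℝ| ≤ ‖h‖ * C := fun y => by
    refine (abs_real_inner_le_norm _ _).trans ?_
    gcongr
    refine (hC y).2.trans ?_
    have := pow_le_one₀ (n := 2) (J_pos y).le (J_le_one y)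
    nlinarith
  have ip := integrable_phid hδ
  have ip1 : ∀ p : R2, Integrable (fun y => phid δ y * ψ (p - y)) := fun p => by
    refine ip.mul_bdd (c := C) ?_ ?_
    · exact (hψc.comp (continuous_const.sub continuous_id)).aestronglyMeasurable
    · exact Filter.Eventually.of_forall fun y => hψb _
  have ch : ∀ (p : R2) (f : R2 → ℝ), ∫ y, phid δ (p - y) * f y = ∫ z, phid δ z * f (p - z) := by
    intro p f
    have := integral_sub_left_eq_self (fun z => phid δ z * f (p - z)) volume p
    simpa using this
  have ip2 : ∀ p : R2, Integrable (fun y => phid δ (p - y) * ψ y) := fun p => by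
    have := (ip1 p).comp_sub_left p
    simpa using this
  rw [fubini_ed x h hδ (by fun_prop) hgb]
  simp only [sub_mul]
  rw [integral_sub (ip2 _) (ip2 _), ch, ch]
  simp only [ch]
  rw [← integral_sub (ip1 _) (ip1 _)]
  have hI : Integrable (Function.uncurry fun (t : ℝ) (z : R2) =>
      phid δ z * ⟪h, gradient ψ (x + t • h - z)⟫_ℝ)
      ((volume.restrict (Ioc (0:ℝ) 1)).prod volume) := by
    have hb : Integrable (fun p : ℝ × R2 => |phid δ p.2| * (‖h‖ * C))
        ((volume.restrict (Ioc (0:ℝ) 1)).prod volume) :=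
      ((ip.abs).mul_const (‖h‖ * C)).comp_snd _
    refine hb.mono' ?_ ?_
    · refine Continuous.aestronglyMeasurable ?_
      unfold Function.uncurry
      fun_prop
    · refine Filter.Eventually.of_forall fun p => ?_
      simp only [Function.uncurry, norm_mul, Real.norm_eq_abs]
      gcongr
      exact hgb _
  rw [intervalIntegral.integral_of_le zero_le_one, integral_integral_swap hI]
  refine integral_congr_ae (Filter.Eventually.of_forall fun z => ?_)
  simp only
  rw [integral_const_mul, ← mul_sub]
  congr 1
  rw [← intervalIntegral.integral_of_le zero_le_one]
  have := intervalIntegral.integral_eq_sub_of_hasDerivAt (a := (0:ℝ)) (b := 1)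
    (f := fun t : ℝ => ψ (x + t • h - z)) (f' := fun t : ℝ => ⟪h, gradient ψ (x + t • h - z)⟫_ℝ) ?_ ?_
  · rw [this]; simp
  · intro t _
    have h1 := (hψ.diff (x + t • h - z)).hasFDerivAt
    have h2 : HasDerivAt (fun t : ℝ => (x + t • h - z)) h t := by
      have := (((hasDerivAt_id t).smul_const h).const_add x).sub_const z
      refine HasDerivAt.congr_deriv this ?_
      simp
    refine (h1.comp_hasDerivAt t h2).congr_deriv ?_
    rw [real_inner_comm, inner_gradient_left]
  · apply Continuous.intervalIntegrable
    fun_prop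

lemma good_memLp {ψ : R2 → ℝ} (hψ : Good ψ) : MemLp (gradient ψ) 2 := by
  obtain ⟨C, hC⟩ := hψ.bound
  exact memLp_of_J hψ.cont.aestronglyMeasurable C fun y => (hC y).2

lemma memLp_ed (x h : R2) {δ : ℝ} (hδ : 0 < δ) : MemLp (fun y => ed x h δ y • h) 2 := by
  have : MemLp ((Metric.closedBall x (‖h‖ + δ)).indicator (fun _ => (δ ^ 2)⁻¹ * ‖h‖)) 2
      (volume : Measure R2) :=
    memLp_indicator_const 2 measurableSet_closedBall _ (Or.inr measure_closedBall_lt_top.ne)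
  refine this.mono ?_ (Filter.Eventually.of_forall fun y => ?_)
  · have := continuous_ed x h δ
    exact Continuous.aestronglyMeasurable (by fun_prop)
  · have := ed_bound x h hδ y
    rw [norm_smul, Real.norm_eq_abs]
    refine le_trans ?_ (le_abs_self _)
    by_cases hy : y ∈ Metric.closedBall x (‖h‖ + δ)
    · rw [indicator_of_mem hy] at this ⊢
      gcongr
    · rw [indicator_of_notMem hy] at this ⊢
      have : |ed x h δ y| = 0 := le_antisymm this (abs_nonneg _)
      rw [this, zero_mul]

lemma integrable_inner_L2 {f g : R2 → R2} (hf : MemLp f 2) (hg : MemLp g 2) :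
    Integrable (fun y => ⟪f y, g y⟫_ℝ) := by
  have := L2.integrable_inner (𝕜 := ℝ) (hf.toLp f) (hg.toLp g)
  refine this.congr ?_
  filter_upwards [hf.coeFn_toLp, hg.coeFn_toLp] with y h1 h2
  rw [h1, h2]

lemma memLp_Dd (x h : R2) {δ : ℝ} (hδ : 0 < δ) : MemLp (Dd x h δ) 2 :=
  memLp_of_J (continuous_Dd x h δ).aestronglyMeasurable _ (Dd_bound x h δ hδ)

/-- The orthogonality relation. -/
lemma ortho (x h : R2) {δ : ℝ} (hδ : 0 < δ) {ψ : R2 → ℝ} (hψ : Good ψ) :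
    ∫ y, ⟪Dd x h δ y + ed x h δ y • h, gradient ψ y⟫_ℝ = 0 := by
  simp only [inner_add_left]
  rw [integral_add (integrable_inner_L2 (memLp_Dd x h hδ) (good_memLp hψ))
    (integrable_inner_L2 (memLp_ed x h hδ) (good_memLp hψ)), ibp_Dd x h δ hδ hψ, ftc_ed x h hδ hψ]
  simp only [inner_smul_left]
  simp

lemma volume_real_closedBall (x : R2) {r : ℝ} (hr : 0 ≤ r) :
    (volume : Measure R2).real (Metric.closedBall x r) = π * r ^ 2 := by
  rw [measureReal_def, EuclideanSpace.volume_closedBall_fin_two]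
  simp [pi_pos.le, hr]
  ring

lemma leb_est (x h : R2) (hh : h ≠ 0) {G : R2 → R2} (hG : MemLp G 2) :
    |(∫ y, ed x h ‖h‖ y * ⟪h, G y⟫_ℝ) - ⟪G x, h⟫_ℝ| ≤
      ‖h‖ * (4 * π * ⨍ y in Metric.closedBall x (2 * ‖h‖), ‖G y - G x‖) := by
  have hδ : 0 < ‖h‖ := norm_pos_iff.2 hh
  have hball : IntegrableOn (fun y => ‖G y - G x‖) (Metric.closedBall x (2 * ‖h‖)) := by
    have h1 : LocallyIntegrable G volume := hG.locallyIntegrable (by norm_num)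
    have h2 := h1.integrableOn_isCompact (isCompact_closedBall x (2 * ‖h‖))
    exact (h2.sub (integrableOn_const measure_closedBall_lt_top.ne)).norm
  have hei : Integrable (ed x h ‖h‖) :=
    (integrable_ball_ind x (‖h‖ + ‖h‖) _).mono' (continuous_ed x h ‖h‖).aestronglyMeasurable
      (Filter.Eventually.of_forall fun y => ed_bound x h hδ y)
  have i1 : Integrable (fun y => ed x h ‖h‖ y * ⟪h, G y⟫_ℝ) := by
    have := integrable_inner_L2 (memLp_ed x h hδ) hG
    refine this.congr (Filter.Eventually.of_forall fun y => ?_)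
    simp [inner_smul_left]
  have i2 : Integrable (fun y => ed x h ‖h‖ y * ⟪h, G x⟫_ℝ) := hei.mul_const _
  have e1 : (∫ y, ed x h ‖h‖ y * ⟪h, G y⟫_ℝ) - ⟪G x, h⟫_ℝ =
      ∫ y, ed x h ‖h‖ y * ⟪h, G y - G x⟫_ℝ := by
    simp only [inner_sub_right, mul_sub]
    rw [integral_sub i1 i2, integral_mul_const, integral_ed x h hδ, one_mul, real_inner_comm]
  have e2 : ‖h‖ * (4 * π * ⨍ y in Metric.closedBall x (2 * ‖h‖), ‖G y - G x‖) =
      ∫ y, (Metric.closedBall x (2 * ‖h‖)).indicator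
        (fun y => (‖h‖ ^ 2)⁻¹ * (‖h‖ * ‖G y - G x‖)) y := by
    rw [integral_indicator measurableSet_closedBall, integral_const_mul, integral_const_mul,
      setAverage_eq, volume_real_closedBall x (by positivity), smul_eq_mul]
    field_simp
    ring
  rw [e1, e2, ← Real.norm_eq_abs]
  refine norm_integral_le_of_norm_le ?_ (Filter.Eventually.of_forall fun y => ?_)
  · rw [integrable_indicator_iff measurableSet_closedBall]
    exact (hball.const_mul _).const_mul _
  · have h1 := ed_bound x h hδ y
    rw [← two_mul] at h1
    rw [norm_mul, Real.norm_eq_abs]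
    by_cases hy : y ∈ Metric.closedBall x (2 * ‖h‖)
    · rw [indicator_of_mem hy] at h1 ⊢
      gcongr
      exact norm_inner_le_norm _ _
    · rw [indicator_of_notMem hy] at h1 ⊢
      have : |ed x h ‖h‖ y| = 0 := le_antisymm h1 (abs_nonneg _)
      rw [this, zero_mul]

lemma bound_aux (A c : ℝ) (hA : 0 ≤ A) (hc : 0 ≤ c) : A * (c / (4 * (A + 1))) ≤ c / 4 := by
  rw [← mul_div_assoc, div_le_div_iff₀ (by positivity) (by norm_num)]
  nlinarith

set_option maxHeartbeats 400000 in
lemma exists_G {F : R2 → R2} (hFc : Continuous F) (hFi : Integrable F) (hF2 : MemLp F 2) {M : ℝ}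
    (hFb : ∀ y, ‖F y‖ ≤ M) :
    ∃ G : R2 → R2, MemLp G 2 ∧ (∀ᵐ x, HasGradientAt (gradKappaConvVec F) (G x) x) ∧
      ∀ ψ, Good ψ → ∫ y, ⟪G y, gradient ψ y⟫_ℝ = - ∫ y, ⟪F y, gradient ψ y⟫_ℝ := by
  obtain ⟨P, hP, hP1, hP2⟩ := exists_projection
    (ι := {p : R2 × R2 × ℝ // 0 < p.2.2})
    (fun p y => Dd p.1.1 p.1.2.1 p.1.2.2 y + ed p.1.1 p.1.2.1 p.1.2.2 y • p.1.2.1)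
    (fun p => (memLp_Dd _ _ p.2).add (memLp_ed _ _ p.2)) F hF2
  have hP3 : ∀ ψ, Good ψ → ∫ y, ⟪gradient ψ y, F y⟫_ℝ = ∫ y, ⟪gradient ψ y, P y⟫_ℝ :=
    fun ψ hψ => hP2 _ (good_memLp hψ) fun p => ortho _ _ p.2 hψ
  have hG : MemLp (fun y => - P y) 2 := hP.neg
  refine ⟨fun y => - P y, hG, ?_, ?_⟩
  · have rep : ∀ (x h : R2) (δ : ℝ), 0 < δ →
        (∫ y, ⟪Kd δ (x + h - y), F y⟫_ℝ) - (∫ y, ⟪Kd δ (x - y), F y⟫_ℝ) =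
          ∫ y, ed x h δ y * ⟪h, - P y⟫_ℝ := by
      intro x h δ hδ
      rw [← integral_sub (integrable_inner_Kd δ hFi _) (integrable_inner_Kd δ hFi _)]
      simp only [← inner_sub_left]
      have h1 := hP3 _ (good_Psi x h δ hδ)
      rw [gradient_eq (hasGradientAt_Psi x h δ)] at h1
      have h2 := hP1 ⟨(x, h, δ), hδ⟩
      simp only [inner_add_left] at h2
      rw [integral_add (integrable_inner_L2 (memLp_Dd x h hδ) hP)
        (integrable_inner_L2 (memLp_ed x h hδ) hP)] at h2
      have h3 : ∫ y, ed x h δ y * ⟪h, - P y⟫_ℝ = - ∫ y, ⟪ed x h δ y • h, P y⟫_ℝ := by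
        rw [← integral_neg]
        refine integral_congr_ae (Filter.Eventually.of_forall fun y => ?_)
        simp [inner_smul_left]
      rw [h3]
      change ∫ y, ⟪Dd x h δ y, F y⟫_ℝ = _
      rw [h1]
      linarith
    have hloc : LocallyIntegrable (fun y => - P y) volume := hG.locallyIntegrable (by norm_num)
    filter_upwards [IsUnifLocDoublingMeasure.ae_tendsto_average_norm_sub (volume : Measure R2)
      hloc 1] with x hx
    have hav := hx (l := nhdsWithin (0 : R2) {0}ᶜ) (fun _ => x) (fun h : R2 => 2 * ‖h‖) ?_ ?_
    · rw [hasGradientAt_iff_isLittleO_nhds_zero, Asymptotics.isLittleO_iff]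
      intro c hc
      set A := ∫ z, ‖N1 z‖ with hA
      have hA0 : 0 ≤ A := integral_nonneg fun z => norm_nonneg _
      set η := c / (4 * (A + 1)) with hη
      have hη0 : 0 < η := by positivity
      obtain ⟨r, hr, hFr⟩ := Metric.continuousAt_iff.1 (hFc.continuousAt (x := x)) η hη0
      have hav2 : ∀ᶠ h in nhdsWithin (0 : R2) {0}ᶜ,
          ⨍ y in Metric.closedBall x (2 * ‖h‖), ‖(- P y) - (- P x)‖ < c / (8 * π) :=
        hav.eventually_lt_const (by positivity)
      rw [eventually_nhdsWithin_iff] at hav2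
      filter_upwards [hav2, Metric.ball_mem_nhds (0 : R2) (by positivity : 0 < r / 2)] with h h1 h2
      rcases eq_or_ne h 0 with h0 | h0
      · simp [h0]
      have h1 := h1 h0
      have hδ : 0 < ‖h‖ := norm_pos_iff.2 h0
      rw [mem_ball_zero_iff] at h2
      have hF' : ∀ y, ‖y - x‖ ≤ 2 * ‖h‖ → ‖F y - F x‖ ≤ η := by
        intro y hy
        have := hFr (x := y) (by rw [dist_eq_norm]; linarith)
        rw [dist_eq_norm] at this
        exact this.le
      have n1 := near_est hFi hFb (x + h) ‖h‖ hδ (F x) η (by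
        intro y hy
        apply hF'
        calc ‖y - x‖ = ‖(y - (x + h)) + h‖ := by congr 1; abel
          _ ≤ ‖y - (x + h)‖ + ‖h‖ := norm_add_le _ _
          _ ≤ _ := by linarith)
      have n2 := near_est hFi hFb x ‖h‖ hδ (F x) η (by
        intro y hy
        apply hF'
        linarith)
      have n3 := leb_est x h h0 hG
      rw [← rep x h ‖h‖ hδ] at n3
      rw [← hA] at n1 n2
      have b1 : ‖h‖ * A * η ≤ ‖h‖ * (c / 4) := by
        have q : A * η ≤ c / 4 := bound_aux A c hA0 hc.le
        rw [mul_assoc]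
        exact mul_le_mul_of_nonneg_left q hδ.le
      have b2 : ‖h‖ * (4 * π * ⨍ y in Metric.closedBall x (2 * ‖h‖), ‖(- P y) - (- P x)‖) ≤
          ‖h‖ * (c / 2) := by
        refine mul_le_mul_of_nonneg_left ?_ hδ.le
        refine (mul_le_mul_of_nonneg_left h1.le (by positivity)).trans (le_of_eq ?_)
        field_simp; norm_num
      rw [Real.norm_eq_abs]
      rw [abs_le] at n1 n2 n3 ⊢
      constructor <;> linarith [n1.1, n1.2, n2.1, n2.2, n3.1, n3.2]
    · refine tendsto_nhdsWithin_iff.2 ⟨?_, ?_⟩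
      · have : Filter.Tendsto (fun h : R2 => 2 * ‖h‖) (nhds 0) (nhds (2 * ‖(0 : R2)‖)) :=
          (continuous_const.mul continuous_norm).tendsto 0
        simp only [norm_zero, mul_zero] at this
        exact this.mono_left nhdsWithin_le_nhds
      · filter_upwards [self_mem_nhdsWithin] with h hh
        have : 0 < ‖h‖ := norm_pos_iff.2 hh
        simpa using this
    · refine Filter.Eventually.of_forall fun h => ?_
      simp
  · intro ψ hψ
    have := hP3 ψ hψ
    simp only [inner_neg_left]
    rw [integral_neg]
    congr 1
    have e1 : ∀ f : R2 → R2, ∫ y, ⟪f y, gradient ψ y⟫_ℝ = ∫ y, ⟪gradient ψ y, f y⟫_ℝ := fun f =>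
      integral_congr_ae (Filter.Eventually.of_forall fun y => real_inner_comm _ _)
    rw [e1 P, e1 F]
    exact this.symm

/-- Coordinate derivative of a Schwartz function, as a Schwartz function. -/
def SD (i : Fin 2) (w : SchwartzMap R2 ℝ) : SchwartzMap R2 ℝ :=
  LineDeriv.lineDerivOp (basis2 i) w

lemma SD_apply (i : Fin 2) (w : SchwartzMap R2 ℝ) (x : R2) :
    SD i w x = fderiv ℝ w x (basis2 i) := rfl

lemma pd_eq (i : Fin 2) (w : SchwartzMap R2 ℝ) : pd i w = SD i w := rfl

lemma SD_comm (i j : Fin 2) (w : SchwartzMap R2 ℝ) : SD i (SD j w) = SD j (SD i w) := by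
  ext x
  have h2 : ∀ a b : Fin 2, SD a (SD b w) x = fderiv ℝ (fderiv ℝ w) x (basis2 a) (basis2 b) := by
    intro a b
    have hd : DifferentiableAt ℝ (fderiv ℝ w) x :=
      (SchwartzMap.fderivCLM ℝ R2 ℝ w).differentiableAt
    have : HasFDerivAt (fun y => fderiv ℝ w y (basis2 b))
        ((ContinuousLinearMap.apply ℝ ℝ (basis2 b)).comp (fderiv ℝ (fderiv ℝ w) x)) x :=
      (ContinuousLinearMap.apply ℝ ℝ (basis2 b)).hasFDerivAt.comp x hd.hasFDerivAt
    have e : fderiv ℝ (SD b w) x = _ := this.fderiv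
    rw [SD_apply, e]
    rfl
  rw [h2, h2]
  have : IsSymmSndFDerivAt ℝ w x := (w.smooth 2).contDiffAt.isSymmSndFDerivAt (by simp)
  exact this _ _

lemma S_int (f g : SchwartzMap R2 ℝ) : Integrable (fun x => f x * g x) :=
  (f.memLp 2).integrable_mul (g.memLp 2)

lemma S_ibp (i : Fin 2) (f g : SchwartzMap R2 ℝ) :
    ∫ x, f x * SD i g x = - ∫ x, SD i f x * g x :=
  SchwartzMap.integral_mul_lineDerivOp_right_eq_neg_left f g (basis2 i)

lemma coord_tg (i : Fin 2) : Function.HasTemperateGrowth (fun x : R2 => x i) :=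
  (EuclideanSpace.proj (𝕜 := ℝ) i : R2 →L[ℝ] ℝ).hasTemperateGrowth

def SX (i : Fin 2) (w : SchwartzMap R2 ℝ) : SchwartzMap R2 ℝ :=
  SchwartzMap.smulLeftCLM ℝ (fun x : R2 => x i) w

lemma SX_apply (i : Fin 2) (w : SchwartzMap R2 ℝ) (x : R2) : SX i w x = x i * w x := by
  simp [SX, SchwartzMap.smulLeftCLM_apply_apply (coord_tg i)]

lemma SD_SX (j i : Fin 2) (w : SchwartzMap R2 ℝ) (x : R2) :
    SD j (SX i w) x = (if i = j then w x else 0) + x i * SD j w x := by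
  have h1 : HasFDerivAt (fun x : R2 => x i) (EuclideanSpace.proj (𝕜 := ℝ) i : R2 →L[ℝ] ℝ) x :=
    (EuclideanSpace.proj (𝕜 := ℝ) i : R2 →L[ℝ] ℝ).hasFDerivAt
  have h := h1.mul (w.hasFDerivAt x)
  have e : (⇑(SX i w)) = fun x => x i * w x := funext fun x => SX_apply i w x
  rw [SD_apply, e]
  erw [h.fderiv]
  simp [SD_apply, basis2]
  split_ifs <;> ring

lemma S_inner (f g : SchwartzMap R2 ℝ) (x : R2) :
    ⟪gradient f x, gradient g x⟫_ℝ = ∑ j, SD j f x * SD j g x := by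
  rw [inner_eq_sum]
  simp only [gradient_coord]
  rfl

lemma S_inner_int (f g : SchwartzMap R2 ℝ) :
    Integrable (fun x => ⟪gradient f x, gradient g x⟫_ℝ) := by
  simp only [S_inner]
  exact integrable_finsetSum _ fun j _ => S_int _ _

lemma S_inner_integral (f g : SchwartzMap R2 ℝ) :
    ∫ x, ⟪gradient f x, gradient g x⟫_ℝ = ∑ j, ∫ x, SD j f x * SD j g x := by
  simp only [S_inner]
  exact integral_finsetSum _ fun j _ => S_int _ _

def SL (w : SchwartzMap R2 ℝ) : SchwartzMap R2 ℝ := SD 0 (SD 0 w) + SD 1 (SD 1 w)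

def SE (w : SchwartzMap R2 ℝ) : SchwartzMap R2 ℝ := SX 0 (SD 0 w) + SX 1 (SD 1 w)

lemma SL_eq (w : SchwartzMap R2 ℝ) : lap w = SL w := by
  funext x
  simp [lap, SL, pd_eq, Fin.sum_univ_two]

lemma SE_eq (w : SchwartzMap R2 ℝ) : (fun x => ⟪x, gradient w x⟫_ℝ) = SE w := by
  funext x
  rw [inner_eq_sum]
  simp only [gradient_coord]
  simp [SE, SX_apply, Fin.sum_univ_two, SD_apply]

lemma SD_add (i : Fin 2) (f g : SchwartzMap R2 ℝ) : SD i (f + g) = SD i f + SD i g :=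
  LineDeriv.lineDerivOp_add _ _ _

lemma SL_int (w : SchwartzMap R2 ℝ) :
    ∫ x, ⟪gradient (SL w) x, gradient w x⟫_ℝ = - ∫ x, hessSq w x := by
  have key : ∀ i j, ∫ x, SD j (SD i (SD i w)) x * SD j w x =
      - ∫ x, SD i (SD j w) x * SD i (SD j w) x := by
    intro i j
    have := S_ibp i (SD j w) (SD j (SD i w))
    rw [SD_comm i j (SD i w)] at this
    rw [SD_comm i j w, ← SD_comm i j w] at *
    simp only [mul_comm (SD j w _)] at this
    rw [this, SD_comm i j w]
  have h1 : ∫ x, hessSq w x = ∑ i, ∑ j, ∫ x, SD i (SD j w) x * SD i (SD j w) x := by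
    simp only [hessSq, pd_eq, sq]
    rw [integral_finsetSum _ fun i _ => integrable_finsetSum _ fun j _ => S_int _ _]
    refine Finset.sum_congr rfl fun i _ => ?_
    rw [integral_finsetSum _ fun j _ => S_int _ _]
  have h2 : ∀ j, ∫ x, SD j (SL w) x * SD j w x = ∑ i, ∫ x, SD j (SD i (SD i w)) x * SD j w x := by
    intro j
    rw [Fin.sum_univ_two, ← integral_add (S_int _ _) (S_int _ _)]
    simp only [SL, SD_add, add_apply, add_mul]
  rw [S_inner_integral, h1]
  simp only [h2, key, Finset.sum_neg_distrib]
  rw [Finset.sum_comm]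

lemma X_ibp (i : Fin 2) (v : SchwartzMap R2 ℝ) :
    ∫ x, SX i v x * SD i v x = - (1 / 2) * ∫ x, v x * v x := by
  have h := S_ibp i (SX i v) v
  have e : ∫ x, SD i (SX i v) x * v x = (∫ x, v x * v x) + ∫ x, SX i v x * SD i v x := by
    rw [← integral_add (S_int _ _) (S_int _ _)]
    refine integral_congr_ae (Filter.Eventually.of_forall fun x => ?_)
    simp only [SD_SX, SX_apply, if_true]
    ring
  rw [e] at h
  linarith

lemma SE_int (w : SchwartzMap R2 ℝ) :
    ∫ x, ⟪gradient (SE w) x, gradient w x⟫_ℝ = 0 := by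
  rw [S_inner_integral]
  refine Finset.sum_eq_zero fun j _ => ?_
  have : ∫ x, SD j (SE w) x * SD j w x = (∫ x, SD j w x * SD j w x) +
      ((∫ x, SX 0 (SD j w) x * SD 0 (SD j w) x) + ∫ x, SX 1 (SD j w) x * SD 1 (SD j w) x) := by
    have hI : Integrable (fun x => SX 0 (SD j w) x * SD 0 (SD j w) x +
        SX 1 (SD j w) x * SD 1 (SD j w) x) := (S_int _ _).add (S_int _ _)
    rw [← integral_add (S_int _ _) (S_int _ _), ← integral_add (S_int _ _) hI]
    refine integral_congr_ae (Filter.Eventually.of_forall fun x => ?_)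
    have e0 : SD j (SD 0 w) x = SD 0 (SD j w) x := by rw [SD_comm]
    have e1 : SD j (SD 1 w) x = SD 1 (SD j w) x := by rw [SD_comm]
    simp only [SE, SD_add, add_apply, SD_SX, SX_apply, e0, e1]
    fin_cases j <;> simp <;> ring
  rw [this, X_ibp, X_ibp]
  ring

lemma S_decay (f : SchwartzMap R2 ℝ) (k n : ℕ) :
    ∃ C, ∀ x, ‖iteratedFDeriv ℝ n f x‖ ≤ C * J x ^ k := by
  refine ⟨2 ^ k * (Finset.Iic (k, n)).sup (fun m => SchwartzMap.seminorm ℝ m.1 m.2) f,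
    fun x => ?_⟩
  have h := SchwartzMap.one_add_le_sup_seminorm_apply (𝕜 := ℝ) (m := (k, n)) le_rfl le_rfl f x
  have hp : 0 < (1 + ‖x‖) ^ k := by positivity
  rw [J, inv_pow, ← div_eq_mul_inv, le_div_iff₀ hp, mul_comm]
  exact h

lemma S_grad_decay (f : SchwartzMap R2 ℝ) (k : ℕ) :
    ∃ C, ∀ x, ‖gradient f x‖ ≤ C * J x ^ k := by
  obtain ⟨C, h⟩ := S_decay f k 1
  refine ⟨C, fun x => ?_⟩
  have := h x
  rw [norm_iteratedFDeriv_one] at this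
  rw [gradient, LinearIsometryEquiv.norm_map]
  exact this

lemma S_grad_cont (f : SchwartzMap R2 ℝ) : Continuous (gradient f) :=
  (InnerProductSpace.toDual ℝ R2).symm.continuous.comp
    (SchwartzMap.fderivCLM ℝ R2 ℝ f).continuous

lemma S_good (f : SchwartzMap R2 ℝ) : Good f where
  diff := f.differentiable
  cont := S_grad_cont f
  bound := by
    obtain ⟨C1, h1⟩ := S_decay f 1 0
    obtain ⟨C2, h2⟩ := S_grad_decay f 2
    refine ⟨max C1 C2, fun y => ⟨?_, ?_⟩⟩
    · have := h1 y
      rw [norm_iteratedFDeriv_zero, Real.norm_eq_abs, pow_one] at this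
      exact this.trans (mul_le_mul_of_nonneg_right (le_max_left _ _) (J_pos y).le)
    · exact (h2 y).trans (mul_le_mul_of_nonneg_right (le_max_right _ _) (pow_nonneg (J_pos y).le _))

/-- `∫ ∇(Lw)·∇w = −(1/ε) ∫ |∇²w|² − ∫ Q |∇w|²` for Schwartz `w`. -/
theorem stmt12 (ε μ C a : ℝ) (hε : 0 < ε) (hμ : 0 < μ) (hC : 0 < C) (ha : 0 < a)
    (Q : R2 → ℝ) (hQc : Continuous Q)
    (hQ : ∀ x, 0 ≤ Q x ∧ Q x ≤ C * Real.exp (-(a * ‖x‖ ^ 2))) :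
    ∀ w : SchwartzMap R2 ℝ,
      (∫ x : R2, ⟪gradient (fun y => L22Op μ ε Q (⇑w) y) x, gradient (⇑w) x⟫_ℝ) =
        -(1 / ε) * (∫ x : R2, hessSq (⇑w) x) - ∫ x : R2, Q x * ‖gradient (⇑w) x‖ ^ 2 := by
  intro w
  have hQb : ∀ x, |Q x| ≤ C := by
    intro x
    rw [abs_of_nonneg (hQ x).1]
    refine (hQ x).2.trans ?_
    have : Real.exp (-(a * ‖x‖ ^ 2)) ≤ 1 := Real.exp_le_one_iff.2 (by
      have : 0 ≤ a * ‖x‖ ^ 2 := by positivity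
      linarith)
    nlinarith
  have hw := S_good w
  have hFc : Continuous (fun y => Q y • gradient w y) := hQc.smul hw.cont
  have hFJ : ∀ k, ∃ D, ∀ y, ‖Q y • gradient w y‖ ≤ D * J y ^ k := by
    intro k
    obtain ⟨D, hD⟩ := S_grad_decay w k
    refine ⟨C * D, fun y => ?_⟩
    rw [norm_smul, Real.norm_eq_abs, mul_assoc]
    exact mul_le_mul (hQb y) (hD y) (norm_nonneg _) hC.le
  obtain ⟨D0, hD0⟩ := hFJ 0
  obtain ⟨D2, hD2⟩ := hFJ 2
  obtain ⟨D3, hD3⟩ := hFJ 3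
  have hF2 : MemLp (fun y => Q y • gradient w y) 2 := memLp_of_J hFc.aestronglyMeasurable D2 hD2
  have hFi : Integrable (fun y => Q y • gradient w y) := by
    refine (integrable_norm_iff hFc.aestronglyMeasurable).1 ?_
    refine integrable_of_J hFc.norm.aestronglyMeasurable 3 (by norm_num) D3 fun y => ?_
    rw [abs_norm]
    exact hD3 y
  obtain ⟨G, hG2, hGd, hGi⟩ := exists_G hFc hFi hF2 (M := D0) fun y => by simpa using hD0 y
  have hae : ∀ᵐ x, ⟪gradient (fun y => L22Op μ ε Q (⇑w) y) x, gradient (⇑w) x⟫_ℝ =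
      ((1 / ε) * ⟪gradient (SL w) x, gradient w x⟫_ℝ + μ * ⟪gradient (SE w) x, gradient w x⟫_ℝ)
        + ⟪G x, gradient w x⟫_ℝ := by
    filter_upwards [hGd] with x hx
    have e : (fun y => L22Op μ ε Q (⇑w) y) = fun y => ((1 / ε) * SL w y + μ * SE w y) +
        gradKappaConvVec (fun y => Q y • gradient w y) y := by
      funext y
      rw [← SL_eq, ← SE_eq]
      rfl
    have d := (((SL w).hasFDerivAt x).const_mul (1 / ε)).add
      (((SE w).hasFDerivAt x).const_mul μ) |>.add hx.hasFDerivAt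
    rw [inner_gradient_left, inner_gradient_left, inner_gradient_left, e]
    erw [d.fderiv]
    simp
  rw [integral_congr_ae hae]
  have i1 := (S_inner_int (SL w) w).const_mul (1 / ε)
  have i2 := (S_inner_int (SE w) w).const_mul μ
  have i3 := integrable_inner_L2 hG2 (good_memLp hw)
  have i12 : Integrable (fun x => (1 / ε) * ⟪gradient (SL w) x, gradient w x⟫_ℝ +
      μ * ⟪gradient (SE w) x, gradient w x⟫_ℝ) := i1.add i2
  rw [integral_add i12 i3, integral_add i1 i2, integral_const_mul, integral_const_mul,
    SL_int, SE_int, hGi w hw]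
  have : ∀ x, ⟪Q x • gradient w x, gradient w x⟫_ℝ = Q x * ‖gradient w x‖ ^ 2 := by
    intro x
    rw [real_inner_smul_left, real_inner_self_eq_norm_sq]
  simp only [this]
  ring

end
end
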